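/- There is an absolute constant C > 0 such that for every real x ≥ 10 and every subset ℐ of {n ∈ ℕ : 1 ≤ n ≤ x} on which the Euler totient function φ is nondecreasing, one has ∑_{n ∈ ℐ} 1/n ≤ log log x + C. -/

import Mathlib

open scoped BigOperators

/-- `t ↦ {t}` on `(1, ∞)`, extended by zero. -/
noncomputable def fractTail : ℝ → ℂ :=
  Set.indicator (Set.Ioi 1) fun t => ((Int.fract t : ℝ) : ℂ)

lemma norm_fractTail_le (t : ℝ) : ‖fractTail t‖ ≤ 1 := by
  unfold fractTail
  by_cases h : t ∈ Set.Ioi (1 : ℝ)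
  · rw [Set.indicator_of_mem h, Complex.norm_real, Real.norm_of_nonneg (Int.fract_nonneg t)]
    exact (Int.fract_lt_one t).le
  · simp [h]

lemma measurable_fractTail : Measurable fractTail :=
  (Complex.measurable_ofReal.comp measurable_fract).indicator measurableSet_Ioi

/-- The analytic continuation of `(s - 1) ζ(s)` to `0 < re s`. -/
noncomputable def zetaPoleFree (s : ℂ) : ℂ := s - s * (s - 1) * mellin fractTail (-s)

lemma differentiableAt_zetaPoleFree {s : ℂ} (hs : 0 < s.re) :
    DifferentiableAt ℂ zetaPoleFree s := by
  have h : DifferentiableAt ℂ (mellin fractTail) (-s) := by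
    refine mellin_differentiableAt_of_isBigO_rpow (a := 0) (b := -s.re - 1) ?_ ?_ ?_ ?_ ?_
    · refine MeasureTheory.LocallyIntegrable.locallyIntegrableOn ?_ _
      refine (MeasureTheory.locallyIntegrable_const (1 : ℝ)).mono
        measurable_fractTail.aestronglyMeasurable (Filter.Eventually.of_forall fun t => ?_)
      simpa using norm_fractTail_le t
    · refine Asymptotics.IsBigO.of_bound 1 (Filter.Eventually.of_forall fun t => ?_)
      simpa using norm_fractTail_le t
    · simpa using hs
    · refine Filter.EventuallyEq.trans_isBigO (f₂ := fun _ => (0 : ℂ)) ?_ (Asymptotics.isBigO_zero _ _)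
      have : Set.Ioo (0 : ℝ) 1 ∈ nhdsWithin (0 : ℝ) (Set.Ioi 0) := Ioo_mem_nhdsGT one_pos
      filter_upwards [this] with t ht
      simp [fractTail, ht.2.le]
    · simp
  unfold zetaPoleFree
  have h2 : DifferentiableAt ℂ (fun s => mellin fractTail (-s)) s :=
    DifferentiableAt.comp (f := fun s : ℂ => -s) (g := mellin fractTail) s h (by fun_prop)
  exact differentiableAt_id.sub
    ((differentiableAt_id.mul (differentiableAt_id.sub_const 1)).mul h2)

lemma mellin_fractTail (s : ℂ) : mellin fractTail (-s) =
    ∫ t in Set.Ioi (1 : ℝ), (t : ℂ) ^ (-s - 1) * ((Int.fract t : ℝ) : ℂ) := by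
  unfold mellin fractTail
  simp_rw [smul_eq_mul]
  have : ∀ t : ℝ, (t : ℂ) ^ (-s - 1) * (Set.Ioi (1:ℝ)).indicator
      (fun t => ((Int.fract t : ℝ) : ℂ)) t = (Set.Ioi (1:ℝ)).indicator
      (fun t => (t : ℂ) ^ (-s - 1) * ((Int.fract t : ℝ) : ℂ)) t := by
    intro t
    by_cases h : t ∈ Set.Ioi (1 : ℝ) <;> simp [h]
  simp_rw [this]
  rw [MeasureTheory.setIntegral_indicator measurableSet_Ioi, Set.Ioi_inter_Ioi]
  simp

lemma norm_mellin_fractTail_le {s : ℂ} (hs : 0 < s.re) :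
    ‖mellin fractTail (-s)‖ ≤ 1 / s.re := by
  rw [mellin_fractTail]
  have hI : MeasureTheory.IntegrableOn (fun t : ℝ => t ^ (-s.re - 1)) (Set.Ioi 1) :=
    integrableOn_Ioi_rpow_of_lt (by linarith) one_pos
  refine (MeasureTheory.norm_integral_le_of_norm_le hI ?_).trans_eq ?_
  · refine (MeasureTheory.ae_restrict_iff' measurableSet_Ioi).2 (Filter.Eventually.of_forall ?_)
    intro t ht
    have ht0 : (0 : ℝ) < t := lt_trans one_pos ht
    rw [norm_mul, Complex.norm_cpow_eq_rpow_re_of_pos ht0, Complex.norm_real,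
      Real.norm_of_nonneg (Int.fract_nonneg t)]
    simp only [Complex.sub_re, Complex.neg_re, Complex.one_re]
    exact mul_le_of_le_one_right (by positivity) (Int.fract_lt_one t).le
  · rw [integral_Ioi_rpow_of_lt (by linarith) one_pos]
    simp

lemma zetaPoleFree_eq_of_one_lt_re {s : ℂ} (hs : 1 < s.re) :
    zetaPoleFree s = (s - 1) * riemannZeta s := by
  have h1 : riemannZeta s = s * ∫ t in Set.Ioi (1 : ℝ), ((⌊t⌋₊ : ℝ) : ℂ) * (t : ℂ) ^ (-(s + 1)) := by
    rw [← LSeries_one_eq_riemannZeta hs]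
    have := LSeries_eq_mul_integral (fun _ => (1 : ℂ)) (r := 1) zero_le_one hs
      (LSeriesSummable_one_iff.2 hs) (by
        simp only [Finset.sum_const, Nat.card_Icc, add_tsub_cancel_right, nsmul_eq_mul, mul_one]
        refine Asymptotics.IsBigO.of_bound 1 (Filter.Eventually.of_forall fun n => ?_)
        simp)
    simpa [Pi.one_def] using this
  have hs0 : s ≠ 0 := by rintro rfl; norm_num at hs
  have hs1 : s - 1 ≠ 0 := by intro h; rw [sub_eq_zero] at h; rw [h] at hs; norm_num at hs
  have hIc : MeasureTheory.IntegrableOn (fun t : ℝ => (t : ℂ) ^ (-s)) (Set.Ioi 1) :=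
    integrableOn_Ioi_cpow_of_lt (by simpa using hs) one_pos
  have hIf : MeasureTheory.IntegrableOn
      (fun t : ℝ => (t : ℂ) ^ (-s - 1) * ((Int.fract t : ℝ) : ℂ)) (Set.Ioi 1) := by
    have := integrableOn_Ioi_cpow_of_lt (a := -s - 1) (c := 1) (by simp; linarith) one_pos
    refine MeasureTheory.Integrable.mul_bdd (c := 1) this
      (Complex.measurable_ofReal.comp measurable_fract).aestronglyMeasurable
      (Filter.Eventually.of_forall fun t => ?_)
    rw [Complex.norm_real, Real.norm_of_nonneg (Int.fract_nonneg t)]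
    exact (Int.fract_lt_one t).le
  have h2 : (∫ t in Set.Ioi (1 : ℝ), ((⌊t⌋₊ : ℝ) : ℂ) * (t : ℂ) ^ (-(s + 1))) =
      1 / (s - 1) - mellin fractTail (-s) := by
    have h3 : (∫ t in Set.Ioi (1 : ℝ), (t : ℂ) ^ (-s)) = 1 / (s - 1) := by
      rw [integral_Ioi_cpow_of_lt (by simpa using hs) one_pos]
      have : -s + 1 ≠ 0 := by intro h; apply hs1; linear_combination -h
      simp only [Complex.ofReal_one, Complex.one_cpow]
      field_simp
      ring
    rw [mellin_fractTail, ← h3, ← MeasureTheory.integral_sub hIc hIf]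
    refine MeasureTheory.setIntegral_congr_fun measurableSet_Ioi fun t ht => ?_
    have ht0 : (0 : ℝ) < t := lt_trans one_pos ht
    have ht' : (t : ℂ) ≠ 0 := by exact_mod_cast ht0.ne'
    have hfl : ((⌊t⌋₊ : ℝ) : ℂ) = (t : ℂ) - ((Int.fract t : ℝ) : ℂ) := by
      have : (⌊t⌋₊ : ℝ) = t - Int.fract t := by
        rw [natCast_floor_eq_intCast_floor ht0.le]; exact (Int.self_sub_fract t).symm
      rw [this]; push_cast; ring
    have hp : (t : ℂ) ^ (-s) = t * (t : ℂ) ^ (-s - 1) := by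
      rw [Complex.cpow_sub _ _ ht', Complex.cpow_one]; field_simp
    rw [hfl, hp, show -(s + 1) = -s - 1 by ring]
    ring
  rw [h1, h2, zetaPoleFree]
  field_simp

lemma norm_zetaPoleFree_le {s : ℂ} (hs : 1 / 2 ≤ s.re) (hs' : s.re ≤ 3) :
    ‖zetaPoleFree s‖ ≤ 20 * (1 + |s.im|) ^ 2 := by
  have h1 : ‖s‖ ≤ 3 + |s.im| := (Complex.norm_le_abs_re_add_abs_im s).trans (by
    rw [abs_of_nonneg (by linarith : 0 ≤ s.re)]; linarith)
  have h2 : ‖s - 1‖ ≤ 2 + |s.im| := (Complex.norm_le_abs_re_add_abs_im _).trans (by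
    simp only [Complex.sub_re, Complex.one_re, Complex.sub_im, Complex.one_im, sub_zero]
    have : |s.re - 1| ≤ 2 := abs_le.2 ⟨by linarith, by linarith⟩
    linarith)
  have h3 := norm_mellin_fractTail_le (s := s) (by linarith)
  have h4 : 1 / s.re ≤ 2 := by rw [div_le_iff₀ (by linarith)]; linarith
  have h5 := abs_nonneg s.im
  calc ‖zetaPoleFree s‖ ≤ ‖s‖ + ‖s‖ * ‖s - 1‖ * ‖mellin fractTail (-s)‖ := by
        unfold zetaPoleFree
        refine (norm_sub_le _ _).trans ?_
        rw [norm_mul, norm_mul]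
    _ ≤ (3 + |s.im|) + (3 + |s.im|) * (2 + |s.im|) * 2 := by
        gcongr
        exact h3.trans h4
    _ ≤ 20 * (1 + |s.im|) ^ 2 := by nlinarith

lemma zetaPoleFree_ne_zero {s : ℂ} (hs : 1 ≤ s.re) : zetaPoleFree s ≠ 0 := by
  by_cases h1 : s = 1
  · subst h1; simp [zetaPoleFree]
  have hs1 : s - 1 ≠ 0 := sub_ne_zero.2 h1
  have key : zetaPoleFree s = (s - 1) * riemannZeta s := by
    have t1 : Filter.Tendsto (fun n : ℕ => s + 1 / ((n : ℂ) + 1)) Filter.atTop (nhds s) := by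
      simpa using tendsto_const_nhds.add (tendsto_one_div_add_atTop_nhds_zero_nat (𝕜 := ℂ))
    have t2 := (differentiableAt_zetaPoleFree (s := s) (by linarith)).continuousAt.tendsto.comp t1
    have t3 : Filter.Tendsto (fun z => (z - 1) * riemannZeta z) (nhds s)
        (nhds ((s - 1) * riemannZeta s)) :=
      ((continuousAt_id.sub continuousAt_const).mul
        (differentiableAt_riemannZeta h1).continuousAt).tendsto
    refine tendsto_nhds_unique t2 ((t3.comp t1).congr fun n => ?_)
    simp only [Function.comp]
    refine (zetaPoleFree_eq_of_one_lt_re ?_).symm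
    have : (1 / ((n : ℂ) + 1)).re = 1 / ((n : ℝ) + 1) := by
      rw [show (1 / ((n : ℂ) + 1)) = ((1 / ((n : ℝ) + 1) : ℝ) : ℂ) by push_cast; rfl]
      exact Complex.ofReal_re _
    rw [Complex.add_re, this]
    have : 0 < 1 / ((n : ℝ) + 1) := by positivity
    linarith
  rw [key]
  exact mul_ne_zero hs1 (riemannZeta_ne_zero_of_one_le_re hs)

lemma norm_deriv_zetaPoleFree_le {s : ℂ} (hs : 3 / 4 ≤ s.re) (hs' : s.re ≤ 5 / 2) :
    ‖deriv zetaPoleFree s‖ ≤ 320 * (1 + |s.im|) ^ 2 := by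
  have hb : ∀ z ∈ Metric.closedBall s (1 / 4), 1 / 2 ≤ z.re ∧ z.re ≤ 3 ∧ |z.im| ≤ |s.im| + 1 / 4 := by
    intro z hz
    rw [Metric.mem_closedBall, dist_eq_norm] at hz
    have a1 := (Complex.abs_re_le_norm (z - s)).trans hz
    have a2 := (Complex.abs_im_le_norm (z - s)).trans hz
    rw [Complex.sub_re, abs_le] at a1
    rw [Complex.sub_im] at a2
    have := abs_sub_abs_le_abs_sub z.im s.im
    refine ⟨by linarith [a1.1], by linarith [a1.2], by linarith⟩
  have := Complex.norm_deriv_le_of_forall_mem_sphere_norm_le (c := s) (R := 1 / 4)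
    (C := 80 * (1 + |s.im|) ^ 2) (f := zetaPoleFree) (by norm_num)
    (DifferentiableOn.diffContOnCl fun z hz => by
      rw [closure_ball _ (by norm_num)] at hz
      exact (differentiableAt_zetaPoleFree (by linarith [(hb z hz).1])).differentiableWithinAt)
    (fun z hz => by
      obtain ⟨b1, b2, b3⟩ := hb z (Metric.sphere_subset_closedBall hz)
      refine (norm_zetaPoleFree_le b1 b2).trans ?_
      nlinarith [abs_nonneg s.im, abs_nonneg z.im])
  refine this.trans_eq ?_
  ring

lemma norm_deriv_deriv_zetaPoleFree_le {s : ℂ} (hs : 1 ≤ s.re) (hs' : s.re ≤ 2) :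
    ‖deriv (deriv zetaPoleFree) s‖ ≤ 5120 * (1 + |s.im|) ^ 2 := by
  have hb : ∀ z ∈ Metric.closedBall s (1 / 4),
      3 / 4 ≤ z.re ∧ z.re ≤ 5 / 2 ∧ |z.im| ≤ |s.im| + 1 / 4 := by
    intro z hz
    rw [Metric.mem_closedBall, dist_eq_norm] at hz
    have a1 := (Complex.abs_re_le_norm (z - s)).trans hz
    have a2 := (Complex.abs_im_le_norm (z - s)).trans hz
    rw [Complex.sub_re, abs_le] at a1
    rw [Complex.sub_im] at a2
    have := abs_sub_abs_le_abs_sub z.im s.im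
    refine ⟨by linarith [a1.1], by linarith [a1.2], by linarith⟩
  have hopen : IsOpen {z : ℂ | 0 < z.re} := isOpen_lt continuous_const Complex.continuous_re
  have hd : DifferentiableOn ℂ zetaPoleFree {z : ℂ | 0 < z.re} := fun z hz =>
    (differentiableAt_zetaPoleFree hz).differentiableWithinAt
  have := Complex.norm_deriv_le_of_forall_mem_sphere_norm_le (c := s) (R := 1 / 4)
    (C := 1280 * (1 + |s.im|) ^ 2) (f := deriv zetaPoleFree) (by norm_num)
    (DifferentiableOn.diffContOnCl fun z hz => by
      rw [closure_ball _ (by norm_num)] at hz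
      have hz0 : 0 < z.re := by linarith [(hb z hz).1]
      exact ((hd.deriv hopen).differentiableAt (hopen.mem_nhds hz0)).differentiableWithinAt)
    (fun z hz => by
      obtain ⟨b1, b2, b3⟩ := hb z (Metric.sphere_subset_closedBall hz)
      refine (norm_deriv_zetaPoleFree_le b1 b2).trans ?_
      nlinarith [abs_nonneg s.im, abs_nonneg z.im])
  refine this.trans_eq ?_
  ring

lemma zetaPoleFree_three_four_one {x t : ℝ} (hx : 0 < x) (hx1 : x ≤ 1) (ht : 1 ≤ |t|) :
    x ^ 3 ≤ 640000 * (1 + |t|) ^ 2 * ‖zetaPoleFree (1 + x + t * Complex.I)‖ ^ 4 := by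
  have h := DirichletCharacter.norm_LFunction_product_ge_one (N := 1) 1 hx t
  rw [DirichletCharacter.LFunctionTrivChar, one_pow] at h
  simp only [DirichletCharacter.LFunction_modOne_eq] at h
  have r1 : ((1 : ℂ) + x).re = 1 + x := by simp
  have r2 : ((1 : ℂ) + x + t * Complex.I).re = 1 + x := by simp
  have r3 : ((1 : ℂ) + x + 2 * t * Complex.I).re = 1 + x := by simp
  have i1 : ((1 : ℂ) + x).im = 0 := by simp
  have i3 : ((1 : ℂ) + x + 2 * t * Complex.I).im = 2 * t := by simp
  have e1 := zetaPoleFree_eq_of_one_lt_re (s := 1 + x) (by rw [r1]; linarith)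
  have e2 := zetaPoleFree_eq_of_one_lt_re (s := 1 + x + t * Complex.I) (by rw [r2]; linarith)
  have e3 := zetaPoleFree_eq_of_one_lt_re (s := 1 + x + 2 * t * Complex.I) (by rw [r3]; linarith)
  have b1 := norm_zetaPoleFree_le (s := 1 + x) (by rw [r1]; linarith) (by rw [r1]; linarith)
  have b3 := norm_zetaPoleFree_le (s := 1 + x + 2 * t * Complex.I) (by rw [r3]; linarith)
    (by rw [r3]; linarith)
  rw [i1, abs_zero, add_zero, one_pow, mul_one] at b1
  rw [i3, abs_mul, abs_two] at b3
  have n1 : ‖(1 : ℂ) + x - 1‖ = x := by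
    rw [add_sub_cancel_left, Complex.norm_real, Real.norm_of_nonneg hx.le]
  have n2 : 1 ≤ ‖(1 : ℂ) + x + t * Complex.I - 1‖ := by
    refine ht.trans (le_trans (le_of_eq ?_) (Complex.abs_im_le_norm _))
    simp
  have n3 : 1 ≤ ‖(1 : ℂ) + x + 2 * t * Complex.I - 1‖ := by
    refine le_trans ?_ (Complex.abs_im_le_norm _)
    simp [abs_mul]; linarith
  have key : x ^ 3 ≤ ‖zetaPoleFree (1 + x)‖ ^ 3 * ‖zetaPoleFree (1 + x + t * Complex.I)‖ ^ 4 *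
      ‖zetaPoleFree (1 + x + 2 * t * Complex.I)‖ := by
    rw [e1, e2, e3, norm_mul, norm_mul, norm_mul, n1]
    rw [norm_mul, norm_mul, norm_pow, norm_pow] at h
    have c1 : (1 : ℂ) + x + Complex.I * t = 1 + x + t * Complex.I := by ring
    have c2 : (1 : ℂ) + x + 2 * Complex.I * t = 1 + x + 2 * t * Complex.I := by ring
    rw [c1, c2] at h
    set A := ‖riemannZeta (1 + x)‖
    set B := ‖riemannZeta (1 + x + t * Complex.I)‖
    set D := ‖riemannZeta (1 + x + 2 * t * Complex.I)‖
    set u := ‖(1 : ℂ) + x + t * Complex.I - 1‖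
    set v := ‖(1 : ℂ) + x + 2 * t * Complex.I - 1‖
    have hu : 1 ≤ u ^ 4 := one_le_pow₀ n2
    calc x ^ 3 = x ^ 3 * 1 * 1 * 1 := by ring
      _ ≤ x ^ 3 * u ^ 4 * v * (A ^ 3 * B ^ 4 * D) := by gcongr
      _ = (x * A) ^ 3 * (u * B) ^ 4 * (v * D) := by ring
  refine key.trans ?_
  calc _ ≤ 20 ^ 3 * ‖zetaPoleFree (1 + x + t * Complex.I)‖ ^ 4 * (20 * (1 + 2 * |t|) ^ 2) := by
        gcongr
    _ ≤ 20 ^ 3 * ‖zetaPoleFree (1 + x + t * Complex.I)‖ ^ 4 * (20 * (2 * (1 + |t|)) ^ 2) := by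
        gcongr; linarith
    _ = _ := by ring

lemma exists_le_norm_zetaPoleFree : ∃ c : ℝ, 0 < c ∧ ∀ s : ℂ, 1 < s.re → s.re ≤ 2 →
    c ≤ ‖zetaPoleFree s‖ * (1 + |s.im|) ^ 8 := by
  obtain ⟨c₁, hc₁, h₁⟩ : ∃ c : ℝ, 0 < c ∧ ∀ s ∈ Set.Icc (1 : ℝ) 2 ×ℂ Set.Icc (-1 : ℝ) 1,
      c ≤ ‖zetaPoleFree s‖ := by
    have hK : IsCompact (Set.Icc (1 : ℝ) 2 ×ℂ Set.Icc (-1 : ℝ) 1) := isCompact_Icc.reProdIm isCompact_Icc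
    have hne : (Set.Icc (1 : ℝ) 2 ×ℂ Set.Icc (-1 : ℝ) 1).Nonempty :=
      ⟨1, by rw [Complex.mem_reProdIm]; norm_num⟩
    obtain ⟨z, hz, hm⟩ := hK.exists_isMinOn hne (f := fun s => ‖zetaPoleFree s‖)
      (fun s hs => (differentiableAt_zetaPoleFree (by
        rw [Complex.mem_reProdIm] at hs; linarith [hs.1.1])).continuousAt.norm.continuousWithinAt)
    refine ⟨‖zetaPoleFree z‖, norm_pos_iff.2 (zetaPoleFree_ne_zero ?_), fun s hs => hm hs⟩
    rw [Complex.mem_reProdIm] at hz; exact hz.1.1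
  set κ : ℝ := 1 / (640 ^ 4 * 640000) with hκ
  have hκ0 : 0 < κ := by positivity
  refine ⟨min c₁ (320 * κ), by positivity, fun s hs hs' => ?_⟩
  have hT1 : 1 ≤ 1 + |s.im| := by linarith [abs_nonneg s.im]
  set T := 1 + |s.im| with hT
  rcases le_total (|s.im|) 1 with him | him
  · refine (min_le_left _ _).trans ((h₁ s ?_).trans ?_)
    · rw [Complex.mem_reProdIm]; exact ⟨⟨hs.le, hs'⟩, abs_le.1 him⟩
    · exact le_mul_of_one_le_right (norm_nonneg _) (one_le_pow₀ hT1)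
  refine (min_le_right _ _).trans ?_
  have hT0 : 0 < T := by linarith
  have main : ∀ x : ℝ, κ / T ^ 10 ≤ x → x ≤ 1 →
      640 * κ / T ^ 8 ≤ ‖zetaPoleFree (1 + x + s.im * Complex.I)‖ := by
    intro x hx hx1
    have hx0 : 0 < x := lt_of_lt_of_le (by positivity) hx
    have h := zetaPoleFree_three_four_one hx0 hx1 him
    rw [← hT] at h
    refine le_of_pow_le_pow_left₀ (n := 4) (by norm_num) (norm_nonneg _) ?_
    have h2 : (κ / T ^ 10) ^ 3 ≤ x ^ 3 := by gcongr
    have h3 := h2.trans h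
    have h4 : (640 * κ / T ^ 8) ^ 4 * (640000 * T ^ 2) = (κ / T ^ 10) ^ 3 := by
      have : κ * (640 ^ 4 * 640000) = 1 := by rw [hκ]; norm_num
      field_simp
      linear_combination κ ^ 3 * this
    rw [← h4] at h3
    refine le_of_mul_le_mul_right (h3.trans_eq (mul_comm _ _)) (by positivity)
  have hse : s = 1 + ((s.re - 1 : ℝ) : ℂ) + s.im * Complex.I := by
    apply Complex.ext <;> simp
  rw [← div_le_iff₀ (by positivity)]
  have hlow : κ / T ^ 10 ≤ 1 := by
    rw [div_le_one (by positivity)]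
    exact le_trans (by rw [hκ]; norm_num) (one_le_pow₀ hT1)
  rcases le_total (κ / T ^ 10) (s.re - 1) with hx | hx
  · have := main _ hx (by linarith)
    rw [← hse] at this
    refine le_trans ?_ this
    gcongr; linarith
  · have h0 := main _ le_rfl hlow
    set s₀ : ℂ := 1 + ((κ / T ^ 10 : ℝ) : ℂ) + s.im * Complex.I with hs₀
    have re0 : s₀.re = 1 + κ / T ^ 10 := by
      rw [hs₀]; simp only [Complex.add_re, Complex.one_re, Complex.ofReal_re, Complex.mul_re,
        Complex.I_re, Complex.ofReal_im, Complex.I_im]; ring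
    have im0 : s₀.im = s.im := by
      rw [hs₀]; simp only [Complex.add_im, Complex.one_im, Complex.ofReal_im, Complex.mul_im,
        Complex.I_re, Complex.ofReal_re, Complex.I_im]; ring
    have hconv : Convex ℝ (({z : ℂ | 1 ≤ z.re} ∩ {z : ℂ | z.re ≤ 2}) ∩
        ({z : ℂ | s.im ≤ z.im} ∩ {z : ℂ | z.im ≤ s.im})) :=
      ((convex_halfSpace_re_ge 1).inter (convex_halfSpace_re_le 2)).inter
        ((convex_halfSpace_im_ge _).inter (convex_halfSpace_im_le _))
    have hmv := hconv.norm_image_sub_le_of_norm_deriv_le (f := zetaPoleFree) (C := 320 * T ^ 2)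
      (x := s) (y := s₀)
      (fun z hz => differentiableAt_zetaPoleFree (lt_of_lt_of_le one_pos hz.1.1))
      (fun z hz => by
        have : z.im = s.im := le_antisymm hz.2.2 hz.2.1
        have hb := norm_deriv_zetaPoleFree_le (s := z) (by linarith [show 1 ≤ z.re from hz.1.1])
          (by linarith [show z.re ≤ 2 from hz.1.2])
        rwa [this] at hb)
      ⟨⟨hs.le, hs'⟩, le_refl s.im, le_refl s.im⟩
      ⟨⟨show 1 ≤ s₀.re by rw [re0]; linarith [show 0 < κ / T ^ 10 by positivity],
        show s₀.re ≤ 2 by rw [re0]; linarith⟩, im0.ge, im0.le⟩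
    have hd : ‖s₀ - s‖ ≤ κ / T ^ 10 := by
      have : s₀ - s = ((κ / T ^ 10 - (s.re - 1) : ℝ) : ℂ) := by
        apply Complex.ext
        · rw [Complex.sub_re, re0, Complex.ofReal_re]; ring
        · rw [Complex.sub_im, im0, Complex.ofReal_im]; ring
      rw [this, Complex.norm_real, Real.norm_of_nonneg (by linarith)]
      linarith
    have h5 : ‖zetaPoleFree s₀ - zetaPoleFree s‖ ≤ 320 * κ / T ^ 8 := by
      refine hmv.trans ((mul_le_mul_of_nonneg_left hd (by positivity)).trans_eq ?_)
      field_simp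
    have h6 := norm_sub_norm_le (zetaPoleFree s₀) (zetaPoleFree s)
    have h7 : 640 * κ / T ^ 8 = 320 * κ / T ^ 8 + 320 * κ / T ^ 8 := by ring
    linarith

/-- The negative logarithmic derivative of `ζ` minus `1 / (s - 1)`, continued to `1 ≤ re s`. -/
noncomputable def logDerivZetaReg (s : ℂ) : ℂ := -(deriv zetaPoleFree s / zetaPoleFree s)

lemma logDerivZetaReg_eq {s : ℂ} (hs : 1 < s.re) :
    logDerivZetaReg s = -deriv riemannZeta s / riemannZeta s - 1 / (s - 1) := by
  have hs1 : s ≠ 1 := by rintro rfl; norm_num at hs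
  have hs1' : s - 1 ≠ 0 := sub_ne_zero.2 hs1
  have hz : riemannZeta s ≠ 0 := riemannZeta_ne_zero_of_one_le_re hs.le
  have hev : zetaPoleFree =ᶠ[nhds s] fun z => (z - 1) * riemannZeta z := by
    filter_upwards [(isOpen_lt continuous_const Complex.continuous_re).mem_nhds hs] with z hz
    exact zetaPoleFree_eq_of_one_lt_re hz
  have hd : deriv zetaPoleFree s = riemannZeta s + (s - 1) * deriv riemannZeta s := by
    rw [hev.deriv_eq]
    have h : HasDerivAt (fun z => (z - 1) * riemannZeta z)
        (1 * riemannZeta s + (s - 1) * deriv riemannZeta s) s :=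
      ((hasDerivAt_id s).sub_const 1).mul (differentiableAt_riemannZeta hs1).hasDerivAt
    rw [h.deriv, one_mul]
  rw [logDerivZetaReg, hd, zetaPoleFree_eq_of_one_lt_re hs]
  field_simp
  ring

lemma hasDerivAt_logDerivZetaReg {s : ℂ} (hs : 1 < s.re) :
    HasDerivAt logDerivZetaReg (-((deriv (deriv zetaPoleFree) s * zetaPoleFree s -
      deriv zetaPoleFree s * deriv zetaPoleFree s) / zetaPoleFree s ^ 2)) s := by
  have hopen : IsOpen {z : ℂ | 0 < z.re} := isOpen_lt continuous_const Complex.continuous_re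
  have hd : DifferentiableOn ℂ zetaPoleFree {z : ℂ | 0 < z.re} := fun z hz =>
    (differentiableAt_zetaPoleFree hz).differentiableWithinAt
  have hs0 : 0 < s.re := by linarith
  have h1 := ((hd.deriv hopen).differentiableAt (hopen.mem_nhds hs0)).hasDerivAt
  have h2 := (differentiableAt_zetaPoleFree hs0).hasDerivAt
  exact (h1.div h2 (zetaPoleFree_ne_zero hs.le)).neg

lemma exists_norm_logDerivZetaReg_le : ∃ C : ℝ, 0 < C ∧ ∀ s : ℂ, 1 < s.re → s.re ≤ 2 →
    ‖logDerivZetaReg s‖ ≤ C * (1 + |s.im|) ^ 20 ∧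
    ‖deriv logDerivZetaReg s‖ ≤ C * (1 + |s.im|) ^ 20 := by
  obtain ⟨c, hc, hlow⟩ := exists_le_norm_zetaPoleFree
  refine ⟨320 / c + (5120 * 20 + 320 ^ 2) / c ^ 2, by positivity, fun s hs hs' => ?_⟩
  have h1 := norm_deriv_zetaPoleFree_le (s := s) (by linarith) (by linarith)
  have h2 := norm_deriv_deriv_zetaPoleFree_le (s := s) (by linarith) (by linarith)
  have h0 := norm_zetaPoleFree_le (s := s) (by linarith) (by linarith)
  have hl := hlow s hs hs'
  have hT1 : 1 ≤ 1 + |s.im| := by linarith [abs_nonneg s.im]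
  set T := 1 + |s.im| with hT
  have hT0 : 0 < T := by linarith
  have hZ : 0 < ‖zetaPoleFree s‖ := norm_pos_iff.2 (zetaPoleFree_ne_zero hs.le)
  have hinv : 1 / ‖zetaPoleFree s‖ ≤ T ^ 8 / c := by
    rw [div_le_div_iff₀ hZ hc]; linarith
  constructor
  · rw [logDerivZetaReg, norm_neg, norm_div]
    calc ‖deriv zetaPoleFree s‖ / ‖zetaPoleFree s‖
        = ‖deriv zetaPoleFree s‖ * (1 / ‖zetaPoleFree s‖) := by ring
      _ ≤ 320 * T ^ 2 * (T ^ 8 / c) := by gcongr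
      _ = 320 / c * T ^ 10 := by ring
      _ ≤ (320 / c + (5120 * 20 + 320 ^ 2) / c ^ 2) * T ^ 20 := by
          gcongr
          · exact le_add_of_nonneg_right (by positivity)
          · norm_num
  · rw [(hasDerivAt_logDerivZetaReg hs).deriv, norm_neg, norm_div, norm_pow]
    calc _ ≤ (‖deriv (deriv zetaPoleFree) s‖ * ‖zetaPoleFree s‖ +
          ‖deriv zetaPoleFree s‖ * ‖deriv zetaPoleFree s‖) * (1 / ‖zetaPoleFree s‖) ^ 2 := by
          rw [one_div, inv_pow, ← div_eq_mul_inv]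
          gcongr
          refine (norm_sub_le _ _).trans ?_
          rw [norm_mul, norm_mul]
      _ ≤ (5120 * T ^ 2 * (20 * T ^ 2) + 320 * T ^ 2 * (320 * T ^ 2)) * (T ^ 8 / c) ^ 2 := by
          gcongr
      _ = (5120 * 20 + 320 ^ 2) / c ^ 2 * T ^ 20 := by ring
      _ ≤ _ := by
          gcongr
          exact le_add_of_nonneg_left (by positivity)

/-- The Fourier transform of `t ↦ exp (-b t²)`. -/
noncomputable def gaussKer (b v : ℝ) : ℝ := √(Real.pi / b) * Real.exp (-v ^ 2 / (4 * b))

lemma gaussKer_nonneg (b v : ℝ) : 0 ≤ gaussKer b v := by unfold gaussKer; positivity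

lemma integral_cexp_mul_gauss {b : ℝ} (hb : 0 < b) (v : ℝ) :
    ∫ t : ℝ, Complex.exp (Complex.I * v * t) * (Real.exp (-b * t ^ 2) : ℝ) = gaussKer b v := by
  have h := fourierIntegral_gaussian (b := b) (by simpa using hb) v
  push_cast
  rw [h, gaussKer]
  push_cast
  congr 1
  rw [Real.sqrt_eq_rpow, Complex.ofReal_cpow (by positivity)]
  push_cast; rfl

lemma integrable_gaussKer {b : ℝ} (hb : 0 < b) : MeasureTheory.Integrable (gaussKer b) := by
  have h := (integrable_exp_neg_mul_sq (b := 1 / (4 * b)) (by positivity)).const_mul √(Real.pi / b)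
  refine h.congr (Filter.Eventually.of_forall fun v => ?_)
  simp only [gaussKer]
  congr 2; field_simp

lemma integral_gaussKer {b : ℝ} (hb : 0 < b) : ∫ v, gaussKer b v = 2 * Real.pi := by
  have h := integral_gaussian (1 / (4 * b))
  have e : ∀ v, gaussKer b v = √(Real.pi / b) * Real.exp (-(1 / (4 * b)) * v ^ 2) := by
    intro v
    simp only [gaussKer]
    congr 2; field_simp
  simp_rw [e]
  rw [MeasureTheory.integral_const_mul, h, ← Real.sqrt_mul (by positivity)]
  rw [show Real.pi / b * (Real.pi / (1 / (4 * b))) = (2 * Real.pi) ^ 2 by field_simp; ring]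
  exact Real.sqrt_sq (by positivity)

lemma integrable_exp_neg_mul_sq_ofReal {b : ℝ} (hb : 0 < b) :
    MeasureTheory.Integrable fun t : ℝ => ((Real.exp (-b * t ^ 2) : ℝ) : ℂ) :=
  (integrable_exp_neg_mul_sq hb).ofReal

lemma norm_cexp_I_mul_mul (u t : ℝ) : ‖Complex.exp (Complex.I * u * t)‖ = 1 := by
  rw [show Complex.I * u * t = ((u * t : ℝ) : ℂ) * Complex.I by push_cast; ring]
  exact Complex.norm_exp_ofReal_mul_I _

lemma integrable_cexp_mul_gauss {b : ℝ} (hb : 0 < b) (v : ℝ) : MeasureTheory.Integrable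
    fun t : ℝ => Complex.exp (Complex.I * v * t) * ((Real.exp (-b * t ^ 2) : ℝ) : ℂ) :=
  (integrable_exp_neg_mul_sq_ofReal hb).bdd_mul (c := 1) (by fun_prop)
    (Filter.Eventually.of_forall fun t => (norm_cexp_I_mul_mul v t).le)

open MeasureTheory in
lemma hasSum_integral_vonMangoldt {b σ : ℝ} (hb : 0 < b) (hσ : 1 < σ) (u : ℝ) :
    HasSum (fun n : ℕ => ((ArithmeticFunction.vonMangoldt n * (n : ℝ) ^ (-σ) *
      gaussKer b (u - Real.log n) : ℝ) : ℂ))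
    (∫ t : ℝ, Complex.exp (Complex.I * u * t) * (Real.exp (-b * t ^ 2) : ℝ) *
      (-deriv riemannZeta (σ + Complex.I * t) / riemannZeta (σ + Complex.I * t))) := by
  have hterm : ∀ (n : ℕ) (t : ℝ), LSeries.term (fun n => (ArithmeticFunction.vonMangoldt n : ℂ))
      (σ + Complex.I * t) n = ((ArithmeticFunction.vonMangoldt n * (n : ℝ) ^ (-σ) : ℝ) : ℂ) *
        Complex.exp (Complex.I * (-Real.log n : ℝ) * t) := by
    intro n t
    rcases eq_or_ne n 0 with rfl | hn
    · simp
    have hn0 : (0 : ℝ) < n := by exact_mod_cast Nat.pos_of_ne_zero hn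
    rw [LSeries.term_of_ne_zero hn, div_eq_mul_inv, ← Complex.cpow_neg]
    push_cast
    rw [mul_assoc, Complex.ofReal_cpow hn0.le]
    congr 1
    have hn' : (n : ℂ) ≠ 0 := by exact_mod_cast hn
    rw [neg_add, Complex.cpow_add _ _ hn']
    push_cast
    congr 1
    rw [Complex.cpow_def_of_ne_zero hn', ← Complex.natCast_log]
    congr 1; ring
  have hsum : Summable fun n : ℕ => ArithmeticFunction.vonMangoldt n * (n : ℝ) ^ (-σ) := by
    have h := ArithmeticFunction.LSeriesSummable_vonMangoldt (s := σ) (by simpa using hσ)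
    rw [LSeriesSummable, ← summable_norm_iff] at h
    refine h.congr fun n => ?_
    have := hterm n 0
    simp only [Complex.ofReal_zero, mul_zero, add_zero, Complex.exp_zero, mul_one] at this
    rw [this, Complex.norm_real, Real.norm_of_nonneg]
    exact mul_nonneg ArithmeticFunction.vonMangoldt_nonneg (by positivity)
  set f : ℕ → ℝ → ℂ := fun n t => ((ArithmeticFunction.vonMangoldt n * (n : ℝ) ^ (-σ) : ℝ) : ℂ) *
    (Complex.exp (Complex.I * (u - Real.log n : ℝ) * t) * (Real.exp (-b * t ^ 2) : ℝ)) with hf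
  have hfn : ∀ n t, ‖f n t‖ = ArithmeticFunction.vonMangoldt n * (n : ℝ) ^ (-σ) *
      Real.exp (-b * t ^ 2) := by
    intro n t
    rw [hf]
    simp only
    rw [norm_mul, norm_mul, norm_cexp_I_mul_mul, Complex.norm_real, Complex.norm_real,
      Real.norm_of_nonneg (mul_nonneg ArithmeticFunction.vonMangoldt_nonneg (by positivity)),
      Real.norm_of_nonneg (Real.exp_nonneg _), one_mul]
  have key := hasSum_integral_of_summable_integral_norm (F := f) (μ := volume)
    (fun n => (integrable_cexp_mul_gauss hb _).const_mul _) (by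
      simp_rw [hfn, integral_const_mul]
      exact hsum.mul_right _)
  convert! key using 1
  · ext n
    rw [hf]
    simp only
    rw [integral_const_mul, integral_cexp_mul_gauss hb]
    push_cast; rfl
  · congr 1
    ext t
    have h1 : 1 < ((σ : ℂ) + Complex.I * t).re := by simpa using hσ
    rw [← ArithmeticFunction.LSeries_vonMangoldt_eq_deriv_riemannZeta_div h1, LSeries,
      ← tsum_mul_left]
    congr 1
    ext n
    rw [hterm, hf]
    simp only
    rw [show Complex.I * ((u - Real.log n : ℝ) : ℂ) * t = Complex.I * u * t +
      Complex.I * ((-Real.log n : ℝ) : ℂ) * t by push_cast; ring, Complex.exp_add]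
    ring

open MeasureTheory in
lemma norm_integral_pole_le {b σ : ℝ} (hb : 0 < b) (hσ : 1 < σ) (u : ℝ) :
    ‖∫ t : ℝ, Complex.exp (Complex.I * u * t) * (Real.exp (-b * t ^ 2) : ℝ) *
      (1 / ((σ + Complex.I * t : ℂ) - 1))‖ ≤ 2 * Real.pi := by
  set μ : Measure ℝ := volume.restrict (Set.Ioi 0)
  have hexp : Integrable (fun v : ℝ => ((Real.exp (-(σ - 1) * v) : ℝ) : ℂ)) μ :=
    (integrableOn_exp_mul_Ioi (by linarith) 0).ofReal
  have e1 : ∀ t : ℝ, 1 / ((σ + Complex.I * t : ℂ) - 1) =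
      ∫ v, ((Real.exp (-(σ - 1) * v) : ℝ) : ℂ) * Complex.exp (Complex.I * (-v : ℝ) * t) ∂μ := by
    intro t
    have h := integral_exp_mul_complex_Ioi (a := -(σ + Complex.I * t - 1))
      (by simp; linarith) 0
    rw [Complex.ofReal_zero, mul_zero, Complex.exp_zero, neg_div_neg_eq] at h
    rw [← h]
    refine integral_congr_ae (Filter.Eventually.of_forall fun v => ?_)
    simp only
    rw [Complex.ofReal_exp, ← Complex.exp_add]
    congr 1; push_cast; ring
  have h_prod : Integrable (Function.uncurry fun (t v : ℝ) =>
      ((Real.exp (-(σ - 1) * v) : ℝ) : ℂ) *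
        (Complex.exp (Complex.I * (u - v : ℝ) * t) * (Real.exp (-b * t ^ 2) : ℝ)))
      (volume.prod μ) := by
    have h := (integrable_exp_neg_mul_sq_ofReal hb).mul_prod hexp
    have h2 := h.bdd_mul (c := 1) (f := fun z : ℝ × ℝ =>
      Complex.exp (Complex.I * (u - z.2 : ℝ) * z.1)) (by fun_prop)
      (Filter.Eventually.of_forall fun z => (norm_cexp_I_mul_mul _ _).le)
    refine h2.congr (Filter.Eventually.of_forall fun z => ?_)
    simp only [Function.uncurry]
    ring
  have hsw := integral_integral_swap h_prod
  have e2 : ∫ t : ℝ, Complex.exp (Complex.I * u * t) * (Real.exp (-b * t ^ 2) : ℝ) *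
      (1 / ((σ + Complex.I * t : ℂ) - 1)) =
      ∫ v, ((Real.exp (-(σ - 1) * v) * gaussKer b (u - v) : ℝ) : ℂ) ∂μ := by
    have l : ∀ t : ℝ, Complex.exp (Complex.I * u * t) * (Real.exp (-b * t ^ 2) : ℝ) *
      (1 / ((σ + Complex.I * t : ℂ) - 1)) = ∫ v, ((Real.exp (-(σ - 1) * v) : ℝ) : ℂ) *
        (Complex.exp (Complex.I * (u - v : ℝ) * t) * (Real.exp (-b * t ^ 2) : ℝ)) ∂μ := by
      intro t
      rw [e1, ← integral_const_mul]
      refine integral_congr_ae (Filter.Eventually.of_forall fun v => ?_)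
      simp only
      rw [show Complex.I * ((u - v : ℝ) : ℂ) * t = Complex.I * u * t +
        Complex.I * ((-v : ℝ) : ℂ) * t by push_cast; ring, Complex.exp_add]
      ring
    simp_rw [l]
    rw [hsw]
    refine integral_congr_ae (Filter.Eventually.of_forall fun v => ?_)
    simp only
    rw [integral_const_mul, integral_cexp_mul_gauss hb]
    push_cast; rfl
  rw [e2, integral_complex_ofReal, Complex.norm_real, Real.norm_of_nonneg
    (integral_nonneg fun v => mul_nonneg (Real.exp_nonneg _) (gaussKer_nonneg _ _))]
  have hg : Integrable fun v => gaussKer b (u - v) := (integrable_gaussKer hb).comp_sub_left u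
  calc _ ≤ ∫ v, gaussKer b (u - v) ∂μ := by
        refine integral_mono_of_nonneg (Filter.Eventually.of_forall fun v =>
          mul_nonneg (Real.exp_nonneg _) (gaussKer_nonneg _ _)) hg.restrict ?_
        filter_upwards [self_mem_ae_restrict measurableSet_Ioi] with v hv
        refine mul_le_of_le_one_left (gaussKer_nonneg _ _) (Real.exp_le_one_iff.2 ?_)
        nlinarith [show (0 : ℝ) < v from hv]
    _ ≤ ∫ v, gaussKer b (u - v) :=
        setIntegral_le_integral hg (Filter.Eventually.of_forall fun v => gaussKer_nonneg _ _)
    _ = 2 * Real.pi := by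
        rw [integral_sub_left_eq_self (gaussKer b) volume u, integral_gaussKer hb]

lemma one_add_abs_pow_mul_exp_le {b : ℝ} (hb : 0 < b) (hb1 : b ≤ 1) (t : ℝ) :
    (1 + |t|) ^ 22 * Real.exp (-b * t ^ 2) ≤
      4 ^ 11 * (Nat.factorial 11 * Real.exp 1) / b ^ 11 * Real.exp (-(b / 2) * t ^ 2) := by
  have h1 : (1 + |t|) ^ 2 ≤ 4 / b * ((b + b * t ^ 2) / 2) := by
    rw [show 4 / b * ((b + b * t ^ 2) / 2) = 2 + 2 * t ^ 2 by field_simp; ring, ← sq_abs t]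
    nlinarith [sq_nonneg (1 - |t|)]
  have h2 : ((b + b * t ^ 2) / 2) ^ 11 ≤ Nat.factorial 11 * Real.exp ((b + b * t ^ 2) / 2) := by
    have := Real.pow_div_factorial_le_exp ((b + b * t ^ 2) / 2) (by positivity) 11
    rw [div_le_iff₀ (by positivity)] at this
    linarith
  have h3 : Real.exp ((b + b * t ^ 2) / 2) ≤ Real.exp 1 * Real.exp (b / 2 * t ^ 2) := by
    rw [← Real.exp_add]; apply Real.exp_le_exp.2; linarith
  calc (1 + |t|) ^ 22 * Real.exp (-b * t ^ 2)
      = ((1 + |t|) ^ 2) ^ 11 * Real.exp (-b * t ^ 2) := by ring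
    _ ≤ (4 / b * ((b + b * t ^ 2) / 2)) ^ 11 * Real.exp (-b * t ^ 2) := by gcongr
    _ = (4 / b) ^ 11 * (((b + b * t ^ 2) / 2) ^ 11 * Real.exp (-b * t ^ 2)) := by ring
    _ ≤ (4 / b) ^ 11 * ((Nat.factorial 11 * (Real.exp 1 * Real.exp (b / 2 * t ^ 2))) *
        Real.exp (-b * t ^ 2)) := by
        gcongr
        exact h2.trans (by gcongr)
    _ = 4 ^ 11 * (Nat.factorial 11 * Real.exp 1) / b ^ 11 *
        (Real.exp (b / 2 * t ^ 2) * Real.exp (-b * t ^ 2)) := by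
        rw [div_pow]; ring
    _ = _ := by
        rw [← Real.exp_add]; congr 2; ring

open MeasureTheory in
lemma exists_norm_integral_logDerivZetaReg_le : ∃ C : ℝ, 0 < C ∧ ∀ b σ u : ℝ, 0 < b → b ≤ 1 →
    1 < σ → σ ≤ 2 → 0 < u →
    Integrable (fun t : ℝ => Complex.exp (Complex.I * u * t) * (Real.exp (-b * t ^ 2) : ℝ) *
      logDerivZetaReg (σ + Complex.I * t)) ∧
    ‖∫ t : ℝ, Complex.exp (Complex.I * u * t) * (Real.exp (-b * t ^ 2) : ℝ) *
      logDerivZetaReg (σ + Complex.I * t)‖ ≤ C / (b ^ 12 * u) := by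
  obtain ⟨C₀, hC₀, hF⟩ := exists_norm_logDerivZetaReg_le
  set K : ℝ := 4 ^ 11 * (Nat.factorial 11 * Real.exp 1) with hK
  have hK0 : 0 < K := by positivity
  refine ⟨3 * C₀ * K * √(Real.pi * 2), by positivity, fun b σ u hb hb1 hσ hσ2 hu => ?_⟩
  have hre : ∀ t : ℝ, ((σ : ℂ) + Complex.I * t).re = σ := fun t => by simp
  have him : ∀ t : ℝ, ((σ : ℂ) + Complex.I * t).im = t := fun t => by simp
  set M : ℝ → ℝ := fun t => C₀ * (K / b ^ 11 * Real.exp (-(b / 2) * t ^ 2)) with hM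
  have hMint : Integrable M :=
    ((integrable_exp_neg_mul_sq (by positivity)).const_mul _).const_mul _
  have hMI : ∫ t, M t ≤ C₀ * K * √(Real.pi * 2) / b ^ 12 := by
    rw [hM, integral_const_mul, integral_const_mul, integral_gaussian]
    have : √(Real.pi / (b / 2)) ≤ √(Real.pi * 2) / b := by
      rw [show Real.pi / (b / 2) = Real.pi * 2 / b by field_simp, Real.sqrt_div (by positivity)]
      gcongr
      exact Real.le_sqrt_of_sq_le (by nlinarith)
    calc _ ≤ C₀ * (K / b ^ 11 * (√(Real.pi * 2) / b)) := by gcongr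
      _ = _ := by field_simp
  have hM0 : ∀ t, 0 ≤ M t := fun t => by positivity
  have hF1 : ∀ t : ℝ, ‖logDerivZetaReg (σ + Complex.I * t)‖ * ((1 + |t|) ^ 2 *
      Real.exp (-b * t ^ 2)) ≤ M t := by
    intro t
    have h := (hF (σ + Complex.I * t) (by rwa [hre]) (by rwa [hre])).1
    rw [him] at h
    calc _ ≤ C₀ * (1 + |t|) ^ 20 * ((1 + |t|) ^ 2 * Real.exp (-b * t ^ 2)) := by gcongr
      _ = C₀ * ((1 + |t|) ^ 22 * Real.exp (-b * t ^ 2)) := by ring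
      _ ≤ _ := mul_le_mul_of_nonneg_left (one_add_abs_pow_mul_exp_le hb hb1 t) hC₀.le
  have hF2 : ∀ t : ℝ, ‖deriv logDerivZetaReg (σ + Complex.I * t)‖ * ((1 + |t|) ^ 2 *
      Real.exp (-b * t ^ 2)) ≤ M t := by
    intro t
    have h := (hF (σ + Complex.I * t) (by rwa [hre]) (by rwa [hre])).2
    rw [him] at h
    calc _ ≤ C₀ * (1 + |t|) ^ 20 * ((1 + |t|) ^ 2 * Real.exp (-b * t ^ 2)) := by gcongr
      _ = C₀ * ((1 + |t|) ^ 22 * Real.exp (-b * t ^ 2)) := by ring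
      _ ≤ _ := mul_le_mul_of_nonneg_left (one_add_abs_pow_mul_exp_le hb hb1 t) hC₀.le
  have hline : ∀ t : ℝ, HasDerivAt (fun t : ℝ => logDerivZetaReg (σ + Complex.I * t))
      (deriv logDerivZetaReg (σ + Complex.I * t) * Complex.I) t := by
    intro t
    have h1 := (hasDerivAt_logDerivZetaReg (s := σ + Complex.I * t)
      (by rwa [hre])).differentiableAt.hasDerivAt
    have h2 : HasDerivAt (fun t : ℝ => (σ : ℂ) + Complex.I * t) Complex.I t := by
      have := ((Complex.ofRealCLM.hasDerivAt (x := t)).const_mul Complex.I).const_add (σ : ℂ)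
      simpa using this
    exact HasDerivAt.comp (h₂ := logDerivZetaReg) t h1 h2
  have hcont : Continuous fun t : ℝ => logDerivZetaReg (σ + Complex.I * t) :=
    continuous_iff_continuousAt.2 fun t => (hline t).continuousAt
  set U : ℝ → ℂ := fun t => (Real.exp (-b * t ^ 2) : ℝ) * logDerivZetaReg (σ + Complex.I * t)
    with hU
  set U' : ℝ → ℂ := fun t => ((Real.exp (-b * t ^ 2) * (-2 * b * t) : ℝ) : ℂ) *
    logDerivZetaReg (σ + Complex.I * t) + (Real.exp (-b * t ^ 2) : ℝ) *
      (deriv logDerivZetaReg (σ + Complex.I * t) * Complex.I) with hU'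
  have hUd : ∀ t, HasDerivAt U (U' t) t := by
    intro t
    have h1 : HasDerivAt (fun t : ℝ => Real.exp (-b * t ^ 2))
        (Real.exp (-b * t ^ 2) * (-2 * b * t)) t := by
      have := ((hasDerivAt_pow 2 t).const_mul (-b)).exp
      convert! this using 1
      simp; ring
    exact h1.ofReal_comp.mul (hline t)
  have hUn : ∀ t, ‖U t‖ ≤ M t := by
    intro t
    rw [hU]
    simp only
    rw [norm_mul, Complex.norm_real, Real.norm_of_nonneg (Real.exp_nonneg _), mul_comm]
    refine le_trans ?_ (hF1 t)
    gcongr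
    exact le_mul_of_one_le_left (Real.exp_nonneg _)
      (one_le_pow₀ (by linarith [abs_nonneg t]))
  have hU'n : ∀ t, ‖U' t‖ ≤ 3 * M t := by
    intro t
    rw [hU']
    simp only
    refine (norm_add_le _ _).trans ?_
    rw [norm_mul, norm_mul, norm_mul, Complex.norm_real, Complex.norm_real, Complex.norm_I, mul_one,
      norm_mul, Real.norm_of_nonneg (Real.exp_nonneg _)]
    have a1 : ‖-2 * b * t‖ ≤ 2 * (1 + |t|) ^ 2 := by
      rw [norm_mul, norm_mul, Real.norm_eq_abs, Real.norm_eq_abs, Real.norm_eq_abs, abs_of_pos hb,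
        abs_neg, abs_two]
      nlinarith [abs_nonneg t, mul_le_of_le_one_left (abs_nonneg t) hb1]
    have a2 := hF1 t
    have a3 := hF2 t
    have a4 : (1 : ℝ) ≤ (1 + |t|) ^ 2 := one_le_pow₀ (by linarith [abs_nonneg t])
    calc _ ≤ Real.exp (-b * t ^ 2) * (2 * (1 + |t|) ^ 2) * ‖logDerivZetaReg (σ + Complex.I * t)‖ +
          (1 + |t|) ^ 2 * Real.exp (-b * t ^ 2) *
            ‖deriv logDerivZetaReg (σ + Complex.I * t)‖ := by
          gcongr
          exact le_mul_of_one_le_left (Real.exp_nonneg _) a4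
      _ ≤ _ := by linarith
  have hUm : AEStronglyMeasurable U := by
    apply Continuous.aestronglyMeasurable
    exact (by fun_prop : Continuous fun t : ℝ => ((Real.exp (-b * t ^ 2) : ℝ) : ℂ)).mul hcont
  have hU'm : AEStronglyMeasurable U' := by
    have : U' = deriv U := funext fun t => (hUd t).deriv.symm
    rw [this]
    exact (stronglyMeasurable_deriv U).aestronglyMeasurable
  have hUi : Integrable U := hMint.mono' hUm (Filter.Eventually.of_forall hUn)
  have hU'i : Integrable U' := (hMint.const_mul 3).mono' hU'm (Filter.Eventually.of_forall hU'n)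
  set V : ℝ → ℂ := fun t => Complex.exp (Complex.I * u * t) / (Complex.I * u) with hV
  have hu0 : Complex.I * (u : ℂ) ≠ 0 := mul_ne_zero Complex.I_ne_zero (by exact_mod_cast hu.ne')
  have hVn : ∀ t, ‖V t‖ = 1 / u := by
    intro t
    rw [hV]
    simp only
    rw [norm_div, norm_cexp_I_mul_mul, norm_mul, Complex.norm_I, one_mul, Complex.norm_real,
      Real.norm_of_nonneg hu.le]
  have hVd : ∀ t : ℝ, HasDerivAt V (Complex.exp (Complex.I * u * t)) t := by
    intro t
    have h2 : HasDerivAt (fun t : ℝ => Complex.I * (u : ℂ) * t) (Complex.I * u) t := by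
      have := (Complex.ofRealCLM.hasDerivAt (x := t)).const_mul (Complex.I * (u : ℂ))
      simpa using this
    have := h2.cexp.div_const (Complex.I * u)
    rwa [mul_div_cancel_right₀ _ hu0] at this
  have hVc : Continuous V := continuous_iff_continuousAt.2 fun t => (hVd t).continuousAt
  have hUe : Integrable (U * fun t : ℝ => Complex.exp (Complex.I * u * t)) :=
    hUi.mul_bdd (c := 1) (by fun_prop)
      (Filter.Eventually.of_forall fun t => (norm_cexp_I_mul_mul u t).le)
  have hibp := integral_mul_deriv_eq_deriv_mul_of_integrable (u := U) (v := V) (u' := U')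
    (v' := fun t => Complex.exp (Complex.I * u * t)) (fun t _ => hUd t) (fun t _ => hVd t) hUe
    (hU'i.mul_bdd (c := 1 / u) hVc.aestronglyMeasurable
      (Filter.Eventually.of_forall fun t => (hVn t).le))
    (hUi.mul_bdd (c := 1 / u) hVc.aestronglyMeasurable
      (Filter.Eventually.of_forall fun t => (hVn t).le))
  have hre' : ∀ t : ℝ, Complex.exp (Complex.I * u * t) * (Real.exp (-b * t ^ 2) : ℝ) *
      logDerivZetaReg (σ + Complex.I * t) = U t * Complex.exp (Complex.I * u * t) := by
    intro t; rw [hU]; ring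
  simp_rw [hre']
  refine ⟨hUe, ?_⟩
  rw [hibp, norm_neg]
  refine (norm_integral_le_of_norm_le (g := fun t => 3 * M t * (1 / u))
    ((hMint.const_mul 3).mul_const _) (Filter.Eventually.of_forall fun t => ?_)).trans ?_
  · rw [norm_mul, hVn]
    gcongr
    exact hU'n t
  · rw [integral_mul_const, integral_const_mul]
    calc _ ≤ 3 * (C₀ * K * √(Real.pi * 2) / b ^ 12) * (1 / u) := by gcongr
      _ = _ := by field_simp

open MeasureTheory in
lemma exists_sum_vonMangoldt_mul_gaussKer_le : ∃ C : ℝ, 0 < C ∧ ∀ b u : ℝ, 0 < b → b ≤ 1 → 0 < u →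
    ∀ S : Finset ℕ, ∑ n ∈ S, ArithmeticFunction.vonMangoldt n / n * gaussKer b (u - Real.log n) ≤
      2 * Real.pi + C / (b ^ 12 * u) := by
  obtain ⟨C, hC, hF⟩ := exists_norm_integral_logDerivZetaReg_le
  refine ⟨C, hC, fun b u hb hb1 hu S => ?_⟩
  have hσ : ∀ σ : ℝ, 1 < σ → σ ≤ 2 → ∑ n ∈ S, ArithmeticFunction.vonMangoldt n *
      (n : ℝ) ^ (-σ) * gaussKer b (u - Real.log n) ≤ 2 * Real.pi + C / (b ^ 12 * u) := by
    intro σ h1 h2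
    obtain ⟨hi, hb'⟩ := hF b σ u hb hb1 h1 h2 hu
    have hs := hasSum_integral_vonMangoldt hb h1 u
    have hpole := norm_integral_pole_le hb h1 u
    have hne : ∀ t : ℝ, (σ + Complex.I * t : ℂ) - 1 ≠ 0 := by
      intro t h
      have := congrArg Complex.re h
      simp at this; linarith
    have hpi : Integrable fun t : ℝ => Complex.exp (Complex.I * u * t) *
        (Real.exp (-b * t ^ 2) : ℝ) * (1 / ((σ + Complex.I * t : ℂ) - 1)) := by
      refine (integrable_cexp_mul_gauss hb u).mul_bdd (c := 1 / (σ - 1))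
        (Continuous.aestronglyMeasurable ?_) (Filter.Eventually.of_forall fun t => ?_)
      · exact continuous_const.div (by fun_prop) hne
      · rw [norm_div, norm_one]
        refine one_div_le_one_div_of_le (by linarith) ?_
        refine le_trans (le_of_eq ?_) (Complex.re_le_norm _)
        simp
    have hsplit : ∫ t : ℝ, Complex.exp (Complex.I * u * t) * (Real.exp (-b * t ^ 2) : ℝ) *
        (-deriv riemannZeta (σ + Complex.I * t) / riemannZeta (σ + Complex.I * t)) =
        (∫ t : ℝ, Complex.exp (Complex.I * u * t) * (Real.exp (-b * t ^ 2) : ℝ) *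
          logDerivZetaReg (σ + Complex.I * t)) +
        ∫ t : ℝ, Complex.exp (Complex.I * u * t) * (Real.exp (-b * t ^ 2) : ℝ) *
          (1 / ((σ + Complex.I * t : ℂ) - 1)) := by
      rw [← integral_add hi hpi]
      refine integral_congr_ae (Filter.Eventually.of_forall fun t => ?_)
      simp only
      rw [logDerivZetaReg_eq (by simpa using h1)]
      ring
    rw [hsplit] at hs
    have hsr := Complex.hasSum_re hs
    simp only [Complex.ofReal_re] at hsr
    refine (sum_le_hasSum S (fun n _ => ?_) hsr).trans ?_
    · exact mul_nonneg (mul_nonneg ArithmeticFunction.vonMangoldt_nonneg (by positivity))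
        (gaussKer_nonneg _ _)
    · refine (Complex.re_le_norm _).trans ((norm_add_le _ _).trans ?_)
      linarith
  have hlim : Filter.Tendsto (fun σ : ℝ => ∑ n ∈ S, ArithmeticFunction.vonMangoldt n *
      (n : ℝ) ^ (-σ) * gaussKer b (u - Real.log n)) (nhdsWithin 1 (Set.Ioi 1))
      (nhds (∑ n ∈ S, ArithmeticFunction.vonMangoldt n / n * gaussKer b (u - Real.log n))) := by
    refine tendsto_finsetSum _ fun n _ => Filter.Tendsto.mul_const _ ?_
    rcases eq_or_ne n 0 with rfl | hn
    · simp
    have hc : Continuous fun σ : ℝ => ArithmeticFunction.vonMangoldt n * (n : ℝ) ^ (-σ) :=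
      continuous_const.mul (Real.continuous_const_rpow (by exact_mod_cast hn) |>.comp
        continuous_neg)
    have h := (hc.tendsto 1).mono_left (nhdsWithin_le_nhds (s := Set.Ioi 1))
    rwa [Real.rpow_neg_one, ← div_eq_mul_inv] at h
  refine le_of_tendsto hlim ?_
  filter_upwards [Ioc_mem_nhdsGT (one_lt_two : (1 : ℝ) < 2)] with σ h
  exact hσ σ h.1 h.2

open MeasureTheory in
lemma le_integral_gaussKer {b τ α β x : ℝ} (hb : 0 < b) (hτ : 0 < τ) (hα : α ≤ x) (hβ : x ≤ β) :
    2 * Real.pi * (1 - 12 * b / τ ^ 2) ≤ ∫ u in (α - τ)..(β + τ), gaussKer b (u - x) := by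
  have hg : Integrable fun u => gaussKer b (u - x) := (integrable_gaussKer hb).comp_sub_right x
  have hg2 : Integrable fun u => gaussKer (2 * b) (u - x) :=
    (integrable_gaussKer (by positivity)).comp_sub_right x
  have hs : ∫ u, gaussKer b (u - x) = 2 * Real.pi := by
    rw [integral_sub_right_eq_self (gaussKer b) x, integral_gaussKer hb]
  have hs2 : ∫ u, gaussKer (2 * b) (u - x) = 2 * Real.pi := by
    rw [integral_sub_right_eq_self (gaussKer (2 * b)) x, integral_gaussKer (by positivity)]
  rw [intervalIntegral.integral_of_le (by linarith), ← integral_indicator measurableSet_Ioc]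
  have hind := hg.indicator (measurableSet_Ioc (a := α - τ) (b := β + τ))
  have hpt : ∀ u, gaussKer b (u - x) - 12 * b / τ ^ 2 * gaussKer (2 * b) (u - x) ≤
      (Set.Ioc (α - τ) (β + τ)).indicator (fun u => gaussKer b (u - x)) u := by
    intro u
    by_cases hu : u ∈ Set.Ioc (α - τ) (β + τ)
    · rw [Set.indicator_of_mem hu]
      have := gaussKer_nonneg (2 * b) (u - x)
      have : 0 ≤ 12 * b / τ ^ 2 * gaussKer (2 * b) (u - x) := by positivity
      linarith
    · rw [Set.indicator_of_notMem hu, sub_nonpos]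
      have hv : τ ^ 2 ≤ (u - x) ^ 2 := by
        rw [sq_le_sq, abs_of_pos hτ, le_abs]
        by_contra hcon
        push Not at hcon
        exact hu ⟨by linarith, by linarith⟩
      set v := u - x
      have e1 : Real.exp (-v ^ 2 / (4 * b)) = Real.exp (-(v ^ 2 / (8 * b))) *
          Real.exp (-v ^ 2 / (4 * (2 * b))) := by
        rw [← Real.exp_add]; congr 1; field_simp; ring
      have e2 : √(Real.pi / b) = √2 * √(Real.pi / (2 * b)) := by
        rw [← Real.sqrt_mul (by norm_num)]; congr 1; field_simp
      have e3 : Real.exp (-(v ^ 2 / (8 * b))) ≤ 8 * b / τ ^ 2 := by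
        rw [Real.exp_neg]
        have hq : τ ^ 2 / (8 * b) ≤ v ^ 2 / (8 * b) := by gcongr
        have := Real.add_one_le_exp (v ^ 2 / (8 * b))
        rw [show 8 * b / τ ^ 2 = (τ ^ 2 / (8 * b))⁻¹ by rw [inv_div]]
        exact inv_anti₀ (by positivity) (by linarith)
      have e4 : √2 ≤ 3 / 2 := Real.sqrt_le_iff.2 ⟨by norm_num, by norm_num⟩
      unfold gaussKer
      rw [e1, e2]
      calc _ ≤ 3 / 2 * √(Real.pi / (2 * b)) * (8 * b / τ ^ 2 *
            Real.exp (-v ^ 2 / (4 * (2 * b)))) := by gcongr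
        _ = _ := by ring
  have := integral_mono (hg.sub (hg2.const_mul (12 * b / τ ^ 2))) hind hpt
  simp only [Pi.sub_apply] at this
  rw [integral_sub hg (hg2.const_mul _), integral_const_mul, hs, hs2] at this
  linarith

open MeasureTheory in
lemma exists_sum_vonMangoldt_div_le : ∃ C : ℝ, 0 < C ∧ ∀ α β : ℝ, 1 / 2 ≤ α → α ≤ β →
    β ≤ α + 1 → ∀ S : Finset ℕ, (∀ n ∈ S, α ≤ Real.log n ∧ Real.log n ≤ β) →
    ∑ n ∈ S, ArithmeticFunction.vonMangoldt n / n ≤ β - α + C * α ^ (-(1 / 37) : ℝ) := by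
  obtain ⟨C, hC, hP⟩ := exists_sum_vonMangoldt_mul_gaussKer_le
  refine ⟨6 + 4 * C * 48 ^ 36, by positivity, fun α β hα hαβ hβ S hS => ?_⟩
  have hα0 : 0 < α := by linarith
  set w : ℝ := α ^ (-(1 / 37) : ℝ) with hw
  have hw0 : 0 < w := Real.rpow_pos_of_pos hα0 _
  have hw37 : w ^ 37 * α = 1 := by
    rw [hw, ← Real.rpow_natCast, ← Real.rpow_mul hα0.le]
    norm_num
    rw [Real.rpow_neg_one, inv_mul_cancel₀ hα0.ne']
  have hw2 : w ≤ 2 := by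
    by_contra hcon
    push Not at hcon
    have : (2 : ℝ) ^ 37 ≤ w ^ 37 := by gcongr
    nlinarith [pow_pos hw0 37]
  set τ := w / 48 with hτ
  have hτ0 : 0 < τ := by positivity
  have hτ1 : τ ≤ 1 / 24 := by rw [hτ]; linarith
  set b := τ ^ 3 with hb
  have hb0 : 0 < b := by positivity
  have hb1 : b ≤ 1 := pow_le_one₀ hτ0.le (by linarith)
  have hτα : τ ≤ α / 2 := by linarith
  have hbound : C / (b ^ 12 * (α / 2)) = 2 * C * 48 ^ 36 * w := by
    rw [hb, hτ]
    field_simp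
    linear_combination -hw37
  have htail : 12 * b / τ ^ 2 = 12 * τ := by rw [hb]; field_simp
  have h1 : (∑ n ∈ S, ArithmeticFunction.vonMangoldt n / n) * (2 * Real.pi * (1 - 12 * τ)) ≤
      ∫ u in (α - τ)..(β + τ), ∑ n ∈ S, ArithmeticFunction.vonMangoldt n / n *
        gaussKer b (u - Real.log n) := by
    rw [intervalIntegral.integral_finsetSum (fun n _ =>
      (((integrable_gaussKer hb0).comp_sub_right _).const_mul _).intervalIntegrable),
      Finset.sum_mul]
    refine Finset.sum_le_sum fun n hn => ?_
    rw [intervalIntegral.integral_const_mul, ← htail]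
    exact mul_le_mul_of_nonneg_left (le_integral_gaussKer hb0 hτ0 (hS n hn).1 (hS n hn).2)
      (div_nonneg ArithmeticFunction.vonMangoldt_nonneg (Nat.cast_nonneg _))
  have h2 : ∫ u in (α - τ)..(β + τ), ∑ n ∈ S, ArithmeticFunction.vonMangoldt n / n *
        gaussKer b (u - Real.log n) ≤ ∫ _u in (α - τ)..(β + τ),
          (2 * Real.pi + 2 * C * 48 ^ 36 * w) := by
    refine intervalIntegral.integral_mono_on (by linarith) ?_ (by simp) fun u hu => ?_
    · have : Integrable fun u => ∑ n ∈ S, ArithmeticFunction.vonMangoldt n / n *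
          gaussKer b (u - Real.log n) := integrable_finsetSum _ fun n _ =>
        ((integrable_gaussKer hb0).comp_sub_right _).const_mul _
      exact this.intervalIntegrable
    · have hu2 : α / 2 ≤ u := by linarith [hu.1]
      refine (hP b u hb0 hb1 (by linarith) S).trans ?_
      rw [← hbound]
      gcongr
  rw [intervalIntegral.integral_const, smul_eq_mul] at h2
  have h3 := h1.trans h2
  set s := ∑ n ∈ S, ArithmeticFunction.vonMangoldt n / n with hs
  have hpi : (1 : ℝ) ≤ Real.pi := by linarith [Real.pi_gt_three]
  set C₁ := C * 48 ^ 36 with hC₁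
  have hC₁0 : 0 < C₁ := by positivity
  have h4 : s * (1 - 12 * τ) ≤ (β - α + 2 * τ) * (1 + C₁ * w) := by
    have : (β + τ - (α - τ)) * (2 * Real.pi + 2 * C * 48 ^ 36 * w) ≤
        (β - α + 2 * τ) * (1 + C₁ * w) * (2 * Real.pi) := by
      rw [show β + τ - (α - τ) = β - α + 2 * τ by ring, mul_assoc (β - α + 2 * τ) (1 + C₁ * w)]
      refine mul_le_mul_of_nonneg_left ?_ (by linarith)
      rw [show 2 * C * 48 ^ 36 * w = 2 * (C₁ * w) by rw [hC₁]; ring]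
      have : 0 < C₁ * w := by positivity
      nlinarith
    refine le_of_mul_le_mul_right (a := 2 * Real.pi) ?_ (by positivity)
    linarith
  have h5 : (β - α + 2 * τ) * (1 + C₁ * w) ≤ (β - α + (6 + 4 * C₁) * w) * (1 - 12 * τ) := by
    have hw' : w = 48 * τ := by rw [hτ]; ring
    have hd0 : 0 ≤ β - α := by linarith
    have hd1 : β - α ≤ 1 := by linarith
    have p1 : (β - α) * τ ≤ τ := mul_le_of_le_one_left hτ0.le hd1
    have p2 : (β - α) * (C₁ * τ) ≤ C₁ * τ := mul_le_of_le_one_left (by positivity) hd1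
    have p3 : τ * τ ≤ 1 / 24 * τ := by gcongr
    have p4 : C₁ * (τ * τ) ≤ C₁ * (1 / 24 * τ) := by gcongr
    rw [hw']
    have p5 : 0 < C₁ * τ := by positivity
    nlinarith
  have h6 := le_of_mul_le_mul_right (h4.trans h5) (by linarith)
  rw [hC₁] at h6
  linarith

lemma exists_sum_primes_log_div_le : ∃ C : ℝ, 0 < C ∧ ∀ α β : ℝ, 1 / 2 ≤ α → α ≤ β →
    β ≤ α + 1 → ∀ S : Finset ℕ, (∀ p ∈ S, p.Prime ∧ α ≤ Real.log p ∧ Real.log p ≤ β) →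
    ∑ p ∈ S, Real.log p / p ≤ β - α + C * α ^ (-(1 / 37) : ℝ) := by
  obtain ⟨C, hC, h⟩ := exists_sum_vonMangoldt_div_le
  refine ⟨C, hC, fun α β h1 h2 h3 S hS => ?_⟩
  refine le_trans (Finset.sum_congr rfl fun p hp => ?_).le (h α β h1 h2 h3 S fun p hp => (hS p hp).2)
  rw [ArithmeticFunction.vonMangoldt_apply_prime (hS p hp).1]

lemma two_pow_card_primeFactors_le {n : ℕ} (hn : n ≠ 0) :
    2 ^ n.primeFactors.card ≤ n.divisors.card := by
  rw [Nat.card_divisors hn, ← Finset.prod_const]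
  refine Finset.prod_le_prod' fun p hp => ?_
  have := (Nat.prime_of_mem_primeFactors hp).factorization_pos_of_dvd hn
    (Nat.dvd_of_mem_primeFactors hp)
  omega

lemma le_two_pow_card_primeFactors_mul_totient (n : ℕ) :
    n ≤ 2 ^ n.primeFactors.card * Nat.totient n := by
  have h := Nat.totient_mul_prod_primeFactors n
  have h1 : ∏ p ∈ n.primeFactors, p ≤ 2 ^ n.primeFactors.card * ∏ p ∈ n.primeFactors, (p - 1) := by
    rw [← Finset.prod_const, ← Finset.prod_mul_distrib]
    refine Finset.prod_le_prod' fun p hp => ?_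
    have := (Nat.prime_of_mem_primeFactors hp).two_le
    omega
  have h2 : 0 < ∏ p ∈ n.primeFactors, (p - 1) := Finset.prod_pos fun p hp => by
    have := (Nat.prime_of_mem_primeFactors hp).two_le
    omega
  refine Nat.le_of_mul_le_mul_right ?_ h2
  rw [← h]
  calc _ ≤ Nat.totient n * (2 ^ n.primeFactors.card * ∏ p ∈ n.primeFactors, (p - 1)) := by gcongr
    _ = _ := by ring

lemma le_pow_mul_sq_of_dvd {n e B z : ℕ} (hn : n ≠ 0) (he : e ∣ n)
    (hB : ∀ b, B < b → ¬ b ^ 2 ∣ n) (hz : 1 ≤ z) (hp : ∀ p, p.Prime → p ∣ e → p ≤ z) :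
    e ≤ z ^ n.primeFactors.card * B ^ 2 := by
  obtain ⟨a, b, rfl, ha⟩ := Nat.sq_mul_squarefree e
  have hb : b ≤ B := by
    by_contra h
    exact hB b (not_le.1 h) ((dvd_mul_right _ _).trans he)
  have ha' : a ≤ z ^ n.primeFactors.card := by
    rw [← Nat.prod_primeFactors_of_squarefree ha]
    calc _ ≤ ∏ p ∈ a.primeFactors, z := Finset.prod_le_prod' fun p h =>
          hp p (Nat.prime_of_mem_primeFactors h) ((Nat.dvd_of_mem_primeFactors h).mul_left _)
      _ = z ^ a.primeFactors.card := Finset.prod_const _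
      _ ≤ _ := Nat.pow_le_pow_right hz (Finset.card_le_card
          (Nat.primeFactors_mono ((dvd_mul_left _ _).trans he) hn))
  calc b ^ 2 * a ≤ B ^ 2 * z ^ n.primeFactors.card := by gcongr
    _ = _ := mul_comm _ _

lemma sum_inv_le_card_div {y : ℕ} (hy : 0 < y) {A : Finset ℕ} (hA : ∀ n ∈ A, y ≤ n) :
    ∑ n ∈ A, (1 : ℝ) / n ≤ A.card / y := by
  rw [div_eq_mul_one_div, ← nsmul_eq_mul]
  refine Finset.sum_le_card_nsmul _ _ _ fun n hn => ?_
  have : (y : ℝ) ≤ n := by exact_mod_cast hA n hn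
  gcongr

lemma sum_inv_of_sq_dvd_le {y B : ℕ} (hy : 0 < y) (hB : 0 < B) {A : Finset ℕ}
    (hA : ∀ n ∈ A, y ≤ n ∧ n < 2 * y ∧ ∃ b, B < b ∧ b ^ 2 ∣ n) :
    ∑ n ∈ A, (1 : ℝ) / n ≤ 2 / B := by
  have hsub : A ⊆ (Finset.Ioc B (B + 2 * y)).biUnion fun b =>
      (Finset.Icc 1 (2 * y / b ^ 2)).image (b ^ 2 * ·) := by
    intro n hn
    obtain ⟨h1, h2, b, hb, k, rfl⟩ := hA n hn
    have hb2 : 0 < b ^ 2 := pow_pos (by omega) 2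
    have hk : 0 < k := Nat.pos_of_ne_zero (by rintro rfl; simp at h1; omega)
    refine Finset.mem_biUnion.2 ⟨b, Finset.mem_Ioc.2 ⟨hb, ?_⟩, Finset.mem_image.2 ⟨k,
      Finset.mem_Icc.2 ⟨hk, ?_⟩, rfl⟩⟩
    · nlinarith [Nat.le_self_pow two_ne_zero b]
    · rw [Nat.le_div_iff_mul_le hb2]; nlinarith
  have hcard : (A.card : ℝ) ≤ 2 * y / B := by
    have h1 : A.card ≤ ∑ b ∈ Finset.Ioc B (B + 2 * y), 2 * y / b ^ 2 := by
      refine (Finset.card_le_card hsub).trans (Finset.card_biUnion_le.trans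
        (Finset.sum_le_sum fun b _ => Finset.card_image_le.trans ?_))
      simp
    calc (A.card : ℝ) ≤ ∑ b ∈ Finset.Ioc B (B + 2 * y), ((2 * y / b ^ 2 : ℕ) : ℝ) := by
          exact_mod_cast h1
      _ ≤ ∑ b ∈ Finset.Ioc B (B + 2 * y), (2 * y : ℝ) * ((b : ℝ) ^ 2)⁻¹ := by
          refine Finset.sum_le_sum fun b _ => Nat.cast_div_le.trans (le_of_eq ?_)
          push_cast; rw [div_eq_mul_inv]
      _ ≤ 2 * y * (B : ℝ)⁻¹ := by
          rw [← Finset.mul_sum]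
          gcongr
          refine (sum_Ioc_inv_sq_le_sub (α := ℝ) hB.ne' (by omega)).trans ?_
          simp only [sub_le_self_iff]; positivity
      _ = _ := by rw [div_eq_mul_inv]
  refine (sum_inv_le_card_div hy fun n hn => (hA n hn).1).trans ?_
  have hy' : (0 : ℝ) < y := by exact_mod_cast hy
  rw [div_le_iff₀ hy']
  exact hcard.trans_eq (by ring)

lemma sum_inv_Icc_le_one_add_log {N : ℕ} : ∑ d ∈ Finset.Icc 1 N, (1 : ℝ) / d ≤ 1 + Real.log N := by
  have h := harmonic_le_one_add_log N
  rw [harmonic_eq_sum_Icc] at h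
  push_cast at h
  simpa [one_div] using h

lemma sum_inv_of_many_divisors_le {y T : ℕ} (hy : 0 < y) (hT : 0 < T) {A : Finset ℕ}
    (hA : ∀ n ∈ A, y ≤ n ∧ n < 2 * y ∧ T < n.divisors.card) :
    ∑ n ∈ A, (1 : ℝ) / n ≤ 2 * (1 + Real.log (2 * y)) / T := by
  have hcard : (A.card : ℝ) * T ≤ 2 * y * (1 + Real.log (2 * y)) := by
    have h0 : A ⊆ Finset.Ioc 0 (2 * y) := fun n hn => by
      obtain ⟨h1, h2, -⟩ := hA n hn
      simp; omega
    have h1 : A.card * T ≤ ∑ n ∈ Finset.Ioc 0 (2 * y), (2 * y) / n := by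
      rw [← ArithmeticFunction.sum_Ioc_sigma0_eq_sum_div, ← smul_eq_mul]
      refine (Finset.card_nsmul_le_sum A _ T fun n hn => ?_).trans
        (Finset.sum_le_sum_of_subset (f := fun n => ArithmeticFunction.sigma 0 n) h0)
      rw [ArithmeticFunction.sigma_zero_apply]
      exact (hA n hn).2.2.le
    calc (A.card : ℝ) * T ≤ ∑ n ∈ Finset.Ioc 0 (2 * y), (((2 * y) / n : ℕ) : ℝ) := by
          exact_mod_cast h1
      _ ≤ ∑ n ∈ Finset.Ioc 0 (2 * y), (2 * y : ℝ) * (1 / n) := by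
          refine Finset.sum_le_sum fun n _ => Nat.cast_div_le.trans (le_of_eq ?_)
          push_cast; rw [div_eq_mul_one_div]
      _ ≤ _ := by
          rw [← Finset.mul_sum]
          gcongr
          have := sum_inv_Icc_le_one_add_log (N := 2 * y)
          push_cast at this
          exact this
  refine (sum_inv_le_card_div hy fun n hn => (hA n hn).1).trans ?_
  have hy' : (0 : ℝ) < y := by exact_mod_cast hy
  have hT' : (0 : ℝ) < T := by exact_mod_cast hT
  rw [div_le_div_iff₀ hy' hT']
  linarith

/-- The largest prime factor of `n` (and `0` when there is none). -/
def maxPrimeFac (n : ℕ) : ℕ := n.primeFactors.sup id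

lemma prime_le_maxPrimeFac {n p : ℕ} (hn : n ≠ 0) (hp : p.Prime) (hpn : p ∣ n) :
    p ≤ maxPrimeFac n :=
  Finset.le_sup (f := id) (Nat.mem_primeFactors.2 ⟨hp, hpn, hn⟩)

lemma maxPrimeFac_mem {n : ℕ} (hn : 2 ≤ n) : maxPrimeFac n ∈ n.primeFactors := by
  obtain ⟨p, hp, h⟩ := Finset.exists_mem_eq_sup n.primeFactors
    (Nat.nonempty_primeFactors.2 (by omega)) id
  rw [maxPrimeFac, h]; exact hp

lemma exists_sum_inv_primes_le : ∃ C : ℝ, 0 < C ∧ ∀ α W : ℝ, 1 ≤ α → 0 ≤ W →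
    ∀ S : Finset ℕ, (∀ p ∈ S, p.Prime ∧ α ≤ Real.log p ∧ Real.log p ≤ α + W) →
    ∑ p ∈ S, (1 : ℝ) / p ≤ C * (W + 1) / α := by
  obtain ⟨C, hC, h⟩ := exists_sum_primes_log_div_le
  have unit : ∀ α : ℝ, 1 ≤ α → ∀ S : Finset ℕ,
      (∀ p ∈ S, p.Prime ∧ α ≤ Real.log p ∧ Real.log p ≤ α + 1) →
      ∑ p ∈ S, (1 : ℝ) / p ≤ (1 + C) / α := by
    intro α hα S hS
    have h1 := h α (α + 1) (by linarith) (by linarith) le_rfl S hS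
    have h2 : α ^ (-(1 / 37) : ℝ) ≤ 1 := Real.rpow_le_one_of_one_le_of_nonpos hα (by norm_num)
    rw [le_div_iff₀ (by linarith), Finset.sum_mul]
    calc ∑ p ∈ S, 1 / (p : ℝ) * α ≤ ∑ p ∈ S, Real.log p / p := by
          refine Finset.sum_le_sum fun p hp => ?_
          rw [one_div_mul_eq_div]
          exact div_le_div_of_nonneg_right (hS p hp).2.1 (Nat.cast_nonneg p)
      _ ≤ 1 + C := by nlinarith
  have key : ∀ k : ℕ, ∀ α : ℝ, 1 ≤ α → ∀ S : Finset ℕ,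
      (∀ p ∈ S, p.Prime ∧ α ≤ Real.log p ∧ Real.log p ≤ α + k) →
      ∑ p ∈ S, (1 : ℝ) / p ≤ (1 + C) * (k + 1) / α := by
    intro k
    induction k with
    | zero =>
      intro α hα S hS
      refine (unit α hα S fun p hp => ?_).trans_eq (by simp)
      obtain ⟨a, b, c⟩ := hS p hp
      exact ⟨a, b, by push_cast at c; linarith⟩
    | succ k ih =>
      intro α hα S hS
      rw [← Finset.sum_filter_add_sum_filter_not S (fun p => Real.log p ≤ α + 1)]
      have h1 := unit α hα (S.filter fun p => Real.log p ≤ α + 1) fun p hp => by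
        rw [Finset.mem_filter] at hp
        exact ⟨(hS p hp.1).1, (hS p hp.1).2.1, hp.2⟩
      have h2 := ih (α + 1) (by linarith) (S.filter fun p => ¬ Real.log p ≤ α + 1) fun p hp => by
        rw [Finset.mem_filter] at hp
        obtain ⟨a, b, c⟩ := hS p hp.1
        push_cast at c
        exact ⟨a, by linarith [hp.2], by linarith⟩
      have h3 : (1 + C) * (k + 1) / (α + 1) ≤ (1 + C) * (k + 1) / α := by
        gcongr; linarith
      calc _ ≤ (1 + C) / α + (1 + C) * (k + 1) / α := by linarith
        _ = _ := by push_cast; ring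
  refine ⟨2 * (1 + C), by positivity, fun α W hα hW S hS => ?_⟩
  have hk := Nat.ceil_lt_add_one hW
  refine (key ⌈W⌉₊ α hα S fun p hp => ?_).trans ?_
  · obtain ⟨a, b, c⟩ := hS p hp
    exact ⟨a, b, c.trans (by linarith [Nat.le_ceil W])⟩
  · gcongr ?_ / _
    nlinarith

lemma log_choose_add_le {t H : ℕ} (hH : 0 < H) :
    Real.log ((t + H).choose H) ≤ H * Real.log (Real.exp 1 * (t + H) / H) := by
  have hH' : (0 : ℝ) < H := by exact_mod_cast hH
  have h1 : ((t + H).choose H : ℝ) ≤ ((t + H : ℕ) : ℝ) ^ H / H.factorial :=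
    Nat.choose_le_pow_div H (t + H)
  have h2 : (H : ℝ) ^ H / H.factorial ≤ Real.exp H := Real.pow_div_factorial_le_exp _ hH'.le H
  have h3 : ((t + H).choose H : ℝ) ≤ (Real.exp 1 * (t + H) / H) ^ H := by
    refine h1.trans ?_
    have hf : (0 : ℝ) < H.factorial := by exact_mod_cast H.factorial_pos
    rw [div_le_iff₀ hf] at h2
    rw [div_pow, mul_pow, ← Real.exp_nat_mul, mul_one, div_le_div_iff₀ hf (by positivity)]
    push_cast
    calc ((t : ℝ) + H) ^ H * H ^ H ≤ (t + H) ^ H * (Real.exp H * H.factorial) := by gcongr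
      _ = _ := by ring
  have h4 : (0 : ℝ) < (t + H).choose H := by
    exact_mod_cast Nat.choose_pos (Nat.le_add_left H t)
  calc _ ≤ Real.log ((Real.exp 1 * (t + H) / H) ^ H) := Real.log_le_log h4 h3
    _ = _ := Real.log_pow _ _

lemma card_primes_mul_log_le {t H : ℕ} (hH : 0 < H) (hHt : H ≤ t) {S : Finset ℕ}
    (hS : ∀ p ∈ S, p.Prime ∧ t < p ∧ p ≤ t + H) :
    S.card * Real.log t ≤ H * Real.log (Real.exp 1 * (t + H) / H) := by
  refine le_trans ?_ (log_choose_add_le hH)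
  have hdvd : ∏ p ∈ S, p ∣ (t + H).choose H := by
    refine Finset.prod_primes_dvd _ (fun p hp => (hS p hp).1.prime) fun p hp => ?_
    obtain ⟨h1, h2, h3⟩ := hS p hp
    exact h1.dvd_choose (by omega) (by omega) h3
  have hpos : 0 < (t + H).choose H := Nat.choose_pos (Nat.le_add_left H t)
  have h1 : t ^ S.card ≤ (t + H).choose H := by
    refine le_trans ?_ (Nat.le_of_dvd hpos hdvd)
    rw [← Finset.prod_const]
    exact Finset.prod_le_prod' fun p hp => (hS p hp).2.1.le
  have ht : 0 < t := by omega
  rw [← Real.log_pow]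
  refine Real.log_le_log (by positivity) ?_
  exact_mod_cast h1

lemma exp_le_one_add_two_mul {η : ℝ} (h0 : 0 ≤ η) (h1 : η ≤ 1) : Real.exp η ≤ 1 + 2 * η := by
  have := Real.abs_exp_sub_one_le (x := η) (by rwa [abs_of_nonneg h0])
  rw [abs_of_nonneg h0] at this
  linarith [le_abs_self (Real.exp η - 1)]

lemma card_Icc_mul_exp_le {η X : ℝ} (h0 : 0 < η) (h1 : η ≤ 1) (hX : 1 ≤ η * X) {S : Finset ℕ}
    (hS : ∀ p ∈ S, X ≤ (p : ℝ) ∧ (p : ℝ) ≤ Real.exp η * X) : (S.card : ℝ) ≤ 3 * (η * X) := by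
  have hX0 : 0 < X := by
    by_contra h
    nlinarith
  have h2 := exp_le_one_add_two_mul h0.le h1
  have hsub : S ⊆ Finset.Icc ⌈X⌉₊ ⌊Real.exp η * X⌋₊ := fun p hp => by
    rw [Finset.mem_Icc]
    exact ⟨Nat.ceil_le.2 (hS p hp).1, Nat.le_floor (hS p hp).2⟩
  have h3 := Finset.card_le_card hsub
  rw [Nat.card_Icc] at h3
  rcases le_or_gt ⌈X⌉₊ (⌊Real.exp η * X⌋₊ + 1) with h | h
  · have h4 : (S.card : ℝ) ≤ (⌊Real.exp η * X⌋₊ + 1 : ℝ) - ⌈X⌉₊ := by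
      have : S.card + ⌈X⌉₊ ≤ ⌊Real.exp η * X⌋₊ + 1 := by omega
      have h5 : (S.card : ℝ) + ⌈X⌉₊ ≤ ⌊Real.exp η * X⌋₊ + 1 := by exact_mod_cast this
      linarith
    have h5 := Nat.floor_le (show 0 ≤ Real.exp η * X by positivity)
    have h6 := Nat.le_ceil X
    nlinarith
  · have : S.card = 0 := by omega
    rw [this]; push_cast; positivity

lemma card_primes_Icc_mul_exp_le {η X : ℝ} (h0 : 0 < η) (h1 : η ≤ 1 / 8) (hX : 2 ≤ η * X)
    {S : Finset ℕ}
    (hS : ∀ p ∈ S, p.Prime ∧ X ≤ (p : ℝ) ∧ (p : ℝ) ≤ Real.exp η * X) :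
    (S.card : ℝ) ≤ 8 * Real.log (10 / η) / Real.log X * (η * X) := by
  have hX0 : 16 ≤ X := by
    by_contra h
    nlinarith
  have h2 := exp_le_one_add_two_mul h0.le (by linarith)
  set H := ⌈2 * (η * X)⌉₊ + 1 with hH
  have hH1 : 2 * (η * X) + 1 ≤ H := by
    rw [hH]; push_cast; linarith [Nat.le_ceil (2 * (η * X))]
  have hH2 : (H : ℝ) ≤ 3 * (η * X) := by
    rw [hH]; push_cast
    linarith [Nat.ceil_lt_add_one (show 0 ≤ 2 * (η * X) by linarith)]
  set t := ⌈X⌉₊ - 1 with ht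
  have hc : 16 ≤ ⌈X⌉₊ := by
    have : (16 : ℝ) ≤ ⌈X⌉₊ := hX0.trans (Nat.le_ceil X)
    exact_mod_cast this
  have ht1 : (t : ℝ) = ⌈X⌉₊ - 1 := by rw [ht, Nat.cast_sub (by omega)]; simp
  have ht2 : (t : ℝ) < X := by
    rw [ht1]; linarith [Nat.ceil_lt_add_one (show 0 ≤ X by linarith)]
  have ht3 : X - 1 ≤ t := by rw [ht1]; linarith [Nat.le_ceil X]
  have hHt : H ≤ t := by
    have : (H : ℝ) ≤ t := by nlinarith
    exact_mod_cast this
  have h3 := card_primes_mul_log_le (t := t) (H := H) (by omega) hHt (S := S) fun p hp => by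
    obtain ⟨a, b, c⟩ := hS p hp
    refine ⟨a, ?_, ?_⟩
    · have : (t : ℝ) < p := by linarith
      exact_mod_cast this
    · have : (p : ℝ) ≤ t + H := by nlinarith
      exact_mod_cast this
  have hlogX : 0 < Real.log X := Real.log_pos (by linarith)
  have hHpos : (0 : ℝ) < H := by linarith
  have h4 : Real.log X / 2 ≤ Real.log t := by
    rw [div_le_iff₀ two_pos, mul_comm, ← Nat.cast_two, ← Real.log_pow]
    refine Real.log_le_log (by linarith) ?_
    nlinarith
  have h5 : Real.log (Real.exp 1 * (t + H) / H) ≤ Real.log (10 / η) := by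
    refine Real.log_le_log (by positivity) ?_
    rw [div_le_div_iff₀ hHpos h0]
    have he : Real.exp 1 ≤ 3 := by linarith [Real.exp_one_lt_d9]
    calc Real.exp 1 * (t + H) * η ≤ 3 * (X + X) * η := by
          gcongr
          nlinarith
      _ ≤ 10 * H := by nlinarith
  have h6 : 0 ≤ Real.log (10 / η) := by
    refine Real.log_nonneg ?_
    rw [le_div_iff₀ h0]; linarith
  rw [div_mul_eq_mul_div, le_div_iff₀ hlogX]
  have h7 : (H : ℝ) * Real.log (Real.exp 1 * (t + H) / H) ≤
      3 * (η * X) * Real.log (10 / η) := by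
    calc _ ≤ (H : ℝ) * Real.log (10 / η) := by gcongr
      _ ≤ _ := by gcongr
  have h8 : (S.card : ℝ) * (Real.log X / 2) ≤ S.card * Real.log t := by gcongr
  have h9 : 0 ≤ (η * X) * Real.log (10 / η) := mul_nonneg (by linarith) h6
  nlinarith

lemma card_le_of_fibers {y N : ℕ} {K η : ℝ} (hy : 0 < y) (hη0 : 0 < η) (hη1 : η ≤ 1) (hK : 1 ≤ K)
    {A : Finset ℕ} (hA : ∀ n ∈ A, y ≤ n ∧ n < 2 * y ∧ (n : ℝ) ≤ K * Nat.totient n)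
    (hmono : ∀ m ∈ A, ∀ n ∈ A, m ≤ n → Nat.totient m ≤ Nat.totient n)
    (hfib : ∀ F ⊆ A, (∀ m ∈ F, ∀ n ∈ F, |Real.log m - Real.log n| ≤ η ∧
      |Real.log (Nat.totient m) - Real.log (Nat.totient n)| ≤ η) → F.card ≤ N) :
    (A.card : ℝ) ≤ N * ((Real.log K + 5) / η) := by
  have hyR : (0 : ℝ) < y := by exact_mod_cast hy
  have hn : ∀ n ∈ A, Real.log y ≤ Real.log n ∧ Real.log n ≤ Real.log y + 1 := fun n hn => by
    obtain ⟨h1, h2, -⟩ := hA n hn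
    refine ⟨Real.log_le_log hyR (by exact_mod_cast h1), ?_⟩
    have : (n : ℝ) ≤ 2 * y := by exact_mod_cast h2.le
    have h3 := Real.log_le_log (by exact_mod_cast (by omega : 0 < n)) this
    rw [Real.log_mul two_ne_zero hyR.ne'] at h3
    linarith [Real.log_two_lt_d9]
  have hφ : ∀ n ∈ A, Real.log y - Real.log K ≤ Real.log (Nat.totient n) ∧
      Real.log (Nat.totient n) ≤ Real.log y + 1 := fun n hn' => by
    obtain ⟨h1, h2, h3⟩ := hA n hn'
    have h4 : (0 : ℝ) < Nat.totient n := by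
      exact_mod_cast Nat.totient_pos.2 (by omega)
    have h5 : (y : ℝ) ≤ n := by exact_mod_cast h1
    constructor
    · have := Real.log_le_log hyR (h5.trans h3)
      rw [Real.log_mul (by linarith) h4.ne'] at this
      linarith
    · refine le_trans (Real.log_le_log h4 ?_) (hn n hn').2
      exact_mod_cast Nat.totient_le n
  set a : ℕ → ℤ := fun n => ⌊Real.log n / η⌋
  set b : ℕ → ℤ := fun n => ⌊Real.log (Nat.totient n) / η⌋
  have ha : ∀ m ∈ A, ∀ n ∈ A, m ≤ n → a m ≤ a n := fun m hm n _ h => by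
    refine Int.floor_le_floor (div_le_div_of_nonneg_right (Real.log_le_log ?_ ?_) hη0.le)
    · have := (hA m hm).1
      exact_mod_cast (by omega : 0 < m)
    · exact_mod_cast h
  have hb : ∀ m ∈ A, ∀ n ∈ A, m ≤ n → b m ≤ b n := fun m hm n hn h => by
    refine Int.floor_le_floor (div_le_div_of_nonneg_right (Real.log_le_log ?_ ?_) hη0.le)
    · have := (hA m hm).1
      exact_mod_cast Nat.totient_pos.2 (by omega)
    · exact_mod_cast hmono m hm n hn h
  have hclose : ∀ u v : ℝ, ⌊u / η⌋ = ⌊v / η⌋ → |u - v| ≤ η := fun u v h => by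
    have h1 := Int.abs_sub_lt_one_of_floor_eq_floor h
    rw [← sub_div, abs_div, abs_of_pos hη0, div_lt_one hη0] at h1
    exact h1.le
  have hcard := Finset.card_le_mul_card_image (f := fun n => a n + b n) A N (by
    intro k _
    refine hfib _ (Finset.filter_subset _ _) fun m hm n hn => ?_
    rw [Finset.mem_filter] at hm hn
    have key : a m = a n ∧ b m = b n := by
      rcases le_total m n with h | h
      · have := ha m hm.1 n hn.1 h
        have := hb m hm.1 n hn.1 h
        have := hm.2; have := hn.2
        constructor <;> omega
      · have := ha n hn.1 m hm.1 h
        have := hb n hn.1 m hm.1 h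
        have := hm.2; have := hn.2
        constructor <;> omega
    exact ⟨hclose _ _ key.1, hclose _ _ key.2⟩)
  set lo : ℤ := ⌊(Real.log y) / η⌋ + ⌊(Real.log y - Real.log K) / η⌋
  set hi : ℤ := ⌊(Real.log y + 1) / η⌋ + ⌊(Real.log y + 1) / η⌋
  have himg : A.image (fun n => a n + b n) ⊆ Finset.Icc lo hi := by
    intro k hk
    obtain ⟨n, hn', rfl⟩ := Finset.mem_image.1 hk
    have h1 := hn n hn'
    have h2 := hφ n hn'
    rw [Finset.mem_Icc]
    exact ⟨add_le_add (Int.floor_le_floor (div_le_div_of_nonneg_right h1.1 hη0.le))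
      (Int.floor_le_floor (div_le_div_of_nonneg_right h2.1 hη0.le)),
      add_le_add (Int.floor_le_floor (div_le_div_of_nonneg_right h1.2 hη0.le))
      (Int.floor_le_floor (div_le_div_of_nonneg_right h2.2 hη0.le))⟩
  have hlogK := Real.log_nonneg hK
  have himg' : ((A.image (fun n => a n + b n)).card : ℝ) ≤ (Real.log K + 5) / η := by
    have h1 := Finset.card_le_card himg
    rw [Int.card_Icc] at h1
    have h2 : (((hi + 1 - lo).toNat : ℤ) : ℝ) ≤ (Real.log K + 5) / η := by
      rw [Int.toNat_eq_max, Int.cast_max]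
      refine max_le ?_ (by push_cast; positivity)
      have e1 := Int.floor_le ((Real.log y + 1) / η)
      have e2 := Int.lt_floor_add_one (Real.log y / η)
      have e3 := Int.lt_floor_add_one ((Real.log y - Real.log K) / η)
      have e4 : 1 ≤ 1 / η := by rwa [le_div_iff₀ hη0, one_mul]
      have e5 : (Real.log K + 5) / η = 2 * ((Real.log y + 1) / η) - Real.log y / η -
        (Real.log y - Real.log K) / η + 3 * (1 / η) := by ring
      push_cast [lo, hi]
      rw [e5]
      linarith
    refine le_trans ?_ h2
    exact_mod_cast h1
  calc (A.card : ℝ) ≤ N * (A.image (fun n => a n + b n)).card := by exact_mod_cast hcard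
    _ ≤ _ := by gcongr

lemma sub_le_of_log_div_sub_le {p q P : ℕ} {δ : ℝ} (hp : P < p) (hP : 0 < P)
    (hpq : p ≤ q) (hq : q ≤ 2 * P)
    (h : Real.log (p / (p - 1)) - Real.log (q / (q - 1)) ≤ δ) :
    (q : ℝ) - p ≤ 4 * P ^ 2 * δ := by
  have hp1 : (1 : ℝ) < p := by exact_mod_cast (by omega : 1 < p)
  have hpq' : (p : ℝ) ≤ q := by exact_mod_cast hpq
  have hq2 : (q : ℝ) ≤ 2 * P := by exact_mod_cast hq
  have hP' : (0 : ℝ) < P := by exact_mod_cast hP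
  have h1 : Real.log (p / (p - 1)) - Real.log (q / (q - 1)) =
      Real.log (p * (q - 1) / ((p - 1) * q)) := by
    rw [← Real.log_div (by apply ne_of_gt; apply div_pos <;> linarith)
      (by apply ne_of_gt; apply div_pos <;> linarith), div_div_div_eq]
  have hpos : 0 < (p : ℝ) * (q - 1) / ((p - 1) * q) := by
    apply div_pos <;> apply mul_pos <;> linarith
  have h2 := Real.one_sub_inv_le_log_of_pos hpos
  rw [← h1] at h2
  have h3 : 1 - ((p : ℝ) * (q - 1) / ((p - 1) * q))⁻¹ = (q - p) / (p * (q - 1)) := by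
    have : (q : ℝ) - 1 ≠ 0 := by linarith
    have : (p : ℝ) ≠ 0 := by linarith
    rw [inv_div]
    field_simp
    ring
  rw [h3] at h2
  have h4 := h2.trans h
  rw [div_le_iff₀ (by apply mul_pos <;> linarith)] at h4
  have hδ : 0 ≤ δ := by
    refine le_trans ?_ (h2.trans h)
    apply div_nonneg; linarith; apply mul_nonneg <;> linarith
  refine h4.trans ?_
  rw [mul_comm]
  refine mul_le_mul_of_nonneg_right ?_ hδ
  calc (p : ℝ) * (q - 1) ≤ (2 * P) * (2 * P) := by
        apply mul_le_mul <;> linarith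
    _ = _ := by ring

lemma card_le_of_sub_le {S : Finset ℕ} {L : ℝ} (hL : 0 ≤ L)
    (h : ∀ p ∈ S, ∀ q ∈ S, p ≤ q → (q : ℝ) - p ≤ L) : (S.card : ℝ) ≤ L + 1 := by
  rcases S.eq_empty_or_nonempty with rfl | hS
  · simp; linarith
  have hsub : S ⊆ Finset.Icc (S.min' hS) (S.max' hS) := fun p hp =>
    Finset.mem_Icc.2 ⟨S.min'_le p hp, S.le_max' p hp⟩
  have h1 := Finset.card_le_card hsub
  have h2 := S.min'_le_max' hS
  rw [Nat.card_Icc] at h1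
  have h3 := h _ (S.min'_mem hS) _ (S.max'_mem hS) h2
  have h4 : S.card + S.min' hS ≤ S.max' hS + 1 := by omega
  have h5 : (S.card : ℝ) + S.min' hS ≤ S.max' hS + 1 := by exact_mod_cast h4
  linarith

lemma log_div_totient_eq {d p q e : ℕ} (hd : 0 < d) (hp : p.Prime) (hq : q.Prime)
    (hpd : ¬ p ∣ d) (hqdp : ¬ q ∣ d * p) :
    Real.log ((d * p ^ (e + 1) * q : ℕ)) - Real.log (Nat.totient (d * p ^ (e + 1) * q)) =
      (Real.log d - Real.log (Nat.totient d)) + Real.log (p / (p - 1)) +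
        Real.log (q / (q - 1)) := by
  have c1 : Nat.Coprime (d * p ^ (e + 1)) q := by
    rw [Nat.coprime_comm, hq.coprime_iff_not_dvd]
    intro h
    apply hqdp
    rcases hq.dvd_mul.1 h with h | h
    · exact h.mul_right _
    · exact (hq.dvd_of_dvd_pow h).mul_left _
  have c2 : Nat.Coprime d (p ^ (e + 1)) :=
    Nat.Coprime.pow_right _ (Nat.coprime_comm.1 ((hp.coprime_iff_not_dvd).2 hpd))
  rw [Nat.totient_mul c1, Nat.totient_mul c2, Nat.totient_prime hq,
    Nat.totient_prime_pow_succ hp]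
  have hd' : (d : ℝ) ≠ 0 := by exact_mod_cast hd.ne'
  have hφ : (Nat.totient d : ℝ) ≠ 0 := by exact_mod_cast (Nat.totient_pos.2 hd).ne'
  have hp1 : (1 : ℝ) < p := by exact_mod_cast hp.one_lt
  have hq1 : (1 : ℝ) < q := by exact_mod_cast hq.one_lt
  have hp2 : (p : ℝ) - 1 ≠ 0 := by linarith
  have hq2 : (q : ℝ) - 1 ≠ 0 := by linarith
  have hp0 : (p : ℝ) ≠ 0 := by linarith
  have hq0 : (q : ℝ) ≠ 0 := by linarith
  rw [Nat.cast_mul, Nat.cast_mul, Nat.cast_mul, Nat.cast_mul, Nat.cast_mul,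
    Nat.cast_sub hp.one_lt.le, Nat.cast_sub hq.one_lt.le, Nat.cast_pow, Nat.cast_pow, Nat.cast_one,
    Real.log_mul (mul_ne_zero hd' (pow_ne_zero _ hp0)) hq0, Real.log_mul hd' (pow_ne_zero _ hp0),
    Real.log_mul (mul_ne_zero hφ (mul_ne_zero (pow_ne_zero _ hp0) hp2)) hq2,
    Real.log_mul hφ (mul_ne_zero (pow_ne_zero _ hp0) hp2), Real.log_mul (pow_ne_zero _ hp0) hp2,
    Real.log_div hp0 hp2, Real.log_div hq0 hq2, Real.log_pow, Real.log_pow]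
  push_cast
  ring

/-- `n = d * p ^ (e + 1) * q` with `p ∈ (P, 2P]` prime not dividing `d`, and `q` a prime which is
large in terms of `η` and `X₀` and divides neither `d` nor `p`. -/
def HasShape (P : ℕ) (η X₀ : ℝ) (d p e q n : ℕ) : Prop :=
  p.Prime ∧ q.Prime ∧ P < p ∧ p ≤ 2 * P ∧ ¬ p ∣ d ∧ ¬ q ∣ d * p ∧ 1 ≤ η * q ∧ 3 * X₀ ≤ q ∧
    n = d * p ^ (e + 1) * q

lemma log_div_sub_one_mem {q : ℕ} {η : ℝ} (hq : q.Prime) (h : 1 ≤ η * q) :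
    0 ≤ Real.log (q / (q - 1)) ∧ Real.log (q / (q - 1)) ≤ 2 * η := by
  have hq2 : (2 : ℝ) ≤ q := by exact_mod_cast hq.two_le
  have hq1 : (0 : ℝ) < q - 1 := by linarith
  constructor
  · refine Real.log_nonneg ?_
    rw [le_div_iff₀ hq1]; linarith
  · refine (Real.log_le_sub_one_of_pos (by positivity)).trans ?_
    rw [sub_le_iff_le_add, div_le_iff₀ hq1]
    nlinarith

lemma sum_inv_two_pow_le (N : ℕ) : ∑ e ∈ Finset.range N, ((1 : ℝ) / 2) ^ e ≤ 2 :=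
  sum_geometric_two_le N

lemma card_fiber_le {y P : ℕ} {η ρ X₀ : ℝ} (hP : 1 ≤ P) (hη0 : 0 < η) (hη1 : η ≤ 1)
    (hηP : 1 ≤ η * P ^ 2) (hρ0 : 0 ≤ ρ)
    (hρ : ∀ X, X₀ ≤ X → ∀ S : Finset ℕ,
      (∀ p ∈ S, p.Prime ∧ X ≤ (p : ℝ) ∧ (p : ℝ) ≤ Real.exp η * X) → (S.card : ℝ) ≤ ρ * (η * X))
    {D F : Finset ℕ} (hD : ∀ d ∈ D, 0 < d)
    (hF : ∀ n ∈ F, n < 2 * y ∧ ∃ d ∈ D, ∃ p e q, HasShape P η X₀ d p e q n)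
    (hclose : ∀ m ∈ F, ∀ n ∈ F, |Real.log m - Real.log n| ≤ η ∧
      |Real.log (Nat.totient m) - Real.log (Nat.totient n)| ≤ η) :
    (F.card : ℝ) ≤ 68 * ρ * η ^ 2 * P * y * ∑ d ∈ D, (1 : ℝ) / d := by
  classical
  rcases F.eq_empty_or_nonempty with rfl | hne
  · simp only [Finset.card_empty, Nat.cast_zero]; positivity
  set n₀ := F.min' hne with hn₀
  have hn₀F : n₀ ∈ F := F.min'_mem hne
  have hn₀y : (n₀ : ℝ) ≤ 2 * y := by exact_mod_cast (hF n₀ hn₀F).1.le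
  have hpos : ∀ n ∈ F, 0 < n := fun n hn => by
    obtain ⟨-, d, hd, p, e, q, hp, hq, -, -, -, -, -, -, rfl⟩ := hF n hn
    have := hD d hd; have := hp.pos; have := hq.pos
    positivity
  have hn₀pos : (0 : ℝ) < n₀ := by exact_mod_cast hpos n₀ hn₀F
  have hup : ∀ n ∈ F, (n : ℝ) ≤ Real.exp η * n₀ := fun n hn => by
    have h1 := (abs_le.1 (hclose n hn n₀ hn₀F).1).2
    have hnp : (0 : ℝ) < n := by exact_mod_cast hpos n hn
    rw [← Real.exp_log hnp, ← Real.exp_log hn₀pos, ← Real.exp_add, Real.exp_le_exp]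
    linarith
  have hexp : Real.exp η ≤ 3 := by
    have := exp_le_one_add_two_mul hη0.le hη1
    linarith
  set W : ℕ → Finset ℕ := fun d => (Finset.Icc (P + 1) (2 * P)).filter
    fun p => ∃ n ∈ F, ∃ e q, HasShape P η X₀ d p e q n with hW
  set T : ℕ → ℕ → ℕ → Finset ℕ := fun d p e => F.filter fun n => ∃ q, HasShape P η X₀ d p e q n
    with hT
  have hcover : F ⊆ D.biUnion fun d => (W d).biUnion fun p =>
      (Finset.range (2 * y)).biUnion fun e => T d p e := by
    intro n hn
    obtain ⟨hny, d, hd, p, e, q, h⟩ := hF n hn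
    have h' := h
    obtain ⟨hp, hq, hp1, hp2, -, -, -, -, hnq⟩ := h
    refine Finset.mem_biUnion.2 ⟨d, hd, Finset.mem_biUnion.2 ⟨p, Finset.mem_filter.2
      ⟨Finset.mem_Icc.2 ⟨hp1, hp2⟩, n, hn, e, q, h'⟩, Finset.mem_biUnion.2 ⟨e,
      Finset.mem_range.2 ?_, Finset.mem_filter.2 ⟨hn, q, h'⟩⟩⟩⟩
    have h1 : e + 1 < p ^ (e + 1) := Nat.lt_pow_self hp.one_lt
    have h2 : p ^ (e + 1) ≤ n := Nat.le_of_dvd (hpos n hn) (by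
      rw [hnq]; exact (dvd_mul_left _ _).mul_right _)
    omega
  have hTcard : ∀ d ∈ D, ∀ p ∈ W d, ∀ e, ((T d p e).card : ℝ) ≤
      2 * ρ * η * y * (1 / d) / P * (1 / 2) ^ e := by
    intro d hd p hp e
    have hp1 : P < p := (Finset.mem_Icc.1 (Finset.mem_filter.1 hp).1).1
    have hd0 : (0 : ℝ) < d := by exact_mod_cast hD d hd
    have hP0 : (0 : ℝ) < P := by exact_mod_cast hP
    have hp0 : (0 : ℝ) < p := by exact_mod_cast (by omega : 0 < p)
    rcases (T d p e).eq_empty_or_nonempty with h0 | ⟨n₁, hn₁⟩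
    · rw [h0]; simp only [Finset.card_empty, Nat.cast_zero]; positivity
    set M : ℝ := d * (p : ℝ) ^ (e + 1) with hM
    have hM0 : 0 < M := by positivity
    have hX : X₀ ≤ n₀ / M := by
      obtain ⟨hn₁F, q, hp, hq, -, -, -, -, -, hX₀, hnq⟩ := Finset.mem_filter.1 hn₁
      have h1 := hup n₁ hn₁F
      have h2 : (n₁ : ℝ) = M * q := by rw [hnq, hM]; push_cast; ring
      rw [le_div_iff₀ hM0]
      nlinarith
    have hinj : Set.InjOn (fun n => n / (d * p ^ (e + 1))) (T d p e : Set ℕ) := by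
      intro a ha b hb hab
      obtain ⟨-, q, -, -, -, -, -, -, -, -, rfl⟩ := Finset.mem_filter.1 (Finset.mem_coe.1 ha)
      obtain ⟨-, q', -, -, -, -, -, -, -, -, rfl⟩ := Finset.mem_filter.1 (Finset.mem_coe.1 hb)
      have h3 : 0 < d * p ^ (e + 1) := by
        have := hD d hd
        have : 0 < p := by omega
        positivity
      simp only [Nat.mul_div_cancel_left _ h3] at hab
      rw [hab]
    have h4 := hρ _ hX ((T d p e).image fun n => n / (d * p ^ (e + 1))) (by
      intro q hq
      obtain ⟨n, hn, rfl⟩ := Finset.mem_image.1 hq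
      obtain ⟨hnF, q, hp', hq', -, -, -, -, -, -, hnq⟩ := Finset.mem_filter.1 hn
      have h3 : 0 < d * p ^ (e + 1) := by
        have := hD d hd
        have : 0 < p := by omega
        positivity
      have h2 : (n : ℝ) = q * M := by rw [hnq, hM]; push_cast; ring
      simp only [hnq, Nat.mul_div_cancel_left _ h3]
      refine ⟨hq', ?_, ?_⟩
      · rw [div_le_iff₀ hM0, ← h2]
        exact_mod_cast F.min'_le n hnF
      · rw [← mul_div_assoc, le_div_iff₀ hM0, ← h2]
        exact hup n hnF)
    rw [Finset.card_image_of_injOn hinj] at h4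
    refine h4.trans ?_
    have h5 : (P : ℝ) * 2 ^ e ≤ (p : ℝ) ^ (e + 1) := by
      rw [pow_succ, mul_comm]
      have : (2 : ℝ) ≤ p := by exact_mod_cast (by omega : 2 ≤ p)
      have : (P : ℝ) ≤ p := by exact_mod_cast hp1.le
      gcongr
    calc ρ * (η * (n₀ / M)) ≤ ρ * (η * ((2 * y) / (d * (P * 2 ^ e)))) := by
          rw [hM]; gcongr
      _ = _ := by rw [one_div_pow]; field_simp
  have hWcard : ∀ d ∈ D, ((W d).card : ℝ) ≤ 17 * (η * P ^ 2) := by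
    intro d hd
    refine (card_le_of_sub_le (L := 4 * (P : ℝ) ^ 2 * (4 * η)) (by positivity) ?_).trans
      (by nlinarith)
    intro p hp p' hp' hpp
    obtain ⟨hpI, n, hn, e, q, h1, h2, h3, h4, h5, h6, h7, h8, h9⟩ := Finset.mem_filter.1 hp
    obtain ⟨hpI', n', hn', e', q', h1', h2', h3', h4', h5', h6', h7', h8', h9'⟩ :=
      Finset.mem_filter.1 hp'
    refine sub_le_of_log_div_sub_le h3 hP hpp h4' ?_
    have r := log_div_totient_eq (e := e) (hD d hd) h1 h2 h5 h6
    have r' := log_div_totient_eq (e := e') (hD d hd) h1' h2' h5' h6'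
    rw [← h9] at r
    rw [← h9'] at r'
    have s := log_div_sub_one_mem h2 h7
    have s' := log_div_sub_one_mem h2' h7'
    obtain ⟨c1, c2⟩ := hclose n hn n' hn'
    rw [abs_le] at c1 c2
    linarith [c1.1, c1.2, c2.1, c2.2, s.1, s.2, s'.1, s'.2]
  have hP0 : (0 : ℝ) < P := by exact_mod_cast hP
  calc (F.card : ℝ) ≤ ∑ d ∈ D, ∑ p ∈ W d, ∑ e ∈ Finset.range (2 * y), ((T d p e).card : ℝ) := by
        have := (Finset.card_le_card hcover).trans (Finset.card_biUnion_le.trans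
          (Finset.sum_le_sum fun d _ => Finset.card_biUnion_le.trans
          (Finset.sum_le_sum fun p _ => Finset.card_biUnion_le)))
        exact_mod_cast this
    _ ≤ ∑ d ∈ D, ∑ p ∈ W d, ∑ e ∈ Finset.range (2 * y),
          2 * ρ * η * y * (1 / d) / P * (1 / 2) ^ e :=
        Finset.sum_le_sum fun d hd => Finset.sum_le_sum fun p hp => Finset.sum_le_sum fun e _ =>
          hTcard d hd p hp e
    _ ≤ ∑ d ∈ D, ∑ _p ∈ W d, 2 * ρ * η * y * (1 / d) / P * 2 := by
        refine Finset.sum_le_sum fun d hd => Finset.sum_le_sum fun p hp => ?_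
        rw [← Finset.mul_sum]
        gcongr
        exact sum_inv_two_pow_le _
    _ ≤ ∑ d ∈ D, 17 * (η * P ^ 2) * (2 * ρ * η * y * (1 / d) / P * 2) := by
        refine Finset.sum_le_sum fun d hd => ?_
        rw [Finset.sum_const, nsmul_eq_mul]
        have := hWcard d hd
        gcongr
    _ = _ := by
        rw [Finset.mul_sum]
        refine Finset.sum_congr rfl fun d _ => ?_
        field_simp
        ring

lemma sum_inv_of_hasShape_le {y P : ℕ} {K η ρ X₀ : ℝ} (hy : 0 < y) (hP : 1 ≤ P) (hK : 1 ≤ K)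
    (hη0 : 0 < η) (hη1 : η ≤ 1) (hηP : 1 ≤ η * P ^ 2) (hρ0 : 0 ≤ ρ)
    (hρ : ∀ X, X₀ ≤ X → ∀ S : Finset ℕ,
      (∀ p ∈ S, p.Prime ∧ X ≤ (p : ℝ) ∧ (p : ℝ) ≤ Real.exp η * X) → (S.card : ℝ) ≤ ρ * (η * X))
    {D A : Finset ℕ} (hD : ∀ d ∈ D, 0 < d)
    (hA : ∀ n ∈ A, y ≤ n ∧ n < 2 * y ∧ (n : ℝ) ≤ K * Nat.totient n)
    (hmono : ∀ m ∈ A, ∀ n ∈ A, m ≤ n → Nat.totient m ≤ Nat.totient n)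
    (hshape : ∀ n ∈ A, ∃ d ∈ D, ∃ p e q, HasShape P η X₀ d p e q n) :
    ∑ n ∈ A, (1 : ℝ) / n ≤ 68 * (Real.log K + 5) * ρ * (η * P) * ∑ d ∈ D, (1 : ℝ) / d := by
  have hlogK := Real.log_nonneg hK
  set B : ℝ := 68 * ρ * η ^ 2 * P * y * ∑ d ∈ D, (1 : ℝ) / d with hB
  have hB0 : 0 ≤ B := by positivity
  have h1 := card_le_of_fibers (N := ⌊B⌋₊) hy hη0 hη1 hK hA hmono fun F hFA hF =>
    Nat.le_floor (card_fiber_le hP hη0 hη1 hηP hρ0 hρ hD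
      (fun n hn => ⟨(hA n (hFA hn)).2.1, hshape n (hFA hn)⟩) hF)
  have hy' : (0 : ℝ) < y := by exact_mod_cast hy
  refine (sum_inv_le_card_div hy fun n hn => (hA n hn).1).trans ?_
  rw [div_le_iff₀ hy']
  calc (A.card : ℝ) ≤ ⌊B⌋₊ * ((Real.log K + 5) / η) := h1
    _ ≤ B * ((Real.log K + 5) / η) := by
        gcongr
        exact Nat.floor_le hB0
    _ = _ := by rw [hB]; field_simp

open Filter

lemma eventually_const_mul_log_pow_le (K : ℝ) (k : ℕ) :
    ∀ᶠ j : ℕ in atTop, K * Real.log j ^ k ≤ j := by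
  have h := (Real.isLittleO_pow_log_id_atTop (n := k)).comp_tendsto tendsto_natCast_atTop_atTop
  have h1 := h.bound (c := 1 / (|K| + 1)) (by positivity)
  filter_upwards [h1, eventually_ge_atTop 1] with j hj hj1
  simp only [Function.comp, id, Real.norm_eq_abs, Nat.abs_cast] at hj
  have hK : 0 < |K| + 1 := by positivity
  rw [one_div, inv_mul_eq_div, le_div_iff₀ hK] at hj
  have h2 : K * Real.log j ^ k ≤ |K * Real.log j ^ k| := le_abs_self _
  rw [abs_mul] at h2
  nlinarith [abs_nonneg (Real.log j ^ k)]

lemma eventually_le_log (K : ℝ) : ∀ᶠ j : ℕ in atTop, K ≤ Real.log j :=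
  (Real.tendsto_log_atTop.comp tendsto_natCast_atTop_atTop).eventually_ge_atTop K

/-- `n` lies in `[2 ^ j, 2 ^ (j + 1))`, is not divisible by a large square, and has few divisors. -/
def Tame (j n : ℕ) : Prop :=
  2 ^ j ≤ n ∧ n < 2 * 2 ^ j ∧ (∀ b, j ^ 2 < b → ¬ b ^ 2 ∣ n) ∧ n.divisors.card ≤ j ^ 3

lemma Tame.pos {j n : ℕ} (h : Tame j n) : 0 < n := (Nat.two_pow_pos j).trans_le h.1

lemma Tame.card_primeFactors_le {j n : ℕ} (h : Tame j n) :
    (n.primeFactors.card : ℝ) ≤ 5 * Real.log j := by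
  have h1 := (two_pow_card_primeFactors_le h.pos.ne').trans h.2.2.2
  have h2 : (2 : ℝ) ^ n.primeFactors.card ≤ (j : ℝ) ^ 3 := by exact_mod_cast h1
  have h3 := Real.log_le_log (by positivity) h2
  rw [Real.log_pow, Real.log_pow] at h3
  push_cast at h3
  have h4 : (0 : ℝ) ≤ n.primeFactors.card := Nat.cast_nonneg _
  nlinarith [Real.log_two_gt_d9, Real.log_natCast_nonneg j]

lemma Tame.le_mul_totient {j n : ℕ} (h : Tame j n) : (n : ℝ) ≤ (j : ℝ) ^ 3 * Nat.totient n := by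
  have h1 := (two_pow_card_primeFactors_le h.pos.ne').trans h.2.2.2
  have h2 := (le_two_pow_card_primeFactors_mul_totient n).trans (Nat.mul_le_mul_right _ h1)
  exact_mod_cast h2

lemma Tame.log_le_of_dvd {j n e z : ℕ} (h : Tame j n) (hz : 1 ≤ z) (hj : 1 ≤ j) (he : e ∣ n)
    (hp : ∀ p, p.Prime → p ∣ e → p ≤ z) :
    Real.log e ≤ 5 * Real.log j * Real.log z + 4 * Real.log j := by
  have h1 := le_pow_mul_sq_of_dvd h.pos.ne' he h.2.2.1 hz hp
  have he0 : 0 < e := Nat.pos_of_dvd_of_pos he h.pos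
  have hz0 : (0 : ℝ) < z := by exact_mod_cast hz
  have hj0 : (0 : ℝ) < j := by exact_mod_cast hj
  have h2 : (e : ℝ) ≤ (z : ℝ) ^ n.primeFactors.card * (j : ℝ) ^ 4 := by
    have : (e : ℝ) ≤ (z : ℝ) ^ n.primeFactors.card * ((j : ℝ) ^ 2) ^ 2 := by exact_mod_cast h1
    rwa [← pow_mul] at this
  have h3 := Real.log_le_log (by exact_mod_cast he0) h2
  rw [Real.log_mul (by positivity) (by positivity), Real.log_pow, Real.log_pow] at h3
  push_cast at h3
  refine h3.trans ?_
  have := h.card_primeFactors_le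
  have := Real.log_natCast_nonneg z
  gcongr

lemma Tame.log_le_of_smooth_dvd {j n e : ℕ} (h : Tame j n) (hj : 1 ≤ Real.log j) (he : e ∣ n)
    (hp : ∀ p, p.Prime → p ∣ e → p ≤ j ^ 5) : Real.log e ≤ 29 * Real.log j ^ 2 := by
  have hj1 : 1 ≤ j := Nat.one_le_iff_ne_zero.2 (by rintro rfl; simp at hj; linarith)
  have := h.log_le_of_dvd (Nat.one_le_pow _ _ hj1) hj1 he hp
  push_cast [Real.log_pow] at this
  nlinarith

lemma eventually_tame_maxPrimeFac : ∀ᶠ j : ℕ in atTop, ∀ n, Tame j n →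
    (maxPrimeFac n).Prime ∧ maxPrimeFac n ∣ n ∧ (j : ℝ) / (10 * Real.log j) ≤
      Real.log (maxPrimeFac n) ∧ j ^ 8 < maxPrimeFac n := by
  filter_upwards [eventually_ge_atTop 3, eventually_le_log 1, eventually_const_mul_log_pow_le 100 1,
    eventually_const_mul_log_pow_le 90 2] with j hj hl h1 h2 n hn
  have hn2 : 2 ≤ n := le_trans (by
    calc 2 = 2 ^ 1 := rfl
      _ ≤ 2 ^ j := Nat.pow_le_pow_right two_pos (by omega)) hn.1
  have hm := maxPrimeFac_mem hn2
  have hp := Nat.prime_of_mem_primeFactors hm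
  have hlog : (j : ℝ) / (10 * Real.log j) ≤ Real.log (maxPrimeFac n) := by
    have h3 := hn.log_le_of_dvd hp.one_lt.le (by omega) dvd_rfl fun p hp hpn =>
      prime_le_maxPrimeFac (by omega) hp hpn
    have h4 : (j : ℝ) * Real.log 2 ≤ Real.log n := by
      rw [← Real.log_pow]
      refine Real.log_le_log (by positivity) ?_
      exact_mod_cast hn.1
    have h5 := Real.log_two_gt_d9
    rw [div_le_iff₀ (by linarith)]
    have h6 : (0 : ℝ) ≤ j := Nat.cast_nonneg j
    nlinarith
  refine ⟨hp, Nat.dvd_of_mem_primeFactors hm, hlog, ?_⟩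
  have h3 : 9 * Real.log j ≤ Real.log (maxPrimeFac n) := by
    refine le_trans ?_ hlog
    rw [le_div_iff₀ (by linarith)]
    linarith
  have hj0 : (0 : ℝ) < j := by exact_mod_cast (by omega : 0 < j)
  have h4 : ((j ^ 8 : ℕ) : ℝ) < maxPrimeFac n := by
    rw [← Real.log_lt_log_iff (by positivity) (by exact_mod_cast hp.pos)]
    push_cast [Real.log_pow]
    linarith
  exact_mod_cast h4

lemma sum_le_sum_range_filter {A : Finset ℕ} {k : ℕ} (Q : ℕ → ℕ → Prop)
    [∀ i, DecidablePred (Q i)] (h : ∀ n ∈ A, ∃ i < k, Q i n) :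
    ∑ n ∈ A, (1 : ℝ) / n ≤ ∑ i ∈ Finset.range k, ∑ n ∈ A.filter (Q i), (1 : ℝ) / n := by
  rw [Finset.sum_comm' (t' := A) (s' := fun n => (Finset.range k).filter fun i => Q i n)
    (by intro i n; simp only [Finset.mem_filter, Finset.mem_range]; tauto)]
  refine Finset.sum_le_sum fun n hn => ?_
  obtain ⟨i, hi, hQ⟩ := h n hn
  exact Finset.single_le_sum (f := fun _ => (1 : ℝ) / n) (fun _ _ => by positivity)
    (Finset.mem_filter.2 ⟨Finset.mem_range.2 hi, hQ⟩)

lemma exists_dyadic {Z p k : ℕ} (h1 : Z < p) (h2 : p ≤ Z * 2 ^ k) :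
    ∃ i < k, Z * 2 ^ i < p ∧ p ≤ 2 * (Z * 2 ^ i) := by
  induction k with
  | zero => simp at h2; omega
  | succ k ih =>
    by_cases h : p ≤ Z * 2 ^ k
    · obtain ⟨i, hi, h⟩ := ih h
      exact ⟨i, by omega, h⟩
    · exact ⟨k, by omega, by omega, by rw [pow_succ] at h2; linarith⟩

lemma exists_eq_mul_pow_mul {n p q : ℕ} (hn : n ≠ 0) (hp : p.Prime) (hq : q.Prime) (hpq : p ≠ q)
    (hpn : p ∣ n) (hqn : q ∣ n) (hq2 : ¬ q ^ 2 ∣ n) :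
    ∃ d e, n = d * p ^ (e + 1) * q ∧ ¬ p ∣ d ∧ ¬ q ∣ d * p ∧ 0 < d := by
  obtain ⟨m, rfl⟩ := hqn
  have hm0 : m ≠ 0 := by rintro rfl; simp at hn
  have hqm : ¬ q ∣ m := fun ⟨c, hc⟩ => hq2 ⟨c, by rw [hc]; ring⟩
  have hpm : p ∣ m := (hp.dvd_mul.1 hpn).resolve_left fun h =>
    hpq ((Nat.prime_dvd_prime_iff_eq hp hq).1 h)
  obtain ⟨e, d, hpd, rfl⟩ := Nat.exists_eq_pow_mul_and_not_dvd hm0 p hp.ne_one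
  have he : e ≠ 0 := by rintro rfl; simp at hpm; exact hpd hpm
  obtain ⟨e, rfl⟩ := Nat.exists_eq_succ_of_ne_zero he
  refine ⟨d, e, by rw [Nat.succ_eq_add_one]; ring, hpd, fun h => hqm ?_, Nat.pos_of_ne_zero (by rintro rfl; simp at hpd)⟩
  rcases hq.dvd_mul.1 h with h | h
  · exact h.mul_left _
  · exact absurd ((Nat.prime_dvd_prime_iff_eq hq hp).1 h).symm hpq

lemma sum_inv_of_grid_le {y Z k : ℕ} {K ρ S : ℝ} {X₀ : ℕ → ℝ} (hy : 0 < y) (hZ : 1 ≤ Z)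
    (hK : 1 ≤ K) (hρ0 : 0 ≤ ρ)
    (hρ : ∀ i < k, ∀ X, X₀ i ≤ X → ∀ S : Finset ℕ,
      (∀ p ∈ S, p.Prime ∧ X ≤ (p : ℝ) ∧ (p : ℝ) ≤ Real.exp (1 / (Z * (Z * 2 ^ i))) * X) →
        (S.card : ℝ) ≤ ρ * (1 / (Z * (Z * 2 ^ i)) * X))
    {D A : Finset ℕ} (hD : ∀ d ∈ D, 0 < d) (hS : ∑ d ∈ D, (1 : ℝ) / d ≤ S)
    (hA : ∀ n ∈ A, y ≤ n ∧ n < 2 * y ∧ (n : ℝ) ≤ K * Nat.totient n)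
    (hmono : ∀ m ∈ A, ∀ n ∈ A, m ≤ n → Nat.totient m ≤ Nat.totient n)
    (hshape : ∀ n ∈ A, ∃ i < k, ∃ d ∈ D, ∃ p e q,
      HasShape (Z * 2 ^ i) (1 / (Z * (Z * 2 ^ i))) (X₀ i) d p e q n) :
    ∑ n ∈ A, (1 : ℝ) / n ≤ k * (68 * (Real.log K + 5) * ρ * (1 / Z) * S) := by
  classical
  refine (sum_le_sum_range_filter (fun i n => ∃ d ∈ D, ∃ p e q,
      HasShape (Z * 2 ^ i) (1 / (Z * (Z * 2 ^ i))) (X₀ i) d p e q n) hshape).trans ?_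
  have hZ0 : (1 : ℝ) ≤ Z := by exact_mod_cast hZ
  have hlogK := Real.log_nonneg hK
  rw [← nsmul_eq_mul, ← Finset.card_range k, ← Finset.sum_const, Finset.card_range]
  refine Finset.sum_le_sum fun i hi => ?_
  have h2i : (1 : ℝ) ≤ 2 ^ i := one_le_pow₀ (by norm_num)
  have hP : (1 : ℝ) ≤ Z * 2 ^ i := one_le_mul_of_one_le_of_one_le hZ0 h2i
  have hcast : ((Z * 2 ^ i : ℕ) : ℝ) = Z * 2 ^ i := by push_cast; ring
  have h := sum_inv_of_hasShape_le (P := Z * 2 ^ i) (η := 1 / (Z * (Z * 2 ^ i))) (K := K)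
    (X₀ := X₀ i) (ρ := ρ) (D := D)
    (A := A.filter fun n => ∃ d ∈ D, ∃ p e q,
      HasShape (Z * 2 ^ i) (1 / (Z * (Z * 2 ^ i))) (X₀ i) d p e q n)
    hy (Nat.mul_pos hZ (by positivity)) hK
    (by positivity) (by
      rw [div_le_one (by positivity)]
      exact one_le_mul_of_one_le_of_one_le hZ0 hP) (by
      rw [hcast, one_div_mul_eq_div, one_le_div (by positivity)]
      nlinarith) hρ0 (hρ i (Finset.mem_range.1 hi)) hD
    (fun n hn => hA n (Finset.mem_filter.1 hn).1)
    (fun m hm n hn => hmono m (Finset.mem_filter.1 hm).1 n (Finset.mem_filter.1 hn).1)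
    (fun n hn => (Finset.mem_filter.1 hn).2)
  refine h.trans ?_
  rw [hcast, show (1 : ℝ) / (Z * (Z * 2 ^ i)) * (Z * 2 ^ i) = 1 / Z by field_simp]
  gcongr

lemma maxPrimeFac_sq_not_dvd {j n : ℕ} (h : Tame j n) (hj : 1 ≤ j) (hq : j ^ 8 < maxPrimeFac n) :
    ¬ maxPrimeFac n ^ 2 ∣ n :=
  h.2.2.1 _ ((Nat.pow_le_pow_right hj (by norm_num)).trans_lt hq)

lemma eventually_sum_inv_of_medium_prime_le : ∀ᶠ j : ℕ in atTop, ∀ A : Finset ℕ,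
    (∀ m ∈ A, ∀ n ∈ A, m ≤ n → Nat.totient m ≤ Nat.totient n) →
    (∀ n ∈ A, Tame j n ∧ ∃ p, p.Prime ∧ p ∣ n ∧ j ^ 5 < p ∧ p * j ^ 6 ≤ maxPrimeFac n) →
    ∑ n ∈ A, (1 : ℝ) / n ≤ 1 / (j * Real.log j ^ 2) := by
  filter_upwards [eventually_ge_atTop 3, eventually_le_log 1, eventually_tame_maxPrimeFac,
    eventually_const_mul_log_pow_le 6528 3] with j hj hl hmax h1 A hmono hA
  have hj3 : (3 : ℝ) ≤ j := by exact_mod_cast hj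
  have hS : ∑ d ∈ Finset.Icc (1 : ℕ) (2 * 2 ^ j), (1 : ℝ) / d ≤ 2 * j := by
    refine sum_inv_Icc_le_one_add_log.trans ?_
    push_cast
    rw [← pow_succ', Real.log_pow]
    push_cast
    nlinarith [Real.log_two_lt_d9]
  have hmain := sum_inv_of_grid_le (y := 2 ^ j) (Z := j ^ 5) (k := j + 2) (K := (j : ℝ) ^ 3) (ρ := 3)
    (S := 2 * j) (X₀ := fun i => (j ^ 5 : ℕ) * ((j ^ 5 : ℕ) * 2 ^ i)) (A := A) (by positivity)
    (Nat.one_le_pow _ _ (by omega)) (one_le_pow₀ (by linarith)) (by norm_num)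
    (by
      intro i _ X hX S hS'
      have hη : (0 : ℝ) < (j ^ 5 : ℕ) * ((j ^ 5 : ℕ) * 2 ^ i) := by positivity
      refine card_Icc_mul_exp_le (by positivity) ?_ ?_ fun p hp => (hS' p hp).2
      · rw [div_le_one hη]
        have : (1 : ℝ) ≤ (j ^ 5 : ℕ) := by exact_mod_cast Nat.one_le_pow _ _ (by omega)
        have h2 : (1 : ℝ) ≤ 2 ^ i := one_le_pow₀ (by norm_num)
        exact one_le_mul_of_one_le_of_one_le this (one_le_mul_of_one_le_of_one_le this h2)
      · rw [one_div_mul_eq_div, le_div_iff₀ hη, one_mul]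
        exact hX)
    (fun d hd => (Finset.mem_Icc.1 hd).1) hS
    (fun n hn => ⟨(hA n hn).1.1, (hA n hn).1.2.1, (hA n hn).1.le_mul_totient⟩) hmono
    (by
      intro n hn
      obtain ⟨ht, p, hp, hpn, hp5, hp6⟩ := hA n hn
      obtain ⟨hq, hqn, -, hq8⟩ := hmax n ht
      have hpq : p ≠ maxPrimeFac n := by
        intro h
        rw [← h] at hp6
        have : 1 < j ^ 6 := Nat.one_lt_pow (by norm_num) (by omega)
        nlinarith [hp.pos]
      obtain ⟨d, e, hn', hpd, hqd, hd⟩ := exists_eq_mul_pow_mul ht.pos.ne' hp hq hpq hpn hqn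
        (maxPrimeFac_sq_not_dvd ht (by omega) hq8)
      have hdn : d ≤ n := Nat.le_of_dvd ht.pos ⟨p ^ (e + 1) * maxPrimeFac n, by
        rw [← mul_assoc]; exact hn'⟩
      have hpn' : p ≤ n := Nat.le_of_dvd ht.pos hpn
      have hny := ht.2.1
      obtain ⟨i, hi, hi1, hi2⟩ := exists_dyadic (k := j + 2) hp5 (by
        have : 1 ≤ j ^ 5 := Nat.one_le_pow _ _ (by omega)
        calc p ≤ 1 * 2 ^ (j + 2) := by rw [pow_add]; omega
          _ ≤ _ := by gcongr)
      have hle : (3 : ℝ) * ((j ^ 5 : ℕ) * ((j ^ 5 : ℕ) * 2 ^ i)) ≤ maxPrimeFac n := by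
        have : 3 * (j ^ 5 * (j ^ 5 * 2 ^ i)) ≤ maxPrimeFac n := by
          calc 3 * (j ^ 5 * (j ^ 5 * 2 ^ i)) ≤ j * (j ^ 5 * p) := by gcongr
            _ = p * j ^ 6 := by ring
            _ ≤ _ := hp6
        exact_mod_cast this
      have hη : (0 : ℝ) < (j ^ 5 : ℕ) * ((j ^ 5 : ℕ) * 2 ^ i) := by positivity
      refine ⟨i, hi, d, Finset.mem_Icc.2 ⟨hd, by omega⟩, p, e, _, hp, hq, hi1, hi2, hpd, hqd, ?_,
        hle, hn'⟩
      rw [one_div_mul_eq_div, le_div_iff₀ hη, one_mul]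
      linarith)
  refine hmain.trans ?_
  have hl0 : 0 < Real.log j := by linarith
  rw [Real.log_pow, le_div_iff₀ (by positivity)]
  push_cast
  rw [show ((j : ℝ) + 2) * (68 * (3 * Real.log j + 5) * 3 * (1 / (j : ℝ) ^ 5) * (2 * j)) *
    (j * Real.log j ^ 2) = (j + 2) * ((3 * Real.log j + 5) * 408) * Real.log j ^ 2 / (j : ℝ) ^ 3
    by field_simp; ring]
  rw [div_le_one (by positivity)]
  calc ((j : ℝ) + 2) * ((3 * Real.log j + 5) * 408) * Real.log j ^ 2 ≤
      (2 * j) * ((8 * Real.log j) * 408) * Real.log j ^ 2 := by gcongr <;> linarith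
    _ = j * (6528 * Real.log j ^ 3) := by ring
    _ ≤ j * j := by gcongr
    _ ≤ _ := by nlinarith

lemma sum_inv_Icc_floor_exp_le {x : ℝ} (hx : 0 ≤ x) :
    ∑ d ∈ Finset.Icc 1 ⌊Real.exp x⌋₊, (1 : ℝ) / d ≤ 1 + x := by
  refine sum_inv_Icc_le_one_add_log.trans ?_
  have h1 : 1 ≤ ⌊Real.exp x⌋₊ := Nat.le_floor (by simpa using Real.one_le_exp hx)
  have h2 := Real.log_le_log (by exact_mod_cast h1) (Nat.floor_le (Real.exp_pos x).le)
  rw [Real.log_exp] at h2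
  linarith

lemma eventually_log_maxPrimeFac_ge : ∀ᶠ j : ℕ in atTop, ∀ n, Tame j n →
    (∀ p, p.Prime → p ∣ n → p ≠ maxPrimeFac n → p ≤ j ^ 5) →
    (j : ℝ) / 2 ≤ Real.log (maxPrimeFac n) ∧
      Real.log ((n / maxPrimeFac n : ℕ) : ℝ) ≤ 29 * Real.log j ^ 2 := by
  filter_upwards [eventually_ge_atTop 3, eventually_le_log 1, eventually_tame_maxPrimeFac,
    eventually_const_mul_log_pow_le 200 2] with j hj hl hmax h1 n hn hsm
  obtain ⟨hq, hqn, -, hq8⟩ := hmax n hn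
  have hq2 := maxPrimeFac_sq_not_dvd hn (by omega) hq8
  obtain ⟨m, hm⟩ := id hqn
  have hm0 : 0 < m := Nat.pos_of_ne_zero (by
    rintro rfl; rw [mul_zero] at hm; exact hn.pos.ne' hm)
  have hdiv : n / maxPrimeFac n = m := by
    conv_lhs => rw [hm]
    rw [← hm]
    exact Nat.div_eq_of_eq_mul_right hq.pos hm
  rw [hdiv]
  have h2 : Real.log m ≤ 29 * Real.log j ^ 2 := by
    refine hn.log_le_of_smooth_dvd hl ⟨maxPrimeFac n, by rw [mul_comm]; exact hm⟩
      fun p hp hpm => hsm p hp (hpm.trans ⟨maxPrimeFac n, by rw [mul_comm]; exact hm⟩) ?_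
    rintro rfl
    obtain ⟨c, hc⟩ := hpm
    exact hq2 ⟨c, by rw [sq, mul_assoc, ← hc]; exact hm⟩
  refine ⟨?_, h2⟩
  have h3 : Real.log n = Real.log (maxPrimeFac n) + Real.log m := by
    conv_lhs => rw [hm]
    push_cast
    exact Real.log_mul (by exact_mod_cast hq.ne_zero) (by exact_mod_cast hm0.ne')
  have h4 : (j : ℝ) * Real.log 2 ≤ Real.log n := by
    rw [← Real.log_pow]
    refine Real.log_le_log (by positivity) ?_
    exact_mod_cast hn.1
  have h5 : (0 : ℝ) ≤ j := Nat.cast_nonneg j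
  nlinarith [Real.log_two_gt_d9]

lemma eventually_sum_inv_of_small_prime_le : ∀ᶠ j : ℕ in atTop, ∀ A : Finset ℕ,
    (∀ m ∈ A, ∀ n ∈ A, m ≤ n → Nat.totient m ≤ Nat.totient n) →
    (∀ n ∈ A, Tame j n ∧ (∀ p, p.Prime → p ∣ n → p ≠ maxPrimeFac n → p ≤ j ^ 5) ∧
      ∃ p, p.Prime ∧ p ∣ n ∧ p ≠ maxPrimeFac n ∧ ⌈Real.log j ^ 8⌉₊ < p) →
    ∑ n ∈ A, (1 : ℝ) / n ≤ 1 / (j * Real.log j ^ 2) := by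
  filter_upwards [eventually_ge_atTop 20, eventually_le_log 8, eventually_tame_maxPrimeFac,
    eventually_log_maxPrimeFac_ge, eventually_const_mul_log_pow_le 100 1,
    eventually_const_mul_log_pow_le 2 8, eventually_le_log (9 * 68 * 8 * 352 * 30)]
    with j hj hl hmax hmax2 h1 h8 hbig A hmono hA
  have hj3 : (20 : ℝ) ≤ j := by exact_mod_cast hj
  set l := Real.log j with hldef
  have hl0 : 0 < l := by linarith
  set Z := ⌈l ^ 8⌉₊ with hZ
  have hZ1 : l ^ 8 ≤ Z := Nat.le_ceil _
  have hZ8 : (8 : ℝ) ≤ Z := by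
    refine le_trans ?_ hZ1
    calc (8 : ℝ) ≤ l := hl
      _ ≤ l ^ 8 := le_self_pow₀ (by linarith) (by norm_num)
  have hZj : (Z : ℝ) ≤ j := by
    have := Nat.ceil_lt_add_one (show 0 ≤ l ^ 8 by positivity)
    rw [← hZ] at this
    have h9 : (1 : ℝ) ≤ l ^ 8 := one_le_pow₀ (by linarith)
    linarith
  set k := ⌈8 * l⌉₊ with hk
  have hk1 : 8 * l ≤ k := Nat.le_ceil _
  have hk2 : (k : ℝ) ≤ 9 * l := by
    have := Nat.ceil_lt_add_one (show 0 ≤ 8 * l by positivity)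
    rw [← hk] at this
    linarith
  have h2k : (2 : ℝ) ^ k ≤ (j : ℝ) ^ 7 := by
    rw [← Real.log_le_log_iff (by positivity) (by positivity), Real.log_pow, Real.log_pow]
    push_cast
    nlinarith [Real.log_two_lt_d9, hldef]
  have h2k' : j ^ 5 ≤ 2 ^ k := by
    have : ((j ^ 5 : ℕ) : ℝ) ≤ ((2 ^ k : ℕ) : ℝ) := by
      push_cast
      rw [← Real.log_le_log_iff (by positivity) (by positivity), Real.log_pow, Real.log_pow]
      push_cast
      nlinarith [Real.log_two_gt_d9, hldef]
    exact_mod_cast this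
  have hη9 : ∀ i < k, (Z : ℝ) * (Z * 2 ^ i) ≤ (j : ℝ) ^ 9 := by
    intro i hi
    calc (Z : ℝ) * (Z * 2 ^ i) ≤ j * (j * 2 ^ k) := by gcongr; norm_num
      _ ≤ j * (j * (j : ℝ) ^ 7) := by gcongr
      _ = _ := by ring
  have hexpj : (j : ℝ) ^ 10 ≤ Real.exp (j / 4) := by
    rw [← Real.log_le_iff_le_exp (by positivity), Real.log_pow]
    push_cast
    rw [← hldef]
    linarith
  have hmain := sum_inv_of_grid_le (y := 2 ^ j) (Z := Z) (k := k) (K := (j : ℝ) ^ 3)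
    (ρ := 352 * l / j)
    (S := 1 + 29 * l ^ 2) (X₀ := fun i => Real.exp (j / 4)) (A := A)
    (D := Finset.Icc 1 ⌊Real.exp (29 * l ^ 2)⌋₊) (by positivity)
    (by exact_mod_cast (by linarith : (1 : ℝ) ≤ Z)) (one_le_pow₀ (by linarith)) (by positivity)
    (by
      intro i hi X hX S hS'
      have h2i : (1 : ℝ) ≤ 2 ^ i := one_le_pow₀ (by norm_num)
      have hη : (0 : ℝ) < Z * (Z * 2 ^ i) := by positivity
      have hη8 := hη9 i hi
      have hX10 : (j : ℝ) ^ 10 ≤ X := hexpj.trans hX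
      have hX0 : 0 < X := (Real.exp_pos _).trans_le hX
      have hlogX : (j : ℝ) / 4 ≤ Real.log X := by rwa [Real.le_log_iff_exp_le hX0]
      have hj9 : (j : ℝ) ^ 10 = j * (j : ℝ) ^ 9 := by ring
      refine (card_primes_Icc_mul_exp_le (by positivity) ?_ ?_ hS').trans ?_
      · rw [div_le_div_iff₀ hη (by norm_num)]
        have : (8 : ℝ) ≤ Z * 2 ^ i := by nlinarith
        nlinarith
      · rw [one_div_mul_eq_div, le_div_iff₀ hη]
        nlinarith
      · gcongr ?_ * _
        have hlog : Real.log (10 / (1 / (Z * (Z * 2 ^ i)))) ≤ 11 * l := by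
          rw [div_div_eq_mul_div, div_one, hldef,
            show (11 : ℝ) * Real.log j = Real.log ((j : ℝ) ^ 11) by rw [Real.log_pow]; norm_num]
          refine Real.log_le_log (by positivity) ?_
          calc 10 * ((Z : ℝ) * (Z * 2 ^ i)) ≤ (j * j) * (j : ℝ) ^ 9 := by
                gcongr
                nlinarith
            _ = _ := by ring
        rw [div_le_div_iff₀ (by linarith) (by linarith)]
        calc 8 * Real.log (10 / (1 / (Z * (Z * 2 ^ i)))) * j ≤ 8 * (11 * l) * j := by gcongr
          _ = 352 * l * (j / 4) := by ring
          _ ≤ _ := by gcongr)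
    (fun d hd => (Finset.mem_Icc.1 hd).1) (sum_inv_Icc_floor_exp_le (by positivity))
    (fun n hn => ⟨(hA n hn).1.1, (hA n hn).1.2.1, (hA n hn).1.le_mul_totient⟩) hmono
    (by
      intro n hn
      obtain ⟨ht, hsm, p, hp, hpn, hpq, hpZ⟩ := hA n hn
      obtain ⟨hq, hqn, -, hq8⟩ := hmax n ht
      obtain ⟨hq1, hm⟩ := hmax2 n ht hsm
      obtain ⟨d, e, hn', hpd, hqd, hd⟩ := exists_eq_mul_pow_mul ht.pos.ne' hp hq hpq hpn hqn
        (maxPrimeFac_sq_not_dvd ht (by omega) hq8)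
      have hdm : d ≤ n / maxPrimeFac n := by
        rw [Nat.le_div_iff_mul_le hq.pos]
        conv_rhs => rw [hn']
        gcongr
        exact Nat.le_mul_of_pos_right _ (pow_pos hp.pos _)
      have hm0 : 0 < n / maxPrimeFac n := hd.trans_le hdm
      rw [Real.log_le_iff_le_exp (by exact_mod_cast hm0)] at hm
      obtain ⟨i, hi, hi1, hi2⟩ := exists_dyadic (k := k) hpZ (by
        have h9 : 1 ≤ Z := by exact_mod_cast (by linarith : (1 : ℝ) ≤ Z)
        calc p ≤ 1 * j ^ 5 := by rw [one_mul]; exact hsm p hp hpn hpq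
          _ ≤ _ := by gcongr)
      rw [Real.le_log_iff_exp_le (by exact_mod_cast hq.pos)] at hq1
      have hsq : Real.exp (j / 2) = Real.exp (j / 4) * Real.exp (j / 4) := by
        rw [← Real.exp_add]; ring_nf
      have hX1 : (j : ℝ) ≤ Real.exp (j / 4) :=
        (le_self_pow₀ (by linarith) (by norm_num)).trans hexpj
      have hη : (0 : ℝ) < Z * (Z * 2 ^ i) := by
        have : (0 : ℝ) < Z := by linarith
        positivity
      have hη8 := hη9 i hi
      have hj9 : (j : ℝ) ^ 9 ≤ (j : ℝ) ^ 10 := pow_le_pow_right₀ (by linarith) (by norm_num)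
      refine ⟨i, hi, d, Finset.mem_Icc.2 ⟨hd, hdm.trans (Nat.le_floor hm)⟩, p, e, _, hp, hq,
        hi1, hi2, hpd, hqd, ?_, by nlinarith, hn'⟩
      rw [one_div_mul_eq_div, le_div_iff₀ hη, one_mul]
      nlinarith)
  refine hmain.trans ?_
  have hj0 : (0 : ℝ) < j := by linarith
  rw [Real.log_pow, le_div_iff₀ (by positivity)]
  push_cast
  rw [← hldef]
  have hl2 : (8 : ℝ) * l ≤ l ^ 2 := by nlinarith
  calc (k : ℝ) * (68 * (3 * l + 5) * (352 * l / j) * (1 / Z) * (1 + 29 * l ^ 2)) * (j * l ^ 2) ≤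
      (9 * l) * (68 * (8 * l) * (352 * l / j) * (1 / l ^ 8) * (30 * l ^ 2)) * (j * l ^ 2) := by
        gcongr <;> linarith
    _ = (9 * 68 * 8 * 352 * 30) / l := by field_simp
    _ ≤ 1 := by rw [div_le_one hl0]; exact hbig

lemma sum_inv_le_of_windows {C α₀ w : ℝ} {k : ℕ}
    (hC : ∀ α W : ℝ, 1 ≤ α → 0 ≤ W →
      ∀ S : Finset ℕ, (∀ p ∈ S, p.Prime ∧ α ≤ Real.log p ∧ Real.log p ≤ α + W) →
      ∑ p ∈ S, (1 : ℝ) / p ≤ C * (W + 1) / α) (hC0 : 0 ≤ C) (hα₀ : 1 ≤ α₀) (hw : 0 ≤ w)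
    {D A : Finset ℕ} {α : ℕ → ℝ} (hα : ∀ d ∈ D, α₀ ≤ α d)
    (hA : ∀ n ∈ A, ∃ d ∈ D, ∃ f : Fin k → ℕ,
      (∀ i, (f i).Prime ∧ α d ≤ Real.log (f i) ∧ Real.log (f i) ≤ α d + w) ∧
      n = d * ∏ i, f i) :
    ∑ n ∈ A, (1 : ℝ) / n ≤ (∑ d ∈ D, (1 : ℝ) / d) * (C * (w + 1) / α₀) ^ k := by
  classical
  set V : ℕ → Finset ℕ := fun d => (Finset.range (⌊Real.exp (α d + w)⌋₊ + 1)).filter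
    fun p => p.Prime ∧ α d ≤ Real.log p ∧ Real.log p ≤ α d + w with hV
  set T := D.sigma fun d => Fintype.piFinset fun _ : Fin k => V d with hT
  have hsub : A ⊆ T.image fun t => t.1 * ∏ i, t.2 i := by
    intro n hn
    obtain ⟨d, hd, f, hf, rfl⟩ := hA n hn
    refine Finset.mem_image.2 ⟨⟨d, f⟩, Finset.mem_sigma.2 ⟨hd, Fintype.mem_piFinset.2 fun i =>
      Finset.mem_filter.2 ⟨Finset.mem_range.2 (Nat.lt_succ_of_le (Nat.le_floor ?_)), hf i⟩⟩, rfl⟩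
    rw [← Real.log_le_iff_le_exp (by exact_mod_cast (hf i).1.pos)]
    exact (hf i).2.2
  calc ∑ n ∈ A, (1 : ℝ) / n ≤ ∑ n ∈ T.image fun t => t.1 * ∏ i, t.2 i, (1 : ℝ) / n :=
        Finset.sum_le_sum_of_subset_of_nonneg hsub fun _ _ _ => by positivity
    _ ≤ ∑ t ∈ T, (1 : ℝ) / ((t.1 * ∏ i, t.2 i : ℕ) : ℝ) :=
        Finset.sum_image_le_of_nonneg fun _ _ => by positivity
    _ = ∑ d ∈ D, (1 : ℝ) / d * (∑ p ∈ V d, (1 : ℝ) / p) ^ k := by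
        rw [hT, Finset.sum_sigma]
        refine Finset.sum_congr rfl fun d _ => ?_
        rw [show (∑ p ∈ V d, (1 : ℝ) / p) ^ k = ∏ _i : Fin k, ∑ p ∈ V d, (1 : ℝ) / p by simp,
          Finset.prod_univ_sum, Finset.mul_sum]
        refine Finset.sum_congr rfl fun f _ => ?_
        push_cast
        rw [Finset.prod_div_distrib]
        simp [one_div, mul_comm]
    _ ≤ ∑ d ∈ D, (1 : ℝ) / d * (C * (w + 1) / α₀) ^ k := by
        refine Finset.sum_le_sum fun d hd => ?_
        have h1 := hC (α d) w (hα₀.trans (hα d hd)) hw (V d)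
          fun p hp => (Finset.mem_filter.1 hp).2
        have h2 : C * (w + 1) / α d ≤ C * (w + 1) / α₀ := by
          have := hα d hd
          gcongr
        gcongr
        exact h1.trans h2
    _ = _ := by rw [Finset.sum_mul]

lemma Tame.log_mem {j n : ℕ} (h : Tame j n) :
    j * Real.log 2 ≤ Real.log n ∧ Real.log n ≤ j * Real.log 2 + 1 := by
  constructor
  · rw [← Real.log_pow]
    exact Real.log_le_log (by positivity) (by exact_mod_cast h.1)
  · have h1 : (n : ℝ) ≤ 2 * 2 ^ j := by exact_mod_cast h.2.1.le
    have h2 := Real.log_le_log (by exact_mod_cast h.pos) h1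
    rw [Real.log_mul (by norm_num) (by positivity), Real.log_pow] at h2
    linarith [Real.log_two_lt_d9]

lemma exists_eq_mul_of_prime_dvd {n p q : ℕ} (hp : p.Prime) (hq : q.Prime) (hpq : p ≠ q)
    (hpn : p ∣ n) (hqn : q ∣ n) : ∃ e, n = e * p * q := by
  obtain ⟨e, he⟩ := Nat.Coprime.mul_dvd_of_dvd_of_dvd ((Nat.coprime_primes hp hq).2 hpq) hpn hqn
  exact ⟨e, by rw [he]; ring⟩

lemma exists_sum_inv_of_two_large_primes_le : ∃ C : ℝ, 0 < C ∧ ∀ᶠ j : ℕ in atTop, ∀ A : Finset ℕ,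
    (∀ n ∈ A, Tame j n ∧ ∃ p, p.Prime ∧ p ∣ n ∧ p ≠ maxPrimeFac n ∧ j ^ 5 < p ∧
      maxPrimeFac n ≤ p * j ^ 6 ∧
      ∀ r, r.Prime → r ∣ n → r ≠ maxPrimeFac n → r ≠ p → r ≤ j ^ 5) →
    ∑ n ∈ A, (1 : ℝ) / n ≤ C * Real.log j ^ 4 / j ^ 2 := by
  obtain ⟨C, hC0, hC⟩ := exists_sum_inv_primes_le
  refine ⟨30 * (44 * C) ^ 2, by positivity, ?_⟩
  filter_upwards [eventually_ge_atTop 20, eventually_le_log 1, eventually_tame_maxPrimeFac,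
    eventually_const_mul_log_pow_le 1000 2] with j hj hl hmax h1 A hA
  have hj3 : (20 : ℝ) ≤ j := by exact_mod_cast hj
  set l := Real.log j with hldef
  have hl0 : 0 < l := by linarith
  have hmain := sum_inv_le_of_windows (k := 2) (w := 10 * l) (α₀ := j / 4)
    (D := (Finset.Icc 1 ⌊Real.exp (29 * l ^ 2)⌋₊))
    (α := fun e => (j * Real.log 2 - Real.log e) / 2 - 6 * l) (A := A) hC hC0.le
    (by linarith) (by positivity) (by
      intro d hd
      obtain ⟨hd1, hd2⟩ := Finset.mem_Icc.1 hd
      have h2 : Real.log d ≤ 29 * l ^ 2 := by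
        rw [Real.log_le_iff_le_exp (by exact_mod_cast hd1)]
        exact (Nat.cast_le.2 hd2).trans (Nat.floor_le (Real.exp_pos _).le)
      have := Real.log_two_gt_d9
      nlinarith)
    (by
      intro n hn
      obtain ⟨ht, p, hp, hpn, hpq, hp5, hp6, hsm⟩ := hA n hn
      obtain ⟨hq, hqn, -, hq8⟩ := hmax n ht
      obtain ⟨e, he⟩ := exists_eq_mul_of_prime_dvd hp hq hpq hpn hqn
      have hen : e ∣ n := ⟨p * maxPrimeFac n, by rw [← mul_assoc]; exact he⟩
      have he0 : 0 < e := Nat.pos_of_dvd_of_pos hen ht.pos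
      have hpsq : ¬ p ^ 2 ∣ n := ht.2.2.1 p
        ((Nat.pow_le_pow_right (by omega) (by norm_num)).trans_lt hp5)
      have hqsq := maxPrimeFac_sq_not_dvd ht (by omega) hq8
      have hle := ht.log_le_of_smooth_dvd hl hen fun r hr hre => hsm r hr (hre.trans hen) (by
          rintro rfl
          obtain ⟨c, hc⟩ := hre
          exact hqsq ⟨c * p, he.trans (by conv_lhs => rw [hc]
                                          ring)⟩) (by
          rintro rfl
          obtain ⟨c, hc⟩ := hre
          exact hpsq ⟨c * maxPrimeFac n, he.trans (by conv_lhs => rw [hc]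
                                                      ring)⟩)
      have hlogn : Real.log n = Real.log e + Real.log p + Real.log (maxPrimeFac n) := by
        conv_lhs => rw [he]
        push_cast
        rw [Real.log_mul, Real.log_mul] <;>
          first | exact_mod_cast he0.ne' | exact_mod_cast hp.ne_zero | exact_mod_cast hq.ne_zero |
            exact_mod_cast (Nat.mul_pos he0 hp.pos).ne'
      have hqp : Real.log (maxPrimeFac n) ≤ Real.log p + 6 * l := by
        have h2 : (maxPrimeFac n : ℝ) ≤ p * (j : ℝ) ^ 6 := by exact_mod_cast hp6
        have h3 := Real.log_le_log (by exact_mod_cast hq.pos) h2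
        rw [Real.log_mul (by exact_mod_cast hp.ne_zero) (by positivity), Real.log_pow] at h3
        exact_mod_cast h3
      have hpq' : Real.log p ≤ Real.log (maxPrimeFac n) :=
        Real.log_le_log (by exact_mod_cast hp.pos)
          (by exact_mod_cast prime_le_maxPrimeFac ht.pos.ne' hp hpn)
      obtain ⟨hn1, hn2⟩ := ht.log_mem
      refine ⟨e, Finset.mem_Icc.2 ⟨he0, Nat.le_floor ?_⟩, ![p, maxPrimeFac n], ?_, ?_⟩
      · rwa [← Real.log_le_iff_le_exp (by exact_mod_cast he0)]
      · intro i
        fin_cases i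
        · exact ⟨hp, by simp; linarith, by simp; linarith⟩
        · exact ⟨hq, by simp; linarith, by simp; linarith⟩
      · rw [Fin.prod_univ_two]
        simp only [Matrix.cons_val_zero, Matrix.cons_val_one, ← mul_assoc]
        exact he)
  refine hmain.trans ?_
  have hS := sum_inv_Icc_floor_exp_le (x := 29 * l ^ 2) (by positivity)
  calc _ ≤ (30 * l ^ 2) * (C * (10 * l + l) / (j / 4)) ^ 2 := by
        gcongr
        nlinarith
    _ = _ := by field_simp; ring

lemma exists_sum_inv_of_three_large_primes_le :
    ∃ C : ℝ, 0 < C ∧ ∀ᶠ j : ℕ in atTop, ∀ A : Finset ℕ,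
    (∀ n ∈ A, Tame j n ∧ ∃ p r, p.Prime ∧ p ∣ n ∧ p ≠ maxPrimeFac n ∧ r.Prime ∧ r ∣ n ∧
      r ≠ maxPrimeFac n ∧ r ≠ p ∧ maxPrimeFac n ≤ p * j ^ 6 ∧ maxPrimeFac n ≤ r * j ^ 6) →
    ∑ n ∈ A, (1 : ℝ) / n ≤ C * Real.log j ^ 6 / j ^ 2 := by
  obtain ⟨C, hC0, hC⟩ := exists_sum_inv_primes_le
  refine ⟨2 * (240 * C) ^ 3, by positivity, ?_⟩
  filter_upwards [eventually_ge_atTop 20, eventually_le_log 1, eventually_tame_maxPrimeFac,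
    eventually_const_mul_log_pow_le 1000 2, eventually_const_mul_log_pow_le 20 1]
    with j hj hl hmax h1 h1' A hA
  have hj3 : (20 : ℝ) ≤ j := by exact_mod_cast hj
  set l := Real.log j with hldef
  have hl0 : 0 < l := by linarith
  set α : ℕ → ℝ := fun e => (j * Real.log 2 - Real.log e) / 3 - 6 * l with hα
  have hmain := sum_inv_le_of_windows (k := 3) (w := 11 * l) (α₀ := j / (20 * l))
    (D := (Finset.Icc (1 : ℕ) (2 * 2 ^ j)).filter fun e => j / (20 * l) ≤ α e)
    (α := α) (A := A) hC hC0.le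
    (by rw [le_div_iff₀ (by positivity)]; linarith) (by positivity)
    (fun d hd => (Finset.mem_filter.1 hd).2)
    (by
      intro n hn
      obtain ⟨ht, p, r, hp, hpn, hpq, hr, hrn, hrq, hrp, hp6, hr6⟩ := hA n hn
      obtain ⟨hq, hqn, hqbig, -⟩ := hmax n ht
      have hcop : Nat.Coprime (r * p) (maxPrimeFac n) := Nat.Coprime.mul_left
        ((Nat.coprime_primes hr hq).2 hrq) ((Nat.coprime_primes hp hq).2 hpq)
      obtain ⟨e, he⟩ := hcop.mul_dvd_of_dvd_of_dvd
        (((Nat.coprime_primes hr hp).2 hrp).mul_dvd_of_dvd_of_dvd hrn hpn) hqn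
      have hen : e ∣ n := ⟨r * p * maxPrimeFac n, by rw [mul_comm]; exact he⟩
      have he0 : 0 < e := Nat.pos_of_dvd_of_pos hen ht.pos
      have hlogn : Real.log n = Real.log r + Real.log p + Real.log (maxPrimeFac n) +
          Real.log e := by
        conv_lhs => rw [he]
        push_cast
        rw [Real.log_mul, Real.log_mul, Real.log_mul] <;>
          first | exact_mod_cast he0.ne' | exact_mod_cast hp.ne_zero | exact_mod_cast hq.ne_zero |
            exact_mod_cast hr.ne_zero | exact_mod_cast (Nat.mul_pos hr.pos hp.pos).ne' |
            exact_mod_cast (Nat.mul_pos (Nat.mul_pos hr.pos hp.pos) hq.pos).ne'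
      have hlarge : ∀ s : ℕ, s.Prime → maxPrimeFac n ≤ s * j ^ 6 →
          Real.log (maxPrimeFac n) ≤ Real.log s + 6 * l := by
        intro s hs hs6
        have h2 : (maxPrimeFac n : ℝ) ≤ s * (j : ℝ) ^ 6 := by exact_mod_cast hs6
        have h3 := Real.log_le_log (by exact_mod_cast hq.pos) h2
        rw [Real.log_mul (by exact_mod_cast hs.ne_zero) (by positivity), Real.log_pow] at h3
        exact_mod_cast h3
      have hle : ∀ s : ℕ, s.Prime → s ∣ n → Real.log s ≤ Real.log (maxPrimeFac n) :=
        fun s hs hsn => Real.log_le_log (by exact_mod_cast hs.pos)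
          (by exact_mod_cast prime_le_maxPrimeFac ht.pos.ne' hs hsn)
      have hp1 := hlarge p hp hp6
      have hr1 := hlarge r hr hr6
      have hp2 := hle p hp hpn
      have hr2 := hle r hr hrn
      obtain ⟨hn1, hn2⟩ := ht.log_mem
      refine ⟨e, Finset.mem_filter.2 ⟨Finset.mem_Icc.2 ⟨he0, ?_⟩, ?_⟩,
        ![r, p, maxPrimeFac n], ?_, ?_⟩
      · exact (Nat.le_of_dvd ht.pos hen).trans ht.2.1.le
      · have h3 : (j : ℝ) / (20 * l) + 11 * l ≤ j / (10 * l) := by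
          rw [div_add' _ _ _ (by positivity), div_le_div_iff₀ (by positivity) (by positivity)]
          nlinarith
        rw [hα]
        dsimp only
        linarith
      · intro i
        fin_cases i
        · exact ⟨hr, by simp [hα]; linarith, by simp [hα]; linarith⟩
        · exact ⟨hp, by simp [hα]; linarith, by simp [hα]; linarith⟩
        · exact ⟨hq, by simp [hα]; linarith, by simp [hα]; linarith⟩
      · rw [Fin.prod_univ_three]
        exact he.trans (by simp; ring))
  refine hmain.trans ?_
  have hS : ∑ d ∈ (Finset.Icc (1 : ℕ) (2 * 2 ^ j)).filter fun e => j / (20 * l) ≤ α e,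
      (1 : ℝ) / d ≤ 2 * j := by
    refine (Finset.sum_le_sum_of_subset_of_nonneg (Finset.filter_subset _ _)
      fun _ _ _ => by positivity).trans (sum_inv_Icc_le_one_add_log.trans ?_)
    push_cast
    rw [← pow_succ', Real.log_pow]
    push_cast
    nlinarith [Real.log_two_lt_d9]
  calc _ ≤ (2 * j) * (C * (11 * l + l) / (j / (20 * l))) ^ 3 := by
        gcongr
    _ = _ := by field_simp; ring

lemma sum_rpow_neg_le_prod {σ : ℝ} (hσ : 0 < σ) {D s : Finset ℕ}
    (hD : ∀ m ∈ D, m ≠ 0 ∧ m.primeFactors ⊆ s) :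
    ∑ m ∈ D, (m : ℝ) ^ (-σ) ≤ ∏ p ∈ s with p.Prime, (1 - (p : ℝ) ^ (-σ))⁻¹ := by
  let f : ℕ →* ℝ :=
    { toFun := fun n => (n : ℝ) ^ (-σ)
      map_one' := by simp
      map_mul' := fun a b => by
        push_cast
        exact Real.mul_rpow (Nat.cast_nonneg a) (Nat.cast_nonneg b) }
  have h := (EulerProduct.summable_and_hasSum_factoredNumbers_prod_filter_prime_geometric (f := f)
    (by
      intro p hp
      change ‖(p : ℝ) ^ (-σ)‖ < 1
      rw [Real.norm_of_nonneg (by positivity)]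
      exact Real.rpow_lt_one_of_one_lt_of_neg (by exact_mod_cast hp.one_lt) (by linarith)) s).2
  have hinj : ∀ m ∈ D, m ∈ Nat.factoredNumbers s := fun m hm =>
    Nat.mem_factoredNumbers_of_primeFactors_subset (hD m hm).1 (hD m hm).2
  have h1 := sum_le_hasSum (D.attach.map ⟨fun m => (⟨m.1, hinj m.1 m.2⟩ : Nat.factoredNumbers s),
    fun a b hab => Subtype.ext (by simpa using hab)⟩)
    (fun m _ => show 0 ≤ ((m : ℕ) : ℝ) ^ (-σ) by positivity) h
  rw [Finset.sum_map] at h1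
  rw [← Finset.sum_attach]
  exact h1

lemma sum_Icc_rpow_neg_le (N : ℕ) :
    ∑ n ∈ Finset.Icc 1 N, (n : ℝ) ^ (-(9 / 10) : ℝ) ≤ 10 * (N : ℝ) ^ (1 / 10 : ℝ) := by
  induction N with
  | zero => simp
  | succ N ih =>
    rw [Finset.sum_Icc_succ_top (by omega)]
    have hN : (0 : ℝ) < (N + 1 : ℕ) := by positivity
    set x : ℝ := ((N + 1 : ℕ) : ℝ) with hx
    have hNx : (N : ℝ) = x * (1 + -(1 / x)) := by
      rw [hx] at *; push_cast; field_simp; ring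
    have h1x : 1 / x ≤ 1 := by
      rw [div_le_one hN, hx]; push_cast; linarith [(Nat.cast_nonneg N : (0 : ℝ) ≤ N)]
    have h1 := rpow_one_add_le_one_add_mul_self (s := -(1 / x)) (p := 1 / 10) (by linarith)
      (by norm_num) (by norm_num)
    have h2 : (N : ℝ) ^ (1 / 10 : ℝ) ≤ x ^ (1 / 10 : ℝ) * (1 + 1 / 10 * -(1 / x)) := by
      rw [hNx, Real.mul_rpow hN.le (by linarith)]
      gcongr
    have h3 : x ^ (1 / 10 : ℝ) = x ^ (-(9 / 10) : ℝ) * x := by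
      rw [← Real.rpow_add_one hN.ne']; norm_num
    rw [h3] at h2 ⊢
    have h4 : x ^ (-(9 / 10) : ℝ) * x * (1 + 1 / 10 * -(1 / x)) =
        x ^ (-(9 / 10) : ℝ) * x - 1 / 10 * x ^ (-(9 / 10) : ℝ) := by
      field_simp
      ring
    linarith

lemma sum_inv_smooth_le {Z : ℕ} {D : Finset ℕ} {R : ℝ}
    (hD : ∀ m ∈ D, m ≠ 0 ∧ R ≤ Real.log m ∧ ∀ p, p.Prime → p ∣ m → p ≤ Z) :
    ∑ m ∈ D, (1 : ℝ) / m ≤ Real.exp (-R / 10 + 30 * (Z : ℝ) ^ (1 / 10 : ℝ)) := by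
  have h1 := sum_rpow_neg_le_prod (σ := 9 / 10) (by norm_num) (D := D) (s := Finset.Icc 1 Z)
    fun m hm => ⟨(hD m hm).1, fun p hp => Finset.mem_Icc.2
      ⟨(Nat.prime_of_mem_primeFactors hp).pos, (hD m hm).2.2 p (Nat.prime_of_mem_primeFactors hp)
        (Nat.dvd_of_mem_primeFactors hp)⟩⟩
  have h2 : ∏ p ∈ Finset.Icc 1 Z with p.Prime, (1 - (p : ℝ) ^ (-(9 / 10) : ℝ))⁻¹ ≤
      Real.exp (30 * (Z : ℝ) ^ (1 / 10 : ℝ)) := by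
    calc _ ≤ ∏ p ∈ Finset.Icc 1 Z with p.Prime, Real.exp (3 * (p : ℝ) ^ (-(9 / 10) : ℝ)) := by
          refine Finset.prod_le_prod (fun p hp => ?_) fun p hp => ?_
          · have : (p : ℝ) ^ (-(9 / 10) : ℝ) < 1 := Real.rpow_lt_one_of_one_lt_of_neg
              (by exact_mod_cast (Finset.mem_filter.1 hp).2.one_lt) (by norm_num)
            exact inv_nonneg.2 (by linarith)
          · have hp2 : (2 : ℝ) ≤ p := by exact_mod_cast (Finset.mem_filter.1 hp).2.two_le
            set u := (p : ℝ) ^ (-(9 / 10) : ℝ) with hu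
            have hu1 : u ≤ 2 / 3 := by
              rw [hu, Real.rpow_neg (by positivity)]
              refine inv_le_of_inv_le₀ (by norm_num) ?_
              calc ((2 : ℝ) / 3)⁻¹ ≤ 2 ^ (9 / 10 : ℝ) := by
                    have h5 : (((2 : ℝ) / 3)⁻¹ : ℝ) ^ (10 : ℕ) ≤
                        ((2 : ℝ) ^ (9 / 10 : ℝ)) ^ (10 : ℕ) := by
                      rw [← Real.rpow_natCast ((2 : ℝ) ^ (9 / 10 : ℝ)), ← Real.rpow_mul (by norm_num)]
                      norm_num
                    exact le_of_pow_le_pow_left₀ (by norm_num) (by positivity) h5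
                _ ≤ (p : ℝ) ^ (9 / 10 : ℝ) := by gcongr
            have hu0 : 0 ≤ u := by positivity
            rw [inv_le_comm₀ (by linarith) (Real.exp_pos _), ← Real.exp_neg]
            have h6 := Real.add_one_le_exp (3 * u)
            rw [Real.exp_neg]
            refine (inv_anti₀ (by linarith) h6).trans ?_
            rw [inv_le_iff_one_le_mul₀ (by linarith)]
            nlinarith
      _ = Real.exp (∑ p ∈ Finset.Icc 1 Z with p.Prime, 3 * (p : ℝ) ^ (-(9 / 10) : ℝ)) :=
          (Real.exp_sum _ _).symm
      _ ≤ _ := by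
          rw [Real.exp_le_exp, ← Finset.mul_sum]
          have := sum_Icc_rpow_neg_le Z
          have h7 : ∑ p ∈ Finset.Icc 1 Z with p.Prime, (p : ℝ) ^ (-(9 / 10) : ℝ) ≤
              ∑ n ∈ Finset.Icc 1 Z, (n : ℝ) ^ (-(9 / 10) : ℝ) :=
            Finset.sum_le_sum_of_subset_of_nonneg (Finset.filter_subset _ _)
              fun _ _ _ => by positivity
          linarith
  calc ∑ m ∈ D, (1 : ℝ) / m ≤ ∑ m ∈ D, Real.exp (-R / 10) * (m : ℝ) ^ (-(9 / 10) : ℝ) := by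
        refine Finset.sum_le_sum fun m hm => ?_
        obtain ⟨h0, hR, -⟩ := hD m hm
        have hm0 : (0 : ℝ) < m := by exact_mod_cast Nat.pos_of_ne_zero h0
        rw [Real.rpow_def_of_pos hm0, ← Real.exp_add, one_div]
        nth_rw 1 [← Real.exp_log hm0]
        rw [← Real.exp_neg, Real.exp_le_exp]
        linarith
    _ ≤ Real.exp (-R / 10) * Real.exp (30 * (Z : ℝ) ^ (1 / 10 : ℝ)) := by
        rw [← Finset.mul_sum]
        gcongr
        exact h1.trans h2
    _ = _ := by rw [← Real.exp_add]

lemma eventually_exp_neg_le (K : ℝ) : ∀ᶠ j : ℕ in atTop,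
    K * Real.exp (-(Real.log j / 200) / 10 + 30 * (⌈Real.log j ^ 8⌉₊ : ℝ) ^ (1 / 10 : ℝ)) *
      Real.log j ^ 2 ≤ 1 := by
  have e1 : ∀ᶠ t : ℝ in atTop, t ^ (-(1 / 5) : ℝ) < 1 / 240000 :=
    (tendsto_rpow_neg_atTop (by norm_num : (0 : ℝ) < 1 / 5)).eventually_lt_const (by norm_num)
  have e2 : ∀ᶠ t : ℝ in atTop, t ^ 3 ≤ Real.exp (t / 4000) := by
    have h := (isLittleO_pow_exp_pos_mul_atTop 3 (by norm_num : (0 : ℝ) < 1 / 4000)).bound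
      (c := 1) one_pos
    filter_upwards [h, eventually_ge_atTop 0] with t ht ht0
    rw [Real.norm_of_nonneg (by positivity), Real.norm_of_nonneg (Real.exp_pos _).le, one_mul] at ht
    rwa [div_eq_inv_mul, ← one_div]
  have key : ∀ᶠ t : ℝ in atTop, K * Real.exp (-(t / 200) / 10 + 30 *
      (⌈t ^ 8⌉₊ : ℝ) ^ (1 / 10 : ℝ)) * t ^ 2 ≤ 1 := by
    filter_upwards [e1, e2, eventually_ge_atTop 1, eventually_ge_atTop K] with t h1 h2 h3 h4
    have ht0 : 0 < t := by linarith
    have hZ : (⌈t ^ 8⌉₊ : ℝ) ≤ 2 * t ^ 8 := by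
      have := Nat.ceil_lt_add_one (show 0 ≤ t ^ 8 by positivity)
      have h9 : (1 : ℝ) ≤ t ^ 8 := one_le_pow₀ h3
      linarith
    have hZ2 : (⌈t ^ 8⌉₊ : ℝ) ^ (1 / 10 : ℝ) ≤ 2 * (t * t ^ (-(1 / 5) : ℝ)) := by
      calc (⌈t ^ 8⌉₊ : ℝ) ^ (1 / 10 : ℝ) ≤ (2 * t ^ 8) ^ (1 / 10 : ℝ) := by gcongr
        _ = 2 ^ (1 / 10 : ℝ) * t ^ (4 / 5 : ℝ) := by
            rw [Real.mul_rpow (by norm_num) (by positivity), ← Real.rpow_natCast t 8,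
              ← Real.rpow_mul ht0.le]
            norm_num
        _ ≤ 2 * t ^ (4 / 5 : ℝ) := by
            gcongr
            exact Real.rpow_le_self_of_one_le (by norm_num) (by norm_num)
        _ = _ := by
            congr 1
            nth_rw 2 [← Real.rpow_one t]
            rw [← Real.rpow_add ht0]
            norm_num
    have h5 : Real.exp (-(t / 200) / 10 + 30 * (⌈t ^ 8⌉₊ : ℝ) ^ (1 / 10 : ℝ)) ≤
        Real.exp (-(t / 4000)) := by
      rw [Real.exp_le_exp]
      nlinarith
    calc _ ≤ t * Real.exp (-(t / 4000)) * t ^ 2 := by gcongr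
      _ = t ^ 3 * Real.exp (-(t / 4000)) := by ring
      _ ≤ Real.exp (t / 4000) * Real.exp (-(t / 4000)) := by gcongr
      _ = 1 := by rw [← Real.exp_add]; simp
  exact (Real.tendsto_log_atTop.comp tendsto_natCast_atTop_atTop).eventually key

lemma eventually_sum_inv_of_smooth_cofactor_le : ∀ᶠ j : ℕ in atTop, ∀ A : Finset ℕ,
    (∀ n ∈ A, Tame j n ∧ (∀ p, p.Prime → p ∣ n → p ≠ maxPrimeFac n → p ≤ ⌈Real.log j ^ 8⌉₊) ∧
      Real.log j / 200 < Real.log ((n / maxPrimeFac n : ℕ) : ℝ)) →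
    ∑ n ∈ A, (1 : ℝ) / n ≤ 1 / (j * Real.log j ^ 2) := by
  classical
  obtain ⟨C, hC0, hC⟩ := exists_sum_inv_primes_le
  filter_upwards [eventually_ge_atTop 20, eventually_le_log 1, eventually_tame_maxPrimeFac,
    eventually_log_maxPrimeFac_ge, eventually_const_mul_log_pow_le 1000 2,
    eventually_const_mul_log_pow_le 2 8, eventually_exp_neg_le (4 * C)]
    with j hj hl hmax hmax2 h1 h8 hexp A hA
  have hj3 : (20 : ℝ) ≤ j := by exact_mod_cast hj
  set l := Real.log j with hldef
  have hl0 : 0 < l := by linarith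
  set Z := ⌈l ^ 8⌉₊ with hZ
  have hZj : Z ≤ j ^ 5 := by
    have := Nat.ceil_lt_add_one (show 0 ≤ l ^ 8 by positivity)
    rw [← hZ] at this
    have h9 : (1 : ℝ) ≤ l ^ 8 := one_le_pow₀ (by linarith)
    have h10 : (Z : ℝ) ≤ j := by linarith
    have h11 : Z ≤ j := by exact_mod_cast h10
    exact h11.trans (Nat.le_self_pow (by norm_num) j)
  set D := (Finset.Icc 1 ⌊Real.exp (29 * l ^ 2)⌋₊).filter
    fun m : ℕ => l / 200 ≤ Real.log m ∧ ∀ p, p.Prime → p ∣ m → p ≤ Z with hDdef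
  have hmain := sum_inv_le_of_windows (k := 1) (w := 1) (α₀ := j / 2)
    (D := D) (α := fun e => j * Real.log 2 - Real.log e) (A := A) hC hC0.le
    (by linarith) (by positivity) (by
      intro d hd
      obtain ⟨hd1, hd2⟩ := Finset.mem_Icc.1 (Finset.mem_filter.1 hd).1
      have h2 : Real.log d ≤ 29 * l ^ 2 := by
        rw [Real.log_le_iff_le_exp (by exact_mod_cast hd1)]
        exact (Nat.cast_le.2 hd2).trans (Nat.floor_le (Real.exp_pos _).le)
      have := Real.log_two_gt_d9
      nlinarith)
    (by
      intro n hn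
      obtain ⟨ht, hsm, hbig⟩ := hA n hn
      obtain ⟨hq, hqn, -, hq8⟩ := hmax n ht
      obtain ⟨-, hm⟩ := hmax2 n ht fun p hp hpn hpq => (hsm p hp hpn hpq).trans hZj
      have hqsq := maxPrimeFac_sq_not_dvd ht (by omega) hq8
      have hn' : n / maxPrimeFac n * maxPrimeFac n = n := Nat.div_mul_cancel hqn
      set m := n / maxPrimeFac n with hmdef
      have hm0 : 0 < m := Nat.div_pos (Nat.le_of_dvd ht.pos hqn) hq.pos
      have hlogn : Real.log n = Real.log m + Real.log (maxPrimeFac n) := by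
        rw [← Real.log_mul (by exact_mod_cast hm0.ne') (by exact_mod_cast hq.ne_zero)]
        congr 1
        exact_mod_cast hn'.symm
      obtain ⟨hn1, hn2⟩ := ht.log_mem
      refine ⟨m, Finset.mem_filter.2 ⟨Finset.mem_Icc.2 ⟨hm0, Nat.le_floor ?_⟩, hbig.le, ?_⟩,
        fun _ => maxPrimeFac n, fun _ => ⟨hq, by linarith, by linarith⟩, by simp [hn']⟩
      · rwa [← Real.log_le_iff_le_exp (by exact_mod_cast hm0)]
      · refine fun p hp hpm => hsm p hp (hpm.trans ⟨_, hn'.symm⟩) ?_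
        rintro rfl
        have h := (Nat.mul_dvd_mul_right hpm (maxPrimeFac n)).trans hn'.dvd
        rw [← sq] at h
        exact hqsq h)
  refine hmain.trans ?_
  have hS := sum_inv_smooth_le (Z := Z) (D := D) (R := l / 200) fun m hm =>
    ⟨Nat.one_le_iff_ne_zero.1 (Finset.mem_Icc.1 (Finset.mem_filter.1 hm).1).1,
      (Finset.mem_filter.1 hm).2.1, (Finset.mem_filter.1 hm).2.2⟩
  rw [pow_one, le_div_iff₀ (by positivity)]
  calc _ ≤ Real.exp (-(l / 200) / 10 + 30 * (Z : ℝ) ^ (1 / 10 : ℝ)) * (C * (1 + 1) / (j / 2)) *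
        (j * l ^ 2) := by gcongr
    _ = 4 * C * Real.exp (-(l / 200) / 10 + 30 * (Z : ℝ) ^ (1 / 10 : ℝ)) * l ^ 2 := by
        field_simp; ring
    _ ≤ 1 := hexp

lemma no_max_prime_of_prod_eq {P Q : Finset ℕ} (hP : ∀ p ∈ P, p.Prime) (hQ : ∀ p ∈ Q, p.Prime)
    (h : (∏ p ∈ P, (p - 1)) * ∏ p ∈ Q, p = (∏ p ∈ Q, (p - 1)) * ∏ p ∈ P, p) {r : ℕ}
    (hr : r ∈ P \ Q) (hmax : ∀ p ∈ P \ Q, p ≤ r) : False := by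
  have hrP := hP r (Finset.mem_sdiff.1 hr).1
  rw [← Finset.prod_inter_mul_prod_sdiff P Q fun p => p - 1,
    ← Finset.prod_inter_mul_prod_sdiff P Q fun p => p,
    ← Finset.prod_inter_mul_prod_sdiff Q P fun p => p - 1,
    ← Finset.prod_inter_mul_prod_sdiff Q P fun p => p, Finset.inter_comm Q P] at h
  have h1 : (∏ p ∈ P ∩ Q, (p - 1)) ≠ 0 := Finset.prod_ne_zero_iff.2 fun p hp => by
    have := (hP p (Finset.mem_inter.1 hp).1).two_le
    omega
  have h2 : (∏ p ∈ P ∩ Q, p) ≠ 0 := Finset.prod_ne_zero_iff.2 fun p hp =>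
    (hP p (Finset.mem_inter.1 hp).1).ne_zero
  have h3 : (∏ p ∈ P \ Q, (p - 1)) * ∏ p ∈ Q \ P, p =
      (∏ p ∈ Q \ P, (p - 1)) * ∏ p ∈ P \ Q, p :=
    mul_left_cancel₀ (mul_ne_zero h1 h2) (by linarith)
  have h4 : r ∣ (∏ p ∈ P \ Q, (p - 1)) * ∏ p ∈ Q \ P, p :=
    h3 ▸ (Finset.dvd_prod_of_mem (fun p => p) hr).mul_left _
  rcases hrP.dvd_mul.1 h4 with h5 | h5
  · obtain ⟨p, hp, hrp⟩ := (hrP.prime.dvd_finsetProd_iff _).1 h5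
    have hp2 := (hP p (Finset.mem_sdiff.1 hp).1).two_le
    have := Nat.le_of_dvd (by omega) hrp
    have := hmax p hp
    omega
  · obtain ⟨p, hp, hrp⟩ := (hrP.prime.dvd_finsetProd_iff _).1 h5
    obtain rfl := (Nat.prime_dvd_prime_iff_eq hrP (hQ p (Finset.mem_sdiff.1 hp).1)).1 hrp
    exact (Finset.mem_sdiff.1 hp).2 (Finset.mem_sdiff.1 hr).1

lemma eq_of_prod_eq {P Q : Finset ℕ} (hP : ∀ p ∈ P, p.Prime) (hQ : ∀ p ∈ Q, p.Prime)
    (h : (∏ p ∈ P, (p - 1)) * ∏ p ∈ Q, p = (∏ p ∈ Q, (p - 1)) * ∏ p ∈ P, p) : P = Q := by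
  have key : ∀ {P Q : Finset ℕ}, (∀ p ∈ P, p.Prime) → (∀ p ∈ Q, p.Prime) →
      ((∏ p ∈ P, (p - 1)) * ∏ p ∈ Q, p = (∏ p ∈ Q, (p - 1)) * ∏ p ∈ P, p) → P ⊆ Q := by
    intro P Q hP hQ h
    by_contra hPQ
    have hne : (P \ Q).Nonempty := by rwa [Finset.sdiff_nonempty]
    exact no_max_prime_of_prod_eq hP hQ h (Finset.max'_mem _ hne) fun p hp => Finset.le_max' _ p hp
  exact (key hP hQ h).antisymm (key hQ hP h.symm)

lemma primeFactors_eq_of_totient_div_eq {a b : ℕ} (ha : 0 < a) (hb : 0 < b)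
    (h : (Nat.totient a : ℝ) / a = Nat.totient b / b) : a.primeFactors = b.primeFactors := by
  have ha' : (0 : ℝ) < a := by exact_mod_cast ha
  have hb' : (0 : ℝ) < b := by exact_mod_cast hb
  rw [div_eq_div_iff ha'.ne' hb'.ne'] at h
  have h1 : Nat.totient a * b = Nat.totient b * a := by exact_mod_cast h
  refine eq_of_prod_eq (fun p hp => Nat.prime_of_mem_primeFactors hp)
    (fun p hp => Nat.prime_of_mem_primeFactors hp) ?_
  have e1 := Nat.totient_mul_prod_primeFactors a
  have e2 := Nat.totient_mul_prod_primeFactors b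
  refine mul_left_cancel₀ (a := a * b) (by positivity) ?_
  calc a * b * ((∏ p ∈ a.primeFactors, (p - 1)) * ∏ p ∈ b.primeFactors, p)
      = (a * ∏ p ∈ a.primeFactors, (p - 1)) * b * ∏ p ∈ b.primeFactors, p := by ring
    _ = (Nat.totient a * b) * (∏ p ∈ a.primeFactors, p) * ∏ p ∈ b.primeFactors, p := by
        rw [← e1]; ring
    _ = a * (Nat.totient b * ∏ p ∈ b.primeFactors, p) * ∏ p ∈ a.primeFactors, p := by
        rw [h1]; ring
    _ = _ := by rw [e2]; ring

lemma sum_inv_le_one_of_primeFactors_eq {S P : Finset ℕ}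
    (hS : ∀ s ∈ S, 0 < s ∧ s.primeFactors = P) : ∑ s ∈ S, (1 : ℝ) / s ≤ 1 := by
  rcases S.eq_empty_or_nonempty with rfl | ⟨s₀, hs₀⟩
  · simp
  have hP : ∀ p ∈ P, p.Prime := fun p hp =>
    Nat.prime_of_mem_primeFactors ((hS s₀ hs₀).2.symm ▸ hp)
  set r := ∏ p ∈ P, p with hr
  have hr0 : 0 < r := Finset.prod_pos fun p hp => (hP p hp).pos
  have hdvd : ∀ s ∈ S, r * (s / r) = s := fun s hs =>
    Nat.mul_div_cancel' (by rw [hr, ← (hS s hs).2]; exact Nat.prod_primeFactors_dvd s)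
  have h1 := sum_rpow_neg_le_prod (σ := 1) one_pos (D := S.image (· / r)) (s := P) (by
    intro m hm
    obtain ⟨s, hs, rfl⟩ := Finset.mem_image.1 hm
    refine ⟨fun h0 => ?_, ?_⟩
    · have := hdvd s hs
      rw [h0, mul_zero] at this
      exact (hS s hs).1.ne this
    · rw [← (hS s hs).2]
      exact Nat.primeFactors_mono ⟨r, by rw [mul_comm]; exact (hdvd s hs).symm⟩ (hS s hs).1.ne')
  rw [Finset.sum_image (fun a ha b hb hab => by
    rw [← hdvd a ha, ← hdvd b hb]; exact congrArg (r * ·) hab), Finset.filter_true_of_mem hP] at h1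
  calc ∑ s ∈ S, (1 : ℝ) / s = (1 / r) * ∑ s ∈ S, ((s / r : ℕ) : ℝ) ^ (-1 : ℝ) := by
        rw [Finset.mul_sum]
        refine Finset.sum_congr rfl fun s hs => ?_
        nth_rw 1 [← hdvd s hs]
        rw [Real.rpow_neg_one]
        push_cast
        rw [one_div, mul_inv, one_div]
    _ ≤ (1 / r) * ∏ p ∈ P, (1 - (p : ℝ) ^ (-1 : ℝ))⁻¹ := by gcongr
    _ = ∏ p ∈ P, (1 / ((p : ℝ) - 1)) := by
        rw [hr]
        push_cast
        rw [one_div, ← Finset.prod_inv_distrib, ← Finset.prod_mul_distrib]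
        refine Finset.prod_congr rfl fun p hp => ?_
        have hp2 : (2 : ℝ) ≤ p := by exact_mod_cast (hP p hp).two_le
        have : (p : ℝ) - 1 ≠ 0 := by linarith
        rw [Real.rpow_neg_one, ← mul_inv, one_div]
        congr 1
        field_simp
    _ ≤ 1 := Finset.prod_le_one (fun p hp => by
          have hp2 : (2 : ℝ) ≤ p := by exact_mod_cast (hP p hp).two_le
          have : 0 < (p : ℝ) - 1 := by linarith
          positivity) fun p hp => by
        have hp2 : (2 : ℝ) ≤ p := by exact_mod_cast (hP p hp).two_le
        rw [div_le_one (by linarith)]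
        linarith

lemma exists_fiber_bounds {y : ℕ} (hy : 0 < y) {A : Finset ℕ} (hA : ∀ n ∈ A, y ≤ n ∧ n < 2 * y)
    {κ : ℕ → ℝ} (hκ : MonotoneOn κ A) : ∃ α β : ℝ → ℕ,
    (∀ k ∈ A.image κ, α k ∈ A ∧ β k ∈ A) ∧ (∀ n ∈ A, α (κ n) ≤ n ∧ n ≤ β (κ n)) ∧
    ∑ k ∈ A.image κ, (Real.log (β k) - Real.log (α k)) ≤ Real.log 2 := by
  have hex : ∀ k ∈ A.image κ, ∃ a b, a ∈ A ∧ b ∈ A ∧ κ a = k ∧ κ b = k ∧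
      ∀ n ∈ A, κ n = k → a ≤ n ∧ n ≤ b := by
    intro k hk
    obtain ⟨n₀, hn₀, hk₀⟩ := Finset.mem_image.1 hk
    have hne : (A.filter fun n => κ n = k).Nonempty := ⟨n₀, Finset.mem_filter.2 ⟨hn₀, hk₀⟩⟩
    have h1 := Finset.mem_filter.1 (Finset.min'_mem _ hne)
    have h2 := Finset.mem_filter.1 (Finset.max'_mem _ hne)
    exact ⟨_, _, h1.1, h2.1, h1.2, h2.2, fun n hn hnk =>
      ⟨Finset.min'_le _ _ (Finset.mem_filter.2 ⟨hn, hnk⟩),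
        Finset.le_max' _ _ (Finset.mem_filter.2 ⟨hn, hnk⟩)⟩⟩
  choose! α β hα hβ hκα hκβ hb using hex
  refine ⟨α, β, fun k hk => ⟨hα k hk, hβ k hk⟩,
    fun n hn => hb _ (Finset.mem_image_of_mem κ hn) n hn rfl, ?_⟩
  have hle : ∀ k ∈ A.image κ, α k ≤ β k := fun k hk => (hb k hk _ (hβ k hk) (hκβ k hk)).1
  have hlt : ∀ k ∈ A.image κ, ∀ k' ∈ A.image κ, k < k' → β k ≤ α k' := by
    intro k hk k' hk' hkk
    by_contra! hcon
    have := hκ (hα k' hk') (hβ k hk) hcon.le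
    rw [hκα k' hk', hκβ k hk] at this
    linarith
  have hdisj : (A.image κ : Set ℝ).PairwiseDisjoint fun k => Finset.Ico (α k) (β k) := by
    intro k hk k' hk' hkk
    refine Finset.disjoint_left.2 fun n hn hn' => ?_
    rw [Finset.mem_Ico] at hn hn'
    rcases lt_or_gt_of_ne hkk with h | h
    · have := hlt k hk k' hk' h; omega
    · have := hlt k' hk' k hk h; omega
  have htel : ∀ {a b : ℕ}, a ≤ b →
      ∑ n ∈ Finset.Ico a b, (Real.log (n + 1 : ℕ) - Real.log n) = Real.log b - Real.log a :=
    fun h => Finset.sum_Ico_sub (fun n : ℕ => Real.log n) h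
  calc ∑ k ∈ A.image κ, (Real.log (β k) - Real.log (α k))
      = ∑ k ∈ A.image κ, ∑ n ∈ Finset.Ico (α k) (β k), (Real.log (n + 1 : ℕ) - Real.log n) :=
        Finset.sum_congr rfl fun k hk => (htel (hle k hk)).symm
    _ = ∑ n ∈ (A.image κ).biUnion fun k => Finset.Ico (α k) (β k),
          (Real.log (n + 1 : ℕ) - Real.log n) := (Finset.sum_biUnion hdisj).symm
    _ ≤ ∑ n ∈ Finset.Ico y (2 * y), (Real.log (n + 1 : ℕ) - Real.log n) := by
        refine Finset.sum_le_sum_of_subset_of_nonneg ?_ fun n hn _ => ?_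
        · intro n hn
          obtain ⟨k, hk, hn⟩ := Finset.mem_biUnion.1 hn
          rw [Finset.mem_Ico] at hn ⊢
          have := hA _ (hα k hk)
          have := hA _ (hβ k hk)
          omega
        · have hn0 : 0 < n := hy.trans_le (Finset.mem_Ico.1 hn).1
          have : Real.log n ≤ Real.log (n + 1 : ℕ) :=
            Real.log_le_log (by exact_mod_cast hn0) (by push_cast; linarith)
          linarith
    _ = Real.log 2 := by
        have hy' : (y : ℝ) ≠ 0 := by exact_mod_cast hy.ne'
        rw [htel (by omega)]
        push_cast
        rw [Real.log_mul (by norm_num) hy']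
        ring

lemma totient_div_le_of_totient_le {R s p s' p' : ℕ} (hs : 0 < s) (hsR : s ≤ R) (hs' : 0 < s')
    (hsR' : s' ≤ R) (hp : p.Prime) (hps : ¬ p ∣ s) (hp8 : 8 * R ^ 2 < p) (hp' : p'.Prime)
    (h : Nat.totient (s * p) ≤ Nat.totient (s' * p'))
    (hlog : Real.log ((s' * p' : ℕ) : ℝ) - Real.log ((s * p : ℕ) : ℝ) ≤ 1 / (8 * (R : ℝ) ^ 2)) :
    (Nat.totient s : ℝ) / s ≤ Nat.totient s' / s' := by
  by_contra! hcon
  have hR1 : 1 ≤ R := hs.trans_le hsR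
  have hR : (1 : ℝ) ≤ R := by exact_mod_cast hR1
  have hs0 : (0 : ℝ) < s := by exact_mod_cast hs
  have hs0' : (0 : ℝ) < s' := by exact_mod_cast hs'
  have hp0 : (0 : ℝ) < p := by exact_mod_cast hp.pos
  have hp0' : (0 : ℝ) < p' := by exact_mod_cast hp'.pos
  have hp8' : 8 * (R : ℝ) ^ 2 < p := by exact_mod_cast hp8
  set q := (Nat.totient s : ℝ) / s with hq
  set q' := (Nat.totient s' : ℝ) / s' with hq'
  have hq'0 : 0 ≤ q' := by positivity
  have hq'1 : q' ≤ 1 := by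
    rw [hq', div_le_one hs0']; exact_mod_cast Nat.totient_le s'
  have hgap : q' + 1 / (R : ℝ) ^ 2 ≤ q := by
    have h1 : (Nat.totient s' * s + 1 : ℝ) ≤ Nat.totient s * s' := by
      rw [hq, hq', div_lt_div_iff₀ hs0' hs0] at hcon
      exact_mod_cast hcon
    have h2 : 1 / (R : ℝ) ^ 2 ≤ 1 / (s * s') := by
      rw [sq]
      have : (s : ℝ) ≤ R := by exact_mod_cast hsR
      have : (s' : ℝ) ≤ R := by exact_mod_cast hsR'
      gcongr
    calc q' + 1 / (R : ℝ) ^ 2 ≤ q' + 1 / (s * s') := by linarith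
      _ = (Nat.totient s' * s + 1) / (s * s') := by rw [hq']; field_simp
      _ ≤ (Nat.totient s * s') / (s * s') := by gcongr
      _ = q := by rw [hq]; field_simp
  have hn : (Nat.totient (s * p) : ℝ) = q * (s * (p - 1)) := by
    rw [Nat.totient_mul ((Nat.Prime.coprime_iff_not_dvd hp).2 hps).symm, Nat.totient_prime hp, hq]
    push_cast [Nat.cast_sub hp.one_le]
    field_simp
  have hm : (Nat.totient (s' * p') : ℝ) ≤ q' * (s' * p') := by
    have : Nat.totient (s' * p') ≤ Nat.totient s' * p' := by
      by_cases hd : p' ∣ s'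
      · rw [mul_comm, Nat.totient_mul_of_prime_of_dvd hp' hd, mul_comm]
      · rw [mul_comm, Nat.totient_mul_of_prime_of_not_dvd hp' hd, mul_comm]
        exact Nat.mul_le_mul_left _ (Nat.sub_le _ _)
    calc (Nat.totient (s' * p') : ℝ) ≤ Nat.totient s' * p' := by exact_mod_cast this
      _ = _ := by rw [hq']; field_simp
  set η := 1 / (8 * (R : ℝ) ^ 2) with hη
  have hη1 : η ≤ 1 / 8 := by
    rw [hη]
    have : (1 : ℝ) ≤ R ^ 2 := one_le_pow₀ hR
    gcongr
    linarith
  have hη0 : 0 < η := by positivity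
  have hexp : Real.exp η ≤ 1 + 2 * η := by
    have := Real.exp_bound_div_one_sub_of_interval hη0.le (by linarith)
    refine this.trans ?_
    rw [div_le_iff₀ (by linarith)]
    nlinarith
  have hratio : (s' * p' : ℝ) ≤ (1 + 2 * η) * (s * p) := by
    push_cast at hlog
    have hsp : (0 : ℝ) < s * p := by positivity
    have hsp' : (0 : ℝ) < s' * p' := by positivity
    have h3 : Real.log (s' * p') ≤ η + Real.log (s * p) := by linarith
    rw [Real.log_le_iff_le_exp hsp', Real.exp_add, Real.exp_log hsp] at h3
    exact h3.trans (by gcongr)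
  have hchain : q * (s * ((p : ℝ) - 1)) ≤ q' * ((1 + 2 * η) * (s * p)) := by
    rw [← hn]
    have : (Nat.totient (s * p) : ℝ) ≤ Nat.totient (s' * p') := by exact_mod_cast h
    exact this.trans (hm.trans (by gcongr))
  have hchain2 : q * ((p : ℝ) - 1) ≤ q' * ((1 + 2 * η) * p) := by
    refine le_of_mul_le_mul_left ?_ hs0
    calc (s : ℝ) * (q * (p - 1)) = q * (s * (p - 1)) := by ring
      _ ≤ _ := hchain
      _ = _ := by ring
  have hR2 : 1 / (R : ℝ) ^ 2 = 8 * η := by rw [hη]; field_simp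
  rw [hR2] at hgap
  have hpη : 1 < η * p := by
    rw [hη, one_div, inv_mul_eq_div, one_lt_div (by positivity)]
    exact hp8'
  have hp1 : 1 ≤ (p : ℝ) := by exact_mod_cast hp.one_le
  have h5 : (q' + 8 * η) * ((p : ℝ) - 1) ≤ q' * ((1 + 2 * η) * p) :=
    (mul_le_mul_of_nonneg_right hgap (by linarith)).trans hchain2
  have h6 : q' * (2 * η * p) ≤ 2 * η * p := by
    have : 0 < 2 * η * p := by positivity
    nlinarith
  nlinarith

lemma sum_inv_le_of_log_bounds {C Λ : ℝ} (hC0 : 0 ≤ C)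
    (hC : ∀ α β : ℝ, 1 / 2 ≤ α → α ≤ β → β ≤ α + 1 → ∀ S : Finset ℕ,
      (∀ p ∈ S, p.Prime ∧ α ≤ Real.log p ∧ Real.log p ≤ β) →
      ∑ p ∈ S, Real.log p / p ≤ β - α + C * α ^ (-(1 / 37) : ℝ)) (hΛ : 1 / 2 ≤ Λ) {δ : ℝ}
    (hδ : 0 ≤ δ) (hδ1 : δ ≤ 1) {F : Finset ℕ} {P : Finset ℕ} {a : ℝ} {s p : ℕ → ℕ}
    (hF : ∀ n ∈ F, n = s n * p n ∧ (p n).Prime ∧ 0 < s n ∧ (s n).primeFactors = P ∧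
      Λ + Real.log (s n) ≤ a ∧ a ≤ Real.log n ∧ Real.log n ≤ a + δ) :
    ∑ n ∈ F, (1 : ℝ) / n ≤ (δ + C * Λ ^ (-(1 / 37) : ℝ)) / Λ := by
  have hΛ0 : 0 < Λ := by linarith
  rw [← Finset.sum_fiberwise_of_maps_to (t := F.image s) (g := s)
    fun n hn => Finset.mem_image_of_mem s hn]
  have hinner : ∀ t ∈ F.image s, ∑ n ∈ F with s n = t, (1 : ℝ) / n ≤
      1 / t * ((δ + C * Λ ^ (-(1 / 37) : ℝ)) / Λ) := by
    intro t ht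
    have ht0 : (0 : ℝ) < t := by
      obtain ⟨n, hn, rfl⟩ := Finset.mem_image.1 ht
      exact_mod_cast (hF n hn).2.2.1
    obtain ⟨m, hm, hmt⟩ := Finset.mem_image.1 ht
    have hta : Λ ≤ a - Real.log t := by
      have := (hF m hm).2.2.2.2.1
      rw [hmt] at this
      linarith
    have hbd : ∀ q ∈ ({n ∈ F | s n = t} : Finset ℕ).image p, q.Prime ∧
        a - Real.log t ≤ Real.log q ∧ Real.log q ≤ a - Real.log t + δ := by
      intro q hq
      obtain ⟨n, hn, rfl⟩ := Finset.mem_image.1 hq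
      obtain ⟨hnF, hnt⟩ := Finset.mem_filter.1 hn
      obtain ⟨h1, h2, -, -, -, h3, h4⟩ := hF n hnF
      have h5 : Real.log n = Real.log t + Real.log (p n) := by
        rw [← Real.log_mul ht0.ne' (by exact_mod_cast h2.ne_zero), ← hnt]
        congr 1
        exact_mod_cast h1
      exact ⟨h2, by linarith, by linarith⟩
    have hsum := hC (a - Real.log t) (a - Real.log t + δ) (by linarith) (by linarith)
      (by linarith) _ hbd
    have hrp : (a - Real.log t) ^ (-(1 / 37) : ℝ) ≤ Λ ^ (-(1 / 37) : ℝ) :=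
      Real.rpow_le_rpow_of_nonpos hΛ0 hta (by norm_num)
    have hsum2 : ∑ q ∈ ({n ∈ F | s n = t} : Finset ℕ).image p, (1 : ℝ) / q ≤
        (δ + C * Λ ^ (-(1 / 37) : ℝ)) / Λ := by
      rw [le_div_iff₀ hΛ0, Finset.sum_mul]
      calc _ ≤ ∑ q ∈ ({n ∈ F | s n = t} : Finset ℕ).image p, Real.log q / q := by
            refine Finset.sum_le_sum fun q hq => ?_
            have := hbd q hq
            rw [div_mul_eq_mul_div, one_mul]
            gcongr
            linarith
        _ ≤ _ := hsum
        _ ≤ _ := by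
            have : C * (a - Real.log t) ^ (-(1 / 37) : ℝ) ≤ C * Λ ^ (-(1 / 37) : ℝ) := by gcongr
            linarith
    rw [Finset.sum_image] at hsum2
    · calc ∑ n ∈ F with s n = t, (1 : ℝ) / n
          = 1 / t * ∑ n ∈ F with s n = t, (1 : ℝ) / (p n) := by
            rw [Finset.mul_sum]
            refine Finset.sum_congr rfl fun n hn => ?_
            obtain ⟨hnF, hnt⟩ := Finset.mem_filter.1 hn
            rw [one_div_mul_one_div]
            congr 1
            rw [← hnt]
            exact_mod_cast (hF n hnF).1
        _ ≤ _ := by gcongr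
    · intro n hn m hm hnm
      obtain ⟨hnF, hnt⟩ := Finset.mem_filter.1 hn
      obtain ⟨hmF, hmt⟩ := Finset.mem_filter.1 hm
      rw [(hF n hnF).1, (hF m hmF).1, hnt, hmt, hnm]
  have hclass : ∑ t ∈ F.image s, (1 : ℝ) / t ≤ 1 := by
    refine sum_inv_le_one_of_primeFactors_eq (P := P) fun t ht => ?_
    obtain ⟨n, hn, rfl⟩ := Finset.mem_image.1 ht
    exact ⟨(hF n hn).2.2.1, (hF n hn).2.2.2.1⟩
  calc _ ≤ ∑ t ∈ F.image s, 1 / (t : ℝ) * ((δ + C * Λ ^ (-(1 / 37) : ℝ)) / Λ) :=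
        Finset.sum_le_sum hinner
    _ = (∑ t ∈ F.image s, 1 / (t : ℝ)) * ((δ + C * Λ ^ (-(1 / 37) : ℝ)) / Λ) :=
        (Finset.sum_mul _ _ _).symm
    _ ≤ 1 * ((δ + C * Λ ^ (-(1 / 37) : ℝ)) / Λ) := by gcongr
    _ = _ := one_mul _

lemma sum_inv_le_of_small_cofactor {C Λ : ℝ} (hC0 : 0 ≤ C)
    (hC : ∀ α β : ℝ, 1 / 2 ≤ α → α ≤ β → β ≤ α + 1 → ∀ S : Finset ℕ,
      (∀ p ∈ S, p.Prime ∧ α ≤ Real.log p ∧ Real.log p ≤ β) →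
      ∑ p ∈ S, Real.log p / p ≤ β - α + C * α ^ (-(1 / 37) : ℝ)) (hΛ : 1 / 2 ≤ Λ) {y R : ℕ}
    (hy : 0 < y) (hR : 1 ≤ R) (hΛR : Λ + Real.log R ≤ Real.log y) {A : Finset ℕ} {s p : ℕ → ℕ}
    (hA : ∀ n ∈ A, y ≤ n ∧ n < 2 * y ∧ n = s n * p n ∧ (p n).Prime ∧ ¬ p n ∣ s n ∧ 0 < s n ∧
      s n ≤ R ∧ 8 * R ^ 2 < p n)
    (hmono : ∀ m ∈ A, ∀ n ∈ A, m ≤ n → Nat.totient m ≤ Nat.totient n) :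
    ∑ n ∈ A, (1 : ℝ) / n ≤ (Real.log 2 + 9 * R ^ 3 * (C * Λ ^ (-(1 / 37) : ℝ))) / Λ := by
  have hΛ0 : 0 < Λ := by linarith
  have hR' : (1 : ℝ) ≤ R := by exact_mod_cast hR
  have hy' : (0 : ℝ) < y := by exact_mod_cast hy
  set i : ℕ → ℕ := fun n => ⌊8 * (R : ℝ) ^ 2 * (Real.log n - Real.log y)⌋₊ with hi
  set q : ℕ → ℝ := fun t => (Nat.totient t : ℝ) / t with hq
  have hq01 : ∀ t, 0 < t → 0 < q t ∧ q t ≤ 1 := fun t ht => by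
    have ht0 : (0 : ℝ) < t := by exact_mod_cast ht
    refine ⟨div_pos (by exact_mod_cast Nat.totient_pos.2 ht) ht0, ?_⟩
    rw [hq]
    simp only
    rw [div_le_one ht0]
    exact_mod_cast Nat.totient_le t
  set κ : ℕ → ℝ := fun n => 2 * i n + q (s n) with hκ
  have hlogmono : ∀ m ∈ A, ∀ n, m ≤ n → Real.log m ≤ Real.log n := fun m hm n hmn =>
    Real.log_le_log (by exact_mod_cast hy.trans_le (hA m hm).1) (by exact_mod_cast hmn)
  have hlogy : ∀ n ∈ A, Real.log y ≤ Real.log n ∧ Real.log n ≤ Real.log y + Real.log 2 := by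
    intro n hn
    obtain ⟨h1, h2, -⟩ := hA n hn
    refine ⟨Real.log_le_log hy' (by exact_mod_cast h1), ?_⟩
    rw [← Real.log_mul hy'.ne' (by norm_num)]
    refine Real.log_le_log (by exact_mod_cast hy.trans_le h1) ?_
    have : (n : ℝ) < 2 * y := by exact_mod_cast h2
    linarith
  have hmonoκ : MonotoneOn κ A := by
    intro m hm n hn hmn
    have hle : i m ≤ i n := by
      refine Nat.floor_mono ?_
      have := hlogmono m hm n hmn
      gcongr
    obtain ⟨-, -, hm1, hm2, hm3, hm4, hm5, hm6⟩ := hA m hm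
    obtain ⟨-, -, hn1, hn2, hn3, hn4, hn5, hn6⟩ := hA n hn
    rcases hle.lt_or_eq with h | h
    · have h1 : (i m : ℝ) + 1 ≤ i n := by exact_mod_cast h
      have := hq01 _ hm4
      have := hq01 _ hn4
      simp only [hκ]
      linarith
    · have hlog : Real.log n - Real.log m ≤ 1 / (8 * (R : ℝ) ^ 2) := by
        rw [le_div_iff₀ (by positivity)]
        have h1 : 8 * (R : ℝ) ^ 2 * (Real.log n - Real.log y) < i n + 1 := Nat.lt_floor_add_one _
        have h2 : (i m : ℝ) ≤ 8 * (R : ℝ) ^ 2 * (Real.log m - Real.log y) :=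
          Nat.floor_le (by
            have := (hlogy m hm).1
            have : 0 ≤ Real.log m - Real.log y := by linarith
            positivity)
        rw [h] at h2
        linarith
      have h1 := hmono m hm n hn hmn
      rw [hm1, hn1] at h1 hlog
      have := totient_div_le_of_totient_le hm4 hm5 hn4 hn5 hm2 hm3 hm6 hn2 h1 hlog
      simp only [hκ, h]
      simp only [hq]
      linarith
  obtain ⟨α, β, hαβ, hbd, hlogsum⟩ := exists_fiber_bounds hy
    (fun n hn => ⟨(hA n hn).1, (hA n hn).2.1⟩) hmonoκ
  have hfib : ∀ k ∈ A.image κ, ∑ n ∈ A with κ n = k, (1 : ℝ) / n ≤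
      (Real.log (β k) - Real.log (α k) + C * Λ ^ (-(1 / 37) : ℝ)) / Λ := by
    intro k hk
    obtain ⟨n₀, hn₀, hk₀⟩ := Finset.mem_image.1 hk
    obtain ⟨hα, hβ⟩ := hαβ k hk
    have hb0 := hbd n₀ hn₀
    rw [hk₀] at hb0
    have h1 := hlogmono _ hα _ (hb0.1.trans hb0.2)
    have h2 := hlogy _ hα
    have h3 := hlogy _ hβ
    have h4 := Real.log_two_lt_d9
    refine sum_inv_le_of_log_bounds hC0 hC hΛ (by linarith) (by linarith)
      (P := (s n₀).primeFactors) (a := Real.log (α k)) (s := s) (p := p) fun n hn => ?_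
    obtain ⟨hnA, hnk⟩ := Finset.mem_filter.1 hn
    obtain ⟨-, -, hn1, hn2, hn3, hn4, hn5, hn6⟩ := hA n hnA
    have hb := hbd n hnA
    rw [hnk] at hb
    refine ⟨hn1, hn2, hn4, ?_, ?_, hlogmono _ hα _ hb.1, ?_⟩
    · refine primeFactors_eq_of_totient_div_eq hn4 (hA n₀ hn₀).2.2.2.2.2.1 ?_
      have e : κ n = κ n₀ := hnk.trans hk₀.symm
      simp only [hκ] at e
      have q1 := hq01 _ hn4
      have q2 := hq01 _ (hA n₀ hn₀).2.2.2.2.2.1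
      have hii : i n = i n₀ := by
        rcases lt_trichotomy (i n) (i n₀) with h | h | h
        · have : (i n : ℝ) + 1 ≤ i n₀ := by exact_mod_cast h
          linarith
        · exact h
        · have : (i n₀ : ℝ) + 1 ≤ i n := by exact_mod_cast h
          linarith
      rw [hii] at e
      exact add_left_cancel e
    · have : Real.log (s n) ≤ Real.log R :=
        Real.log_le_log (by exact_mod_cast hn4) (by exact_mod_cast hn5)
      linarith
    · have := hlogmono n hnA _ hb.2
      linarith
  have hcard : ((A.image κ).card : ℝ) ≤ 9 * (R : ℝ) ^ 3 := by
    have hsub : A.image κ ⊆ ((Finset.range (8 * R ^ 2 + 1)) ×ˢ Finset.Icc 1 R).image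
        fun x : ℕ × ℕ => 2 * (x.1 : ℝ) + q x.2 := by
      intro k hk
      obtain ⟨n, hn, rfl⟩ := Finset.mem_image.1 hk
      refine Finset.mem_image.2 ⟨(i n, s n), Finset.mem_product.2 ⟨Finset.mem_range.2 ?_,
        Finset.mem_Icc.2 ⟨(hA n hn).2.2.2.2.2.1, (hA n hn).2.2.2.2.2.2.1⟩⟩, rfl⟩
      refine Nat.lt_succ_of_le (Nat.floor_le_of_le ?_)
      push_cast
      have h1 := hlogy n hn
      have h2 := Real.log_two_lt_d9
      have h3 : 0 ≤ 8 * (R : ℝ) ^ 2 := by positivity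
      nlinarith
    have h1 : (A.image κ).card ≤ (8 * R ^ 2 + 1) * R := by
      refine (Finset.card_le_card hsub).trans (Finset.card_image_le.trans ?_)
      simp
    calc ((A.image κ).card : ℝ) ≤ (8 * R ^ 2 + 1) * R := by exact_mod_cast h1
      _ ≤ (8 * R ^ 2 + R ^ 2) * R := by
          have : (1 : ℝ) ≤ R ^ 2 := one_le_pow₀ hR'
          gcongr
      _ = _ := by ring
  rw [← Finset.sum_fiberwise_of_maps_to (t := A.image κ) (g := κ)
    fun n hn => Finset.mem_image_of_mem κ hn]
  calc _ ≤ ∑ k ∈ A.image κ, (Real.log (β k) - Real.log (α k) + C * Λ ^ (-(1 / 37) : ℝ)) / Λ :=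
        Finset.sum_le_sum hfib
    _ = (∑ k ∈ A.image κ, (Real.log (β k) - Real.log (α k)) +
          (A.image κ).card * (C * Λ ^ (-(1 / 37) : ℝ))) / Λ := by
        rw [← Finset.sum_div, Finset.sum_add_distrib, Finset.sum_const, nsmul_eq_mul]
    _ ≤ _ := by gcongr

lemma exists_sum_inv_of_small_cofactor_le : ∃ C : ℝ, 0 < C ∧ ∀ᶠ j : ℕ in atTop, ∀ A : Finset ℕ,
    (∀ m ∈ A, ∀ n ∈ A, m ≤ n → Nat.totient m ≤ Nat.totient n) →
    (∀ n ∈ A, Tame j n ∧ Real.log ((n / maxPrimeFac n : ℕ) : ℝ) ≤ Real.log j / 200) →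
    ∑ n ∈ A, (1 : ℝ) / n ≤ 1 / j + C / (j * Real.log j ^ 2) := by
  obtain ⟨C, hC0, hC⟩ := exists_sum_primes_log_div_le
  have e1 : ∀ᶠ j : ℕ in atTop, Real.log j ^ 2 ≤ (j : ℝ) ^ (1 / 100 : ℝ) := by
    have h := ((isLittleO_log_rpow_rpow_atTop 2 (by norm_num : (0 : ℝ) < 1 / 100)).comp_tendsto
      tendsto_natCast_atTop_atTop).bound (c := 1) one_pos
    filter_upwards [h, eventually_le_log 0] with j hj hl
    simp only [Function.comp] at hj
    rw [Real.norm_of_nonneg (by positivity), Real.norm_of_nonneg (by positivity), one_mul] at hj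
    exact_mod_cast hj
  refine ⟨1 + 36 * C, by positivity, ?_⟩
  filter_upwards [eventually_ge_atTop 20, eventually_le_log 1, eventually_tame_maxPrimeFac,
    eventually_const_mul_log_pow_le 10 3, eventually_const_mul_log_pow_le 10 1, e1]
    with j hj hl hmax h3 h1 he A hmono hA
  have hj3 : (20 : ℝ) ≤ j := by exact_mod_cast hj
  have hj0 : (0 : ℝ) < j := by linarith
  set l := Real.log j with hldef
  rw [pow_one] at h1
  set R := ⌊(j : ℝ) ^ (1 / 200 : ℝ)⌋₊ with hRdef
  have hRle : (R : ℝ) ≤ (j : ℝ) ^ (1 / 200 : ℝ) := Nat.floor_le (by positivity)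
  have hR1 : 1 ≤ R := Nat.le_floor (by
    push_cast; exact Real.one_le_rpow (by linarith) (by norm_num))
  have hRj : R ≤ j := by
    have : (j : ℝ) ^ (1 / 200 : ℝ) ≤ j := Real.rpow_le_self_of_one_le (by linarith) (by norm_num)
    exact_mod_cast hRle.trans this
  have hlogR : Real.log R ≤ l :=
    Real.log_le_log (by exact_mod_cast hR1) (by exact_mod_cast hRj)
  set Λ := j * Real.log 2 - l with hΛ
  have hl2 := Real.log_two_gt_d9
  have hl2' := Real.log_two_lt_d9
  have hΛj : j / 2 ≤ Λ := by rw [hΛ]; nlinarith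
  have hΛ0 : 0 < Λ := by linarith
  have hmain := sum_inv_le_of_small_cofactor hC0.le hC (Λ := Λ) (by linarith) (y := 2 ^ j) (R := R)
    (by positivity) hR1 (by push_cast; rw [Real.log_pow, hΛ]; linarith) (A := A)
    (s := fun n => n / maxPrimeFac n) (p := maxPrimeFac) (by
      intro n hn
      obtain ⟨ht, hsm⟩ := hA n hn
      obtain ⟨hq, hqn, -, hq8⟩ := hmax n ht
      have hqsq := maxPrimeFac_sq_not_dvd ht (by omega) hq8
      have hn' : n / maxPrimeFac n * maxPrimeFac n = n := Nat.div_mul_cancel hqn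
      have hm0 : 0 < n / maxPrimeFac n := Nat.div_pos (Nat.le_of_dvd ht.pos hqn) hq.pos
      refine ⟨ht.1, ht.2.1, hn'.symm, hq, fun hd => ?_, hm0, Nat.le_floor ?_, ?_⟩
      · have h := (Nat.mul_dvd_mul_right hd (maxPrimeFac n)).trans hn'.dvd
        rw [← sq] at h
        exact hqsq h
      · rw [Real.rpow_def_of_pos hj0, ← Real.log_le_iff_le_exp (by exact_mod_cast hm0)]
        linarith
      · calc 8 * R ^ 2 ≤ j ^ 6 * j ^ 2 := by
              have : j ≤ j ^ 6 := Nat.le_self_pow (by norm_num) j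
              have : 8 ≤ j ^ 6 := by omega
              gcongr
          _ = j ^ 8 := by ring
          _ < _ := hq8) hmono
  refine hmain.trans ?_
  have hR3 : (R : ℝ) ^ 3 * Λ ^ (-(1 / 37) : ℝ) ≤ 2 * (j : ℝ) ^ (-(1 / 100) : ℝ) := by
    calc (R : ℝ) ^ 3 * Λ ^ (-(1 / 37) : ℝ)
        ≤ ((j : ℝ) ^ (1 / 200 : ℝ)) ^ 3 * (j / 2) ^ (-(1 / 37) : ℝ) := by
          have := Real.rpow_le_rpow_of_nonpos (z := -(1 / 37)) (by positivity) hΛj (by norm_num)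
          gcongr
      _ = (j : ℝ) ^ (3 / 200 - 1 / 37 : ℝ) * 2 ^ (1 / 37 : ℝ) := by
          rw [Real.div_rpow hj0.le (by norm_num), Real.rpow_neg (by norm_num : (0 : ℝ) ≤ 2),
            div_inv_eq_mul, ← Real.rpow_natCast, ← Real.rpow_mul hj0.le, ← mul_assoc,
            ← Real.rpow_add hj0]
          norm_num
      _ ≤ (j : ℝ) ^ (-(1 / 100) : ℝ) * 2 := by
          gcongr
          · linarith
          · norm_num
          · exact Real.rpow_le_self_of_one_le (by norm_num) (by norm_num)
      _ = _ := mul_comm _ _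
  have hR3' : (R : ℝ) ^ 3 * Λ ^ (-(1 / 37) : ℝ) ≤ 2 / l ^ 2 := by
    refine hR3.trans ?_
    rw [Real.rpow_neg hj0.le, ← div_eq_mul_inv]
    gcongr
  have hA1 : Real.log 2 / Λ ≤ 1 / j + 1 / (j * l ^ 2) := by
    have e : Real.log 2 / Λ = 1 / j + l / (j * Λ) := by
      have e0 : l + Λ = j * Real.log 2 := by rw [hΛ]; ring
      calc Real.log 2 / Λ = j * Real.log 2 / (j * Λ) := by field_simp
        _ = _ := by rw [← e0]; field_simp; ring
    rw [e]
    gcongr 1 / (j : ℝ) + ?_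
    rw [div_le_div_iff₀ (by positivity) (by positivity)]
    nlinarith
  have hA2 : 9 * (R : ℝ) ^ 3 * (C * Λ ^ (-(1 / 37) : ℝ)) / Λ ≤ 36 * C / (j * l ^ 2) := by
    calc _ = 9 * C * ((R : ℝ) ^ 3 * Λ ^ (-(1 / 37) : ℝ)) / Λ := by ring
      _ ≤ 9 * C * (2 / l ^ 2) / (j / 2) := by gcongr
      _ = _ := by field_simp; ring
  calc _ = Real.log 2 / Λ + 9 * (R : ℝ) ^ 3 * (C * Λ ^ (-(1 / 37) : ℝ)) / Λ := add_div _ _ _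
    _ ≤ 1 / j + 1 / (j * l ^ 2) + 36 * C / (j * l ^ 2) := by linarith
    _ = _ := by ring

lemma sum_inv_dyadic_le_one {y : ℕ} (hy : 0 < y) {A : Finset ℕ}
    (hA : ∀ n ∈ A, y ≤ n ∧ n < 2 * y) : ∑ n ∈ A, (1 : ℝ) / n ≤ 1 := by
  refine (sum_inv_le_card_div hy fun n hn => (hA n hn).1).trans ?_
  have hy' : (0 : ℝ) < y := by exact_mod_cast hy
  rw [div_le_one hy']
  have h : A.card ≤ (Finset.Ico y (2 * y)).card :=
    Finset.card_le_card fun n hn => Finset.mem_Ico.2 (hA n hn)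
  rw [Nat.card_Ico] at h
  have : A.card ≤ y := by omega
  exact_mod_cast this

lemma sum_range_one_div_mul_log_sq_le (N : ℕ) :
    ∑ j ∈ Finset.range N, 1 / ((j : ℝ) * Real.log j ^ 2) ≤
      1 / (2 * Real.log 2 ^ 2) + 1 / Real.log 2 := by
  have key : ∀ N : ℕ, ∑ j ∈ Finset.range (N + 3), 1 / ((j : ℝ) * Real.log j ^ 2) ≤
      1 / (2 * Real.log 2 ^ 2) + 1 / Real.log 2 - 1 / Real.log (N + 2 : ℝ) := by
    intro N
    induction N with
    | zero => simp [Finset.sum_range_succ]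
    | succ N ih =>
      rw [show N + 1 + 3 = (N + 3) + 1 by ring, Finset.sum_range_succ]
      have hN : (0 : ℝ) ≤ N := Nat.cast_nonneg N
      push_cast
      rw [show (N : ℝ) + 1 + 2 = N + 3 by ring]
      have h2 : 0 < Real.log (N + 2 : ℝ) := Real.log_pos (by linarith)
      have h3 : Real.log (N + 2 : ℝ) ≤ Real.log (N + 3 : ℝ) :=
        Real.log_le_log (by linarith) (by linarith)
      have h4 : 1 / (N + 3 : ℝ) ≤ Real.log (N + 3 : ℝ) - Real.log (N + 2 : ℝ) := by
        rw [← Real.log_div (by linarith) (by linarith)]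
        refine le_trans (le_of_eq ?_) (Real.one_sub_inv_le_log_of_pos (by positivity))
        field_simp
        ring
      have h5 : 1 / ((N + 3 : ℝ) * Real.log (N + 3 : ℝ) ^ 2) ≤
          1 / Real.log (N + 2 : ℝ) - 1 / Real.log (N + 3 : ℝ) := by
        calc 1 / ((N + 3 : ℝ) * Real.log (N + 3 : ℝ) ^ 2)
            = 1 / (N + 3 : ℝ) / (Real.log (N + 3 : ℝ) * Real.log (N + 3 : ℝ)) := by
              rw [div_div, sq]
          _ ≤ (Real.log (N + 3 : ℝ) - Real.log (N + 2 : ℝ)) /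
                (Real.log (N + 2 : ℝ) * Real.log (N + 3 : ℝ)) := by
              have h6 : 0 < Real.log (N + 3 : ℝ) := h2.trans_le h3
              have h7 : 0 ≤ Real.log (N + 3 : ℝ) - Real.log (N + 2 : ℝ) := by linarith
              gcongr
          _ = _ := by
              have h6 : 0 < Real.log (N + 3 : ℝ) := h2.trans_le h3
              field_simp
      linarith
  refine (Finset.sum_le_sum_of_subset_of_nonneg (Finset.range_subset_range.2 (by omega : N ≤ N + 3))
    fun _ _ _ => by positivity).trans ((key N).trans ?_)
  have : 0 ≤ Real.log (N + 2 : ℝ) :=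
    Real.log_nonneg (by linarith [(Nat.cast_nonneg N : (0 : ℝ) ≤ N)])
  have : 0 ≤ 1 / Real.log (N + 2 : ℝ) := by positivity
  linarith

lemma exists_sum_inv_tame_le : ∃ C : ℝ, 0 < C ∧ ∀ᶠ j : ℕ in atTop, ∀ A : Finset ℕ,
    (∀ m ∈ A, ∀ n ∈ A, m ≤ n → Nat.totient m ≤ Nat.totient n) → (∀ n ∈ A, Tame j n) →
    ∑ n ∈ A, (1 : ℝ) / n ≤ 1 / j + C / (j * Real.log j ^ 2) := by
  classical
  obtain ⟨C, hC0, hM⟩ := exists_sum_inv_of_small_cofactor_le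
  obtain ⟨C₂, -, hK₂⟩ := exists_sum_inv_of_two_large_primes_le
  obtain ⟨C₃, -, hK₃⟩ := exists_sum_inv_of_three_large_primes_le
  refine ⟨C + 5, by positivity, ?_⟩
  filter_upwards [hM, hK₂, hK₃, eventually_sum_inv_of_medium_prime_le,
    eventually_sum_inv_of_small_prime_le, eventually_sum_inv_of_smooth_cofactor_le,
    eventually_const_mul_log_pow_le C₂ 6, eventually_const_mul_log_pow_le C₃ 8,
    eventually_ge_atTop 20, eventually_le_log 1]
    with j hM hK₂ hK₃ hH hS hD h6 h8 hj hl A hmono hA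
  have hj0 : (0 : ℝ) < j := by exact_mod_cast (by omega : 0 < j)
  set l := Real.log j with hldef
  have hl0 : 0 < l := by linarith
  set ε := 1 / (j * l ^ 2) with hε
  have hsplit : ∀ (B : Finset ℕ) (Q : ℕ → Prop) [DecidablePred Q], ∑ n ∈ B, (1 : ℝ) / n =
      ∑ n ∈ B with Q n, (1 : ℝ) / n + ∑ n ∈ B with ¬ Q n, (1 : ℝ) / n := fun B Q _ =>
    (Finset.sum_filter_add_sum_filter_not B Q _).symm
  rw [hsplit A fun n => ∃ p, p.Prime ∧ p ∣ n ∧ j ^ 5 < p ∧ p * j ^ 6 ≤ maxPrimeFac n]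
  set A₁ := A.filter fun n => ¬ ∃ p, p.Prime ∧ p ∣ n ∧ j ^ 5 < p ∧ p * j ^ 6 ≤ maxPrimeFac n
    with hA₁
  rw [hsplit A₁ fun n => ∃ p, p.Prime ∧ p ∣ n ∧ p ≠ maxPrimeFac n ∧ j ^ 5 < p ∧
    maxPrimeFac n ≤ p * j ^ 6 ∧ ∀ r, r.Prime → r ∣ n → r ≠ maxPrimeFac n → r ≠ p → r ≤ j ^ 5]
  set A₂ := A₁.filter fun n => ¬ ∃ p, p.Prime ∧ p ∣ n ∧ p ≠ maxPrimeFac n ∧ j ^ 5 < p ∧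
    maxPrimeFac n ≤ p * j ^ 6 ∧ ∀ r, r.Prime → r ∣ n → r ≠ maxPrimeFac n → r ≠ p → r ≤ j ^ 5
    with hA₂
  rw [hsplit A₂ fun n => ∃ p, p.Prime ∧ p ∣ n ∧ p ≠ maxPrimeFac n ∧ j ^ 5 < p]
  set A₃ := A₂.filter fun n => ¬ ∃ p, p.Prime ∧ p ∣ n ∧ p ≠ maxPrimeFac n ∧ j ^ 5 < p with hA₃
  rw [hsplit A₃ fun n => ∃ p, p.Prime ∧ p ∣ n ∧ p ≠ maxPrimeFac n ∧ ⌈l ^ 8⌉₊ < p]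
  set A₄ := A₃.filter fun n => ¬ ∃ p, p.Prime ∧ p ∣ n ∧ p ≠ maxPrimeFac n ∧ ⌈l ^ 8⌉₊ < p
    with hA₄
  rw [hsplit A₄ fun n => l / 200 < Real.log ((n / maxPrimeFac n : ℕ) : ℝ)]
  have s₁ : A₁ ⊆ A := Finset.filter_subset _ _
  have s₂ : A₂ ⊆ A := (Finset.filter_subset _ _).trans s₁
  have s₃ : A₃ ⊆ A := (Finset.filter_subset _ _).trans s₂
  have s₄ : A₄ ⊆ A := (Finset.filter_subset _ _).trans s₃
  have hmonof : ∀ B ⊆ A, ∀ m ∈ B, ∀ n ∈ B, m ≤ n → Nat.totient m ≤ Nat.totient n :=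
    fun B hB m hm n hn => hmono m (hB hm) n (hB hn)
  have b₁ := hH _ (hmonof _ (Finset.filter_subset _ _)) fun n hn => ⟨hA n (Finset.mem_filter.1 hn).1, (Finset.mem_filter.1 hn).2⟩
  have b₂ := hK₂ _ fun n hn => ⟨hA n (s₁ (Finset.mem_filter.1 hn).1), (Finset.mem_filter.1 hn).2⟩
  have b₃ := hK₃ (A₂.filter fun n => ∃ p, p.Prime ∧ p ∣ n ∧ p ≠ maxPrimeFac n ∧ j ^ 5 < p) (by
    intro n hn
    obtain ⟨hn2, p, hp, hpn, hpq, hpj⟩ := Finset.mem_filter.1 hn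
    obtain ⟨hn1, hno⟩ := Finset.mem_filter.1 hn2
    have hnoH := (Finset.mem_filter.1 hn1).2
    have hbig : ∀ p, p.Prime → p ∣ n → j ^ 5 < p → maxPrimeFac n ≤ p * j ^ 6 := fun p hp hpn hpj =>
      by_contra fun h => hnoH ⟨p, hp, hpn, hpj, (not_le.1 h).le⟩
    push Not at hno
    obtain ⟨r, hr, hrn, hrq, hrp, hrj⟩ := hno p hp hpn hpq hpj (hbig p hp hpn hpj)
    exact ⟨hA n (s₁ hn1), p, r, hp, hpn, hpq, hr, hrn, hrq, hrp, hbig p hp hpn hpj,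
      hbig r hr hrn hrj⟩)
  have hsmall : ∀ n ∈ A₃, ∀ p, p.Prime → p ∣ n → p ≠ maxPrimeFac n → p ≤ j ^ 5 :=
    fun n hn p hp hpn hpq => by_contra fun h => (Finset.mem_filter.1 hn).2 ⟨p, hp, hpn, hpq, not_le.1 h⟩
  have b₄ := hS _ (hmonof _ ((Finset.filter_subset _ _).trans s₃)) fun n hn =>
    ⟨hA n (s₃ (Finset.mem_filter.1 hn).1), hsmall n (Finset.mem_filter.1 hn).1, (Finset.mem_filter.1 hn).2⟩
  have b₅ := hD (A₄.filter fun n => l / 200 < Real.log ((n / maxPrimeFac n : ℕ) : ℝ)) fun n hn =>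
    ⟨hA n (s₄ (Finset.mem_filter.1 hn).1), fun p hp hpn hpq =>
      by_contra fun h => (Finset.mem_filter.1 (Finset.mem_filter.1 hn).1).2 ⟨p, hp, hpn, hpq, not_le.1 h⟩, (Finset.mem_filter.1 hn).2⟩
  have b₆ := hM (A₄.filter fun n => ¬ l / 200 < Real.log ((n / maxPrimeFac n : ℕ) : ℝ))
    (hmonof _ ((Finset.filter_subset _ _).trans s₄)) fun n hn => ⟨hA n (s₄ (Finset.mem_filter.1 hn).1), not_lt.1 (Finset.mem_filter.1 hn).2⟩
  have k₂ : C₂ * l ^ 4 / j ^ 2 ≤ ε := by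
    rw [hε, div_le_div_iff₀ (by positivity) (by positivity)]
    nlinarith
  have k₃ : C₃ * l ^ 6 / j ^ 2 ≤ ε := by
    rw [hε, div_le_div_iff₀ (by positivity) (by positivity)]
    nlinarith
  have e : (C + 5) / (j * l ^ 2) = C / (j * l ^ 2) + 5 * ε := by rw [hε]; ring
  rw [e]
  linarith

lemma exists_sum_inv_dyadic_le : ∃ C : ℝ, 0 < C ∧ ∀ᶠ j : ℕ in atTop, ∀ A : Finset ℕ,
    (∀ m ∈ A, ∀ n ∈ A, m ≤ n → Nat.totient m ≤ Nat.totient n) →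
    (∀ n ∈ A, 2 ^ j ≤ n ∧ n < 2 * 2 ^ j) →
    ∑ n ∈ A, (1 : ℝ) / n ≤ 1 / j + C / (j * Real.log j ^ 2) := by
  classical
  obtain ⟨C, hC0, hC⟩ := exists_sum_inv_tame_le
  refine ⟨C + 2, by positivity, ?_⟩
  filter_upwards [hC, eventually_ge_atTop 20, eventually_le_log 1,
    eventually_const_mul_log_pow_le 4 2] with j hC hj hl h2 A hmono hA
  have hj3 : (20 : ℝ) ≤ j := by exact_mod_cast hj
  have hj0 : (0 : ℝ) < j := by linarith
  set l := Real.log j with hldef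
  have hl0 : 0 < l := by linarith
  rw [← Finset.sum_filter_add_sum_filter_not A fun n => ∃ b, j ^ 2 < b ∧ b ^ 2 ∣ n]
  set A₁ := A.filter fun n => ¬ ∃ b, j ^ 2 < b ∧ b ^ 2 ∣ n with hA₁
  rw [← Finset.sum_filter_add_sum_filter_not A₁ fun n => j ^ 3 < n.divisors.card]
  have b₁ := sum_inv_of_sq_dvd_le (y := 2 ^ j) (B := j ^ 2) (by positivity) (by positivity)
    (A := A.filter fun n => ∃ b, j ^ 2 < b ∧ b ^ 2 ∣ n) fun n hn => by
      obtain ⟨h, h'⟩ := Finset.mem_filter.1 hn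
      exact ⟨(hA n h).1, (hA n h).2, h'⟩
  have b₂ := sum_inv_of_many_divisors_le (y := 2 ^ j) (T := j ^ 3) (by positivity) (by positivity)
    (A := A₁.filter fun n => j ^ 3 < n.divisors.card) fun n hn => by
      obtain ⟨h, h'⟩ := Finset.mem_filter.1 hn
      have := hA n (Finset.mem_filter.1 h).1
      exact ⟨this.1, this.2, h'⟩
  have b₃ := hC (A₁.filter fun n => ¬ j ^ 3 < n.divisors.card)
    (fun m hm n hn => hmono m (Finset.mem_filter.1 (Finset.mem_filter.1 hm).1).1 n
      (Finset.mem_filter.1 (Finset.mem_filter.1 hn).1).1) fun n hn => by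
      obtain ⟨h, h'⟩ := Finset.mem_filter.1 hn
      obtain ⟨h1, h1'⟩ := Finset.mem_filter.1 h
      exact ⟨(hA n h1).1, (hA n h1).2, fun b hb hbn => h1' ⟨b, hb, hbn⟩, not_lt.1 h'⟩
  have k₁ : 2 / ((j ^ 2 : ℕ) : ℝ) ≤ 1 / (j * l ^ 2) := by
    push_cast
    rw [div_le_div_iff₀ (by positivity) (by positivity)]
    nlinarith
  have k₂ : 2 * (1 + Real.log (2 * (2 ^ j : ℕ))) / ((j ^ 3 : ℕ) : ℝ) ≤ 1 / (j * l ^ 2) := by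
    push_cast
    rw [← pow_succ', Real.log_pow]
    push_cast
    have hlog := Real.log_two_lt_d9
    calc 2 * (1 + ((j : ℝ) + 1) * Real.log 2) / (j : ℝ) ^ 3 ≤ 4 * j / (j : ℝ) ^ 3 := by
          gcongr ?_ / _
          nlinarith
      _ ≤ 1 / (j * l ^ 2) := by
          rw [div_le_div_iff₀ (by positivity) (by positivity)]
          have : (j : ℝ) ^ 2 * (4 * l ^ 2) ≤ j ^ 2 * j := by gcongr
          nlinarith
  have e : (C + 2) / (j * l ^ 2) = C / (j * l ^ 2) + 2 * (1 / (j * l ^ 2)) := by ring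
  rw [e]
  linarith

theorem stmt1 : ∃ C : ℝ, 0 < C ∧ ∀ x : ℝ, 10 ≤ x → ∀ I : Finset ℕ,
    (∀ n ∈ I, 1 ≤ n ∧ (n : ℝ) ≤ x) →
    (∀ m ∈ I, ∀ n ∈ I, m ≤ n → Nat.totient m ≤ Nat.totient n) →
    ∑ n ∈ I, (1 : ℝ) / n ≤ Real.log (Real.log x) + C := by
  obtain ⟨C, hC0, hC⟩ := exists_sum_inv_dyadic_le
  obtain ⟨J₀, hJ₀⟩ := eventually_atTop.1 hC
  set K := 1 / (2 * Real.log 2 ^ 2) + 1 / Real.log 2 with hK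
  have hlog2 := Real.log_two_gt_d9
  have hlog2' := Real.log_two_lt_d9
  refine ⟨2 + C * K + J₀, by positivity, fun x hx I hI hmono => ?_⟩
  set J := Nat.log 2 ⌊x⌋₊ with hJ
  have hx0 : ⌊x⌋₊ ≠ 0 := (Nat.floor_pos.2 (by linarith)).ne'
  have hmaps : ∀ n ∈ I, Nat.log 2 n ∈ Finset.range (J + 1) := fun n hn =>
    Finset.mem_range.2 (Nat.lt_succ_of_le (Nat.log_mono_right (Nat.le_floor (hI n hn).2)))
  rw [← Finset.sum_fiberwise_of_maps_to hmaps]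
  have hblock : ∀ j ∈ Finset.range (J + 1), ∑ n ∈ I with Nat.log 2 n = j, (1 : ℝ) / n ≤
      1 / j + C * (1 / (j * Real.log j ^ 2)) + if j < J₀ then 1 else 0 := by
    intro j _
    have hdy : ∀ n ∈ I.filter fun n => Nat.log 2 n = j, 2 ^ j ≤ n ∧ n < 2 * 2 ^ j := by
      intro n hn
      obtain ⟨hnI, rfl⟩ := Finset.mem_filter.1 hn
      refine ⟨Nat.pow_log_le_self 2 (by have := (hI n hnI).1; omega), ?_⟩
      rw [← pow_succ']
      exact Nat.lt_pow_succ_log_self (by norm_num) n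
    split_ifs with h
    · have := sum_inv_dyadic_le_one (by positivity) hdy
      have : 0 ≤ 1 / (j : ℝ) + C * (1 / (j * Real.log j ^ 2)) := by positivity
      linarith
    · have := hJ₀ j (not_lt.1 h) _ (fun m hm n hn => hmono m (Finset.mem_filter.1 hm).1 n
        (Finset.mem_filter.1 hn).1) hdy
      rw [add_zero, mul_one_div]
      exact this
  refine (Finset.sum_le_sum hblock).trans ?_
  rw [Finset.sum_add_distrib, Finset.sum_add_distrib, ← Finset.mul_sum]
  have h1 : ∑ j ∈ Finset.range (J + 1), (1 : ℝ) / j ≤ 1 + Real.log J := by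
    have := sum_inv_Icc_le_one_add_log (N := J)
    rw [Finset.sum_range_succ', Nat.cast_zero, div_zero, add_zero,
      Finset.range_eq_Ico, Finset.sum_Ico_add' (fun j : ℕ => (1 : ℝ) / j)]
    rwa [zero_add, Finset.Ico_add_one_right_eq_Icc]
  have h2 := sum_range_one_div_mul_log_sq_le (J + 1)
  have h3 : ∑ j ∈ Finset.range (J + 1), (if j < J₀ then (1 : ℝ) else 0) ≤ J₀ := by
    rw [← Finset.sum_filter, Finset.sum_const, nsmul_eq_mul, mul_one]
    have : ((Finset.range (J + 1)).filter fun j => j < J₀).card ≤ (Finset.range J₀).card :=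
      Finset.card_le_card fun j hj => Finset.mem_range.2 (Finset.mem_filter.1 hj).2
    rw [Finset.card_range] at this
    exact_mod_cast this
  have hJ1 : 0 < J := Nat.log_pos (by norm_num) (Nat.le_floor (by push_cast; linarith))
  have hlogx : 0 < Real.log x := Real.log_pos (by linarith)
  have hJx : (J : ℝ) ≤ 2 * Real.log x := by
    have h4 : ((2 ^ J : ℕ) : ℝ) ≤ x :=
      (Nat.cast_le.2 (Nat.pow_log_le_self 2 hx0)).trans (Nat.floor_le (by linarith))
    have h5 := Real.log_le_log (by positivity) h4
    push_cast at h5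
    rw [Real.log_pow] at h5
    have : (0 : ℝ) < J := by exact_mod_cast hJ1
    nlinarith
  have h4 : Real.log J ≤ Real.log 2 + Real.log (Real.log x) := by
    rw [← Real.log_mul (by norm_num) hlogx.ne']
    exact Real.log_le_log (by exact_mod_cast hJ1) hJx
  have h5 := mul_le_mul_of_nonneg_left h2 hC0.le
  linarith
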